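/- arXiv:2106.04002 — 3 statements merged into one kernel-verified Lean document; each statement's English description precedes it below -/
import Mathlib

section
/- Let 1 ≤ p < ∞, let ρ ⊆ [0,1) have 1 as a limit point, and let K ⊆ 𝕋 be compact with m(K) = 0. Then the set 𝒟𝒱_{H^p}^K(𝔻,ρ) is a dense G_δ subset of the Banach space H^p(𝔻). -/
open Complex Metric Set Filter MeasureTheory Polynomial Topology

noncomputable section

/-- The Hardy `p`-norm of a function `f` on the unit disk:
`sup_{0<r<1} ((1/2π) ∫_0^{2π} |f(r e^{iθ})|^p dθ)^{1/p}`. -/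
def hardyNorm (p : ℝ) (f : ℂ → ℂ) : ℝ :=
  ⨆ r : Set.Ioo (0:ℝ) 1,
    ((1 / (2 * Real.pi)) *
      ∫ θ in (0:ℝ)..(2 * Real.pi),
        ‖f (((r : ℝ) : ℂ) * Complex.exp ((θ : ℂ) * Complex.I))‖ ^ p) ^ (1 / p)

/-- Membership in the Hardy space `H^p(𝔻)`: `f` is holomorphic on the unit disk and the
means `((1/2π) ∫_0^{2π} |f(r e^{iθ})|^p dθ)^{1/p}` are uniformly bounded for `0 < r < 1`. -/
def MemHp (p : ℝ) (f : ℂ → ℂ) : Prop :=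
  DifferentiableOn ℂ f (Metric.ball (0:ℂ) 1) ∧
  BddAbove (Set.range fun r : Set.Ioo (0:ℝ) 1 =>
    ((1 / (2 * Real.pi)) *
      ∫ θ in (0:ℝ)..(2 * Real.pi),
        ‖f (((r : ℝ) : ℂ) * Complex.exp ((θ : ℂ) * Complex.I))‖ ^ p) ^ (1 / p))

/-- The Hardy space `H^p(𝔻)` as a type. -/
def HpSpace (p : ℝ) := {f : ℂ → ℂ // MemHp p f}

/-- The norm topology on `H^p(𝔻)`, generated by the open balls of the Hardy norm. -/
instance hpTopology (p : ℝ) : TopologicalSpace (HpSpace p) :=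
  TopologicalSpace.generateFrom
    {U : Set (HpSpace p) | ∃ (f : HpSpace p) (ε : ℝ), 0 < ε ∧
      U = {g : HpSpace p | hardyNorm p (fun z => g.1 z - f.1 z) < ε}}

/-- The arc length measure of a subset `K` of the unit circle `𝕋 ⊆ ℂ`, computed as the
Lebesgue measure of the set of angles `θ ∈ [0, 2π)` with `e^{iθ} ∈ K`. -/
def arcMeasure (K : Set ℂ) : ENNReal :=
  MeasureTheory.volume {θ : ℝ | θ ∈ Set.Ico (0:ℝ) (2 * Real.pi) ∧
    Complex.exp ((θ : ℂ) * Complex.I) ∈ K}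

/-- The class `𝒟𝒱_{H^p}^K(𝔻,ρ)` of functions in `H^p(𝔻)` all of whose derivatives have
universal radial limits on `K` along dilation parameters from `ρ`. -/
def DVHp (p : ℝ) (ρ : Set ℝ) (K : Set ℂ) : Set (HpSpace p) :=
  {f : HpSpace p | ∀ φ : ℂ → ℂ, ContinuousOn φ K →
    ∀ L : Set ℂ, IsCompact L → L ⊆ Metric.ball (0:ℂ) 1 → ∀ l : ℕ,
      ∃ r : ℕ → ℝ, (∀ n, r n ∈ ρ) ∧ StrictMono r ∧
        Filter.Tendsto r Filter.atTop (nhds 1) ∧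
        Filter.Tendsto
          (fun n => ⨆ ζ ∈ K, ⨆ z ∈ L,
            ‖iteratedDeriv l f.1 (((r n : ℝ) : ℂ) * (ζ - z) + z) - φ ζ‖)
          Filter.atTop (nhds 0)}

instance isProbabilityMeasure_unitAddCircle :
    IsProbabilityMeasure (volume : Measure UnitAddCircle) :=
  ⟨UnitAddCircle.measure_univ⟩

/-- The parametrisation of the unit circle by `ℝ / ℤ`, a probability space. -/
abbrev unitPt (x : UnitAddCircle) : ℂ := (AddCircle.toCircle x : ℂ)

lemma norm_unitPt (x : UnitAddCircle) : ‖unitPt x‖ = 1 := Circle.norm_coe _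

@[fun_prop]
lemma continuous_unitPt : Continuous unitPt :=
  continuous_subtype_val.comp AddCircle.continuous_toCircle

lemma integral_unitPt_eq_circleAverage {E : Type*} [NormedAddCommGroup E] [NormedSpace ℝ E]
    (h : ℂ → E) : ∫ x, h (unitPt x) = Real.circleAverage h 0 1 := by
  rw [← UnitAddCircle.intervalIntegral_preimage 0, Real.circleAverage]
  have := intervalIntegral.inv_smul_integral_comp_div
    (fun θ : ℝ => h (circleMap 0 1 (2 * Real.pi * θ))) (2 * Real.pi) (a := 0) (b := 2 * Real.pi)
  have hpi : (2 * Real.pi) ≠ 0 := by positivity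
  rw [zero_div, div_self hpi] at this
  simp only [zero_add]
  have h2 : ∀ a : ℝ, h (unitPt (a : UnitAddCircle)) = h (circleMap 0 1 (2 * Real.pi * a)) := by
    intro a
    simp [unitPt, AddCircle.toCircle_apply_mk, circleMap, Circle.coe_exp]
  simp_rw [h2]
  rw [← this]
  congr 1
  refine intervalIntegral.integral_congr fun x _ => ?_
  have hx : 2 * Real.pi * (x / (2 * Real.pi)) = x := by field_simp
  rw [hx]

lemma exists_unitPt {c : ℂ} (hc : ‖c‖ = 1) : ∃ y, unitPt y = c := by
  obtain ⟨y, hy⟩ := (AddCircle.homeomorphCircle (T := 1) one_ne_zero).surjective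
    ⟨c, by simpa [Submonoid.unitSphere] using hc⟩
  refine ⟨y, ?_⟩
  rw [AddCircle.homeomorphCircle_apply] at hy
  simp [unitPt, hy]

lemma integral_mul_unitPt {E : Type*} [NormedAddCommGroup E] [NormedSpace ℝ E]
    (h : ℂ → E) {c : ℂ} (hc : ‖c‖ = 1) : ∫ x, h (c * unitPt x) = ∫ x, h (unitPt x) := by
  obtain ⟨y, rfl⟩ := exists_unitPt hc
  rw [← integral_add_left_eq_self (fun x => h (unitPt x)) y]
  simp [unitPt, AddCircle.toCircle_add]

lemma integral_conj_unitPt {E : Type*} [NormedAddCommGroup E] [NormedSpace ℝ E]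
    (h : ℂ → E) : ∫ x, h ((starRingEnd ℂ) (unitPt x)) = ∫ x, h (unitPt x) := by
  have h1 : ∀ x, (starRingEnd ℂ) (unitPt x) = (unitPt x)⁻¹ := fun x => by
    simp [unitPt, ← Circle.coe_inv_eq_conj]
  simp_rw [h1]
  rw [integral_unitPt_eq_circleAverage (fun z => h z⁻¹), integral_unitPt_eq_circleAverage,
    Real.circleAverage_zero_one_congr_inv]

lemma integrable_of_continuous_unit {E : Type*} [NormedAddCommGroup E]
    {X : Type*} [TopologicalSpace X] [CompactSpace X] [MeasurableSpace X] [OpensMeasurableSpace X]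
    [SecondCountableTopologyEither X E]
    {μ : Measure X} [IsFiniteMeasure μ] {h : X → E} (hh : Continuous h) : Integrable h μ :=
  hh.integrable_of_hasCompactSupport (HasCompactSupport.of_compactSpace h)

/-- Powers of the modulus of an analytic function satisfy the sub-mean value inequality. -/
lemma norm_rpow_le_integral {g : ℂ → ℂ} (hg : AnalyticOnNhd ℂ g (closedBall 0 1)) {q : ℝ}
    (hq : 0 < q) : ‖g 0‖ ^ q ≤ ∫ x, ‖g (unitPt x)‖ ^ q := by
  by_cases h0 : g 0 = 0
  · rw [h0, norm_zero, Real.zero_rpow hq.ne']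
    exact integral_nonneg fun x => by positivity
  have habs : |(1 : ℝ)| = 1 := abs_one
  have hn : 0 < ‖g 0‖ := norm_pos_iff.2 h0
  set L := Real.log ‖g 0‖ with hL
  have hjen : L ≤ Real.circleAverage (fun z => Real.log ‖g z‖) 0 1 := by
    have := AnalyticOnNhd.circleAverage_log_norm (c := 0) (R := 1) one_ne_zero
      (by rwa [habs]) h0
    rw [this]
    have : 0 ≤ ∑ᶠ u, (MeromorphicOn.divisor g (closedBall 0 |1|) u : ℝ) *
        Real.log (1 * ‖0 - u‖⁻¹) := by
      refine finsum_nonneg fun u => ?_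
      by_cases hu : u ∈ closedBall (0 : ℂ) |1|
      · refine mul_nonneg ?_ ?_
        · exact_mod_cast (MeromorphicOn.AnalyticOnNhd.divisor_nonneg (by rwa [habs])) u
        · by_cases hu0 : u = 0
          · simp [hu0]
          · apply Real.log_nonneg
            rw [one_mul, zero_sub, norm_neg]
            exact (one_le_inv₀ (norm_pos_iff.2 hu0)).2 (by simpa using hu)
      · simp [Function.locallyFinsuppWithin.apply_eq_zero_of_notMem _ hu]
    linarith
  have hcod : ∀ᶠ x in codiscreteWithin (sphere (0 : ℂ) |1|), g x ≠ 0 := by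
    rw [habs]
    apply codiscreteWithin_mono sphere_subset_closedBall
    rcases hg.eqOn_zero_or_eventually_ne_zero_of_preconnected
      (convex_closedBall _ _).isPreconnected with h | h
    · exact absurd (h (by simp)) h0
    · exact h
  rw [integral_unitPt_eq_circleAverage (fun z => ‖g z‖ ^ q)]
  have hint : CircleIntegrable (fun z => Real.log ‖g z‖) 0 1 :=
    (hg.mono (by rw [habs]; exact sphere_subset_closedBall)).meromorphicOn.circleIntegrable_log_norm
  have hcont : ContinuousOn (fun z => ‖g z‖ ^ q) (sphere 0 1) :=
    ((hg.continuousOn.mono sphere_subset_closedBall).norm.rpow_const fun _ _ => Or.inr hq.le)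
  have hintl : CircleIntegrable (fun z => q * (Real.log ‖g z‖)) 0 1 := hint.const_fun_smul (a := q)
  have key : Real.circleAverage (fun z => ‖g 0‖ ^ q * (1 - q * L) +
      ‖g 0‖ ^ q • (q * Real.log ‖g z‖)) 0 1 ≤
      Real.circleAverage (fun z => ‖g z‖ ^ q) 0 1 := by
    have hmax : Real.circleAverage (fun z => max (‖g z‖ ^ q) (‖g 0‖ ^ q * (1 - q * L) +
      ‖g 0‖ ^ q • (q * Real.log ‖g z‖))) 0 1 = Real.circleAverage (fun z => ‖g z‖ ^ q) 0 1 := by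
      apply Real.circleAverage_congr_codiscreteWithin _ one_ne_zero
      filter_upwards [hcod] with z hz
      apply max_eq_left
      have hz' : 0 < ‖g z‖ := norm_pos_iff.2 hz
      have h1 := Real.add_one_le_exp (q * Real.log ‖g z‖ - q * L)
      have h2 : ‖g z‖ ^ q = ‖g 0‖ ^ q * Real.exp (q * Real.log ‖g z‖ - q * L) := by
        rw [Real.rpow_def_of_pos hz', Real.rpow_def_of_pos hn, ← Real.exp_add]
        congr 1
        rw [hL]; ring
      rw [h2, smul_eq_mul, ← mul_add]
      gcongr
      linarith
    rw [← hmax]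
    have i1 : CircleIntegrable (fun z => ‖g 0‖ ^ q * (1 - q * L) +
      ‖g 0‖ ^ q • (q * Real.log ‖g z‖)) 0 1 :=
      (circleIntegrable_const _ _ _).add (hintl.const_fun_smul (a := ‖g 0‖ ^ q))
    have i2 : CircleIntegrable (fun z => ‖g z‖ ^ q) 0 1 := hcont.circleIntegrable zero_le_one
    apply Real.circleAverage_mono i1
    · have e : (fun θ => max (‖g (circleMap 0 1 θ)‖ ^ q) (‖g 0‖ ^ q * (1 - q * L) +
        ‖g 0‖ ^ q • (q * Real.log ‖g (circleMap 0 1 θ)‖))) =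
        (fun θ => ‖g (circleMap 0 1 θ)‖ ^ q) ⊔ (fun θ => (‖g 0‖ ^ q * (1 - q * L) +
        ‖g 0‖ ^ q • (q * Real.log ‖g (circleMap 0 1 θ)‖))) := rfl
      rw [CircleIntegrable, intervalIntegrable_iff] at *
      rw [e]
      exact i2.sup i1
    · intro z _
      exact le_max_right _ _
  refine le_trans ?_ key
  rw [Real.circleAverage_fun_add (circleIntegrable_const _ _ _)
    (hintl.const_fun_smul (a := ‖g 0‖ ^ q)), Real.circleAverage_const,
    Real.circleAverage_fun_smul]
  have : Real.circleAverage (fun z => q * Real.log ‖g z‖) 0 1 =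
    q * Real.circleAverage (fun z => Real.log ‖g z‖) 0 1 :=
    Real.circleAverage_fun_smul (a := q) (f := fun z => Real.log ‖g z‖)
  rw [this, smul_eq_mul, ← mul_add]
  nlinarith [mul_le_mul_of_nonneg_left hjen hq.le, Real.rpow_pos_of_pos hn q,
    mul_nonneg (Real.rpow_pos_of_pos hn q).le (mul_nonneg hq.le (sub_nonneg.2 hjen))]

lemma add_rpow_le {p a b : ℝ} (hp : 1 ≤ p) (ha : 0 ≤ a) (hb : 0 ≤ b) :
    (a + b) ^ p ≤ 2 ^ (p - 1) * (a ^ p + b ^ p) := by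
  have := NNReal.rpow_add_le_mul_rpow_add_rpow ⟨a, ha⟩ ⟨b, hb⟩ hp
  exact_mod_cast this

lemma sub_rpow_final_bound {T κ κ' S D1 D3 : ℝ} (hT2 : 2 ≤ T) (hκ : 0 ≤ κ) (hκi : 0 ≤ κ')
    (hS : 0 ≤ S) (hD1 : 0 ≤ D1) (hD30 : 0 ≤ D3) :
    T / 2 * (T * ((κ * (T / 2 * S) + κ' * (D3 / 2)) / 2) + (κ * (2 * S) + κ' * D1) / 2) ≤
      T ^ 3 * (κ * S + κ' * (D1 + D3)) := by
  have u1 : 0 ≤ κ * S := by positivity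
  have u2 : 0 ≤ κ' * D3 := by positivity
  have u3 : 0 ≤ κ' * D1 := by positivity
  have t2 : T ≤ T ^ 3 := le_self_pow₀ (by linarith) (by norm_num)
  have t3 : T ^ 2 ≤ T ^ 3 := pow_le_pow_right₀ (by linarith) (by norm_num)
  have e1 : T / 2 * (T * ((κ * (T / 2 * S) + κ' * (D3 / 2)) / 2) +
      (κ * (2 * S) + κ' * D1) / 2) = (T ^ 3 / 8 + T / 2) * (κ * S) + T ^ 2 / 8 * (κ' * D3)
      + T / 4 * (κ' * D1) := by ring
  rw [e1]
  have v1 : (T ^ 3 / 8 + T / 2) * (κ * S) ≤ T ^ 3 * (κ * S) := by gcongr; linarith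
  have v2 : T ^ 2 / 8 * (κ' * D3) ≤ T ^ 3 * (κ' * D3) := by
    gcongr
    linarith [sq_nonneg T]
  have v3 : T / 4 * (κ' * D1) ≤ T ^ 3 * (κ' * D1) := by gcongr; linarith
  linarith

lemma norm_sub_rpow_le {p κ : ℝ} (hp : 1 ≤ p) (hκ : 0 < κ) (x y : ℂ) :
    ‖x - y‖ ^ p ≤ 8 ^ p * (κ * (‖x‖ ^ p + ‖y‖ ^ p) +
      κ⁻¹ * ((‖x‖ ^ (p / 2) - ‖y‖ ^ (p / 2)) ^ 2 +
        (‖x‖ ^ p + ‖y‖ ^ p - 2 * ‖(x + y) / 2‖ ^ p))) := by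
  set a := ‖x‖
  set b := ‖y‖
  set c := ‖(x + y) / 2‖ with hc
  set d := ‖x - y‖
  have ha : 0 ≤ a := norm_nonneg _
  have hb : 0 ≤ b := norm_nonneg _
  have hc0 : 0 ≤ c := norm_nonneg _
  have hd : 0 ≤ d := norm_nonneg _
  have hc2 : 2 * c = ‖x + y‖ := by rw [hc, norm_div]; simp; ring
  have hcab : 2 * c ≤ a + b := by rw [hc2]; exact norm_add_le x y
  have hpar : (2 * c) ^ 2 + d ^ 2 = 2 * (a ^ 2 + b ^ 2) := by
    rw [hc2]; exact parallelogram_law_with_norm ℝ x y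
  set e := (a + b) / 2 - c with he
  have he0 : 0 ≤ e := by rw [he]; linarith
  have hq : 0 < p / 2 := by linarith
  have sq_half : ∀ t : ℝ, 0 ≤ t → (t ^ (p / 2)) ^ 2 = t ^ p := fun t ht => by
    rw [← Real.rpow_natCast, ← Real.rpow_mul ht]; congr 1; push_cast; ring
  have hS : 0 ≤ a ^ p + b ^ p := by positivity
  have hD3 : 2 * e ^ p ≤ a ^ p + b ^ p - 2 * c ^ p := by
    have h1 := Real.add_rpow_le_rpow_add he0 hc0 hp
    have h2 := add_rpow_le hp (show 0 ≤ a / 2 by linarith) (show 0 ≤ b / 2 by linarith)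
    rw [show e + c = a / 2 + b / 2 by rw [he]; ring] at h1
    rw [Real.div_rpow ha zero_le_two, Real.div_rpow hb zero_le_two,
      Real.rpow_sub_one two_ne_zero] at h2
    have h3 : (2 : ℝ) ^ p / 2 * (a ^ p / 2 ^ p + b ^ p / 2 ^ p) = (a ^ p + b ^ p) / 2 := by
      have : (2 : ℝ) ^ p ≠ 0 := by positivity
      field_simp
    linarith
  have hdle : d ≤ √(4 * ((a + b) * e)) + |a - b| := by
    have hs := Real.sq_sqrt (show 0 ≤ 4 * ((a + b) * e) by positivity)
    apply le_of_sq_le_sq _ (by positivity)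
    have : d ^ 2 ≤ 4 * ((a + b) * e) + |a - b| ^ 2 := by
      rw [sq_abs, he]; nlinarith
    nlinarith [Real.sqrt_nonneg (4 * ((a + b) * e)), abs_nonneg (a - b)]
  have hsqrt : √(4 * ((a + b) * e)) ^ p = 2 ^ p * ((a + b) ^ (p / 2) * e ^ (p / 2)) := by
    rw [Real.sqrt_eq_rpow, ← Real.rpow_mul (by positivity), Real.mul_rpow (by norm_num)
      (by positivity), Real.mul_rpow (by positivity) he0, show 1 / 2 * p = p / 2 by ring]
    congr 1
    rw [show (4 : ℝ) = 2 ^ (2 : ℝ) by norm_num, ← Real.rpow_mul zero_le_two]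
    congr 1; ring
  have young : ∀ s t : ℝ, s * t ≤ (κ * s ^ 2 + κ⁻¹ * t ^ 2) / 2 := fun s t => by
    have h1 : κ * (s - κ⁻¹ * t) ^ 2 = κ * s ^ 2 + κ⁻¹ * t ^ 2 - 2 * (s * t) := by
      field_simp; ring
    nlinarith [mul_nonneg hκ.le (sq_nonneg (s - κ⁻¹ * t))]
  have hA := young ((a + b) ^ (p / 2)) (e ^ (p / 2))
  rw [sq_half _ (by positivity), sq_half _ he0] at hA
  have hab : |a - b| ^ p ≤ |a ^ (p / 2) - b ^ (p / 2)| * (a ^ (p / 2) + b ^ (p / 2)) := by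
    have key : ∀ u v : ℝ, 0 ≤ v → v ≤ u → (u - v) ^ p ≤ u ^ p - v ^ p := fun u v hv huv => by
      have := Real.add_rpow_le_rpow_add (sub_nonneg.2 huv) hv hp
      rw [sub_add_cancel] at this; linarith
    have e1 : a ^ p - b ^ p = (a ^ (p / 2) - b ^ (p / 2)) * (a ^ (p / 2) + b ^ (p / 2)) := by
      rw [← sq_half a ha, ← sq_half b hb]; ring
    have e2 : 0 ≤ a ^ (p / 2) + b ^ (p / 2) := by positivity
    rw [← abs_of_nonneg e2, ← abs_mul, ← e1]
    rcases le_total b a with h | h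
    · rw [abs_of_nonneg (sub_nonneg.2 h)]
      exact (key a b hb h).trans (le_abs_self _)
    · rw [abs_sub_comm, abs_of_nonneg (sub_nonneg.2 h), abs_sub_comm]
      exact (key b a ha h).trans (le_abs_self _)
  have hB := young (a ^ (p / 2) + b ^ (p / 2)) |a ^ (p / 2) - b ^ (p / 2)|
  rw [sq_abs] at hB
  have hsum : (a ^ (p / 2) + b ^ (p / 2)) ^ 2 ≤ 2 * (a ^ p + b ^ p) := by
    rw [← sq_half a ha, ← sq_half b hb]; nlinarith [sq_nonneg (a ^ (p / 2) - b ^ (p / 2))]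
  set D1 := (a ^ (p / 2) - b ^ (p / 2)) ^ 2 with hD1def
  have hD1 : 0 ≤ D1 := sq_nonneg _
  set D3 := a ^ p + b ^ p - 2 * c ^ p
  have hep : 0 ≤ e ^ p := by positivity
  have hD30 : 0 ≤ D3 := by linarith
  set S := a ^ p + b ^ p
  have hκi : 0 < κ⁻¹ := inv_pos.2 hκ
  set T := (2 : ℝ) ^ p with hT
  have hT2 : 2 ≤ T := by
    have := Real.rpow_le_rpow_of_exponent_le one_le_two hp
    rwa [Real.rpow_one] at this
  have h8 : (8 : ℝ) ^ p = T ^ 3 := by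
    rw [hT, ← Real.rpow_natCast, ← Real.rpow_mul zero_le_two, mul_comm,
      Real.rpow_mul zero_le_two]; norm_num
  have hadd := add_rpow_le hp ha hb
  rw [Real.rpow_sub_one two_ne_zero, ← hT] at hadd
  have step1 : d ^ p ≤ T / 2 * (T * ((κ * (T / 2 * S) + κ⁻¹ * (D3 / 2)) / 2) +
      (κ * (2 * S) + κ⁻¹ * D1) / 2) := by
    calc d ^ p ≤ (√(4 * ((a + b) * e)) + |a - b|) ^ p := by gcongr
      _ ≤ T / 2 * (√(4 * ((a + b) * e)) ^ p + |a - b| ^ p) := by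
        have := add_rpow_le hp (Real.sqrt_nonneg (4 * ((a + b) * e))) (abs_nonneg (a - b))
        rwa [Real.rpow_sub_one two_ne_zero, ← hT] at this
      _ ≤ _ := by
        rw [hsqrt]
        gcongr
        · refine hA.trans ?_
          gcongr
          linarith
        · refine hab.trans ?_
          rw [mul_comm]
          refine hB.trans ?_
          gcongr
  rw [h8]
  exact step1.trans (sub_rpow_final_bound hT2 hκ.le hκi.le hS hD1 hD30)

/-- The `p`-th power mean of `‖f‖` over the circle of radius `r`. -/
def powMean (p : ℝ) (f : ℂ → ℂ) (r : ℝ) : ℝ := ∫ x, ‖f (r * unitPt x)‖ ^ p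

/-- The disk automorphism sending `0` to `s`, scaled by `R`. -/
def mob (R s : ℝ) (w : ℂ) : ℂ := R * (w + s) / (1 + s * w)

section Mob

variable {R s : ℝ} {w : ℂ}

lemma mob_zero : mob R s 0 = R * s := by simp [mob]

lemma mob_denom_ne (hs0 : 0 ≤ s) (hs : s < 1) (hw : ‖w‖ ≤ 1) : 1 + s * w ≠ 0 := by
  intro h
  have h1 : (s : ℂ) * w = -1 := by linear_combination h
  have h2 : s * ‖w‖ = 1 := by
    have := congrArg norm h1
    simpa [abs_of_nonneg hs0] using this
  nlinarith [norm_nonneg w]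

lemma norm_mob_denom_sq :
    ‖1 + s * w‖ ^ 2 - ‖w + s‖ ^ 2 = (1 - s ^ 2) * (1 - ‖w‖ ^ 2) := by
  rw [← normSq_eq_norm_sq, ← normSq_eq_norm_sq, ← normSq_eq_norm_sq]
  simp [normSq_apply]
  ring

lemma norm_mob_le (hR : 0 ≤ R) (hs0 : 0 ≤ s) (hs : s < 1) (hw : ‖w‖ ≤ 1) : ‖mob R s w‖ ≤ R := by
  have hd := norm_pos_iff.2 (mob_denom_ne hs0 hs hw)
  rw [mob, norm_div, norm_mul, norm_real, Real.norm_of_nonneg hR, div_le_iff₀ hd]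
  gcongr
  apply le_of_sq_le_sq _ hd.le
  have h1 : 0 ≤ (1 - s ^ 2) * (1 - ‖w‖ ^ 2) :=
    mul_nonneg (by nlinarith) (by nlinarith [norm_nonneg w])
  have := norm_mob_denom_sq (s := s) (w := w)
  linarith

lemma norm_mob_eq (hR : 0 ≤ R) (hs0 : 0 ≤ s) (hs : s < 1) (hw : ‖w‖ = 1) : ‖mob R s w‖ = R := by
  have hd := norm_pos_iff.2 (mob_denom_ne hs0 hs hw.le)
  rw [mob, norm_div, norm_mul, norm_real, Real.norm_of_nonneg hR, div_eq_iff hd.ne']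
  congr 1
  have := norm_mob_denom_sq (s := s) (w := w)
  rw [hw] at this
  exact (pow_left_inj₀ (norm_nonneg _) (norm_nonneg _) two_ne_zero).1 (by linarith)

lemma conj_mob : (starRingEnd ℂ) (mob R s w) = mob R s ((starRingEnd ℂ) w) := by
  simp [mob]

lemma analyticAt_mob (hs0 : 0 ≤ s) (hs : s < 1) (hw : ‖w‖ ≤ 1) : AnalyticAt ℂ (mob R s) w := by
  unfold mob
  exact ((analyticAt_const.mul (analyticAt_id.add analyticAt_const))).div
    (analyticAt_const.add (analyticAt_const.mul analyticAt_id)) (mob_denom_ne hs0 hs hw)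

lemma continuous_mob_unitPt (hs0 : 0 ≤ s) (hs : s < 1) :
    Continuous fun x => mob R s (unitPt x) :=
  continuous_iff_continuousAt.2 fun x =>
    (analyticAt_mob hs0 hs (norm_unitPt x).le).continuousAt.comp
      continuous_unitPt.continuousAt

end Mob

lemma integral_mul_unitPt_of_norm_eq {E : Type*} [NormedAddCommGroup E] [NormedSpace ℝ E]
    (h : ℂ → E) {c : ℂ} {r : ℝ} (hc : ‖c‖ = r) :
    ∫ x, h (c * unitPt x) = ∫ x, h (r * unitPt x) := by
  rcases eq_or_ne c 0 with rfl | h0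
  · simp only [norm_zero] at hc
    simp [← hc]
  · have hr : (r : ℂ) ≠ 0 := by rw [← hc]; exact_mod_cast norm_ne_zero_iff.2 h0
    rw [← integral_mul_unitPt (fun z => h (r * z)) (c := c / r) (by
      rw [norm_div, norm_real, hc, Real.norm_of_nonneg (hc ▸ norm_nonneg c), div_self]
      exact_mod_cast hr)]
    congr 1 with x
    rw [← mul_assoc, mul_div_cancel₀ _ hr]

lemma integral_norm_sub_apply_zero_rpow_le {g : ℂ → ℂ} (hg : AnalyticOnNhd ℂ g (closedBall 0 1))
    {p κ : ℝ} (hp : 1 ≤ p) (hκ : 0 < κ) :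
    ∫ x, ‖g (unitPt x) - g 0‖ ^ p ≤ 8 ^ p * (κ * ((∫ x, ‖g (unitPt x)‖ ^ p) + ‖g 0‖ ^ p) +
      2 * κ⁻¹ * ((∫ x, ‖g (unitPt x)‖ ^ p) - ‖g 0‖ ^ p)) := by
  have hp0 : 0 < p := by linarith
  have hq0 : 0 < p / 2 := by linarith
  have hc : Continuous fun x => g (unitPt x) :=
    hg.continuousOn.comp_continuous continuous_unitPt fun x => by simp [norm_unitPt]
  have hint : ∀ h : ℂ → ℂ, Continuous h → ∀ q : ℝ, 0 < q →
      Integrable (fun x : UnitAddCircle => ‖h (g (unitPt x))‖ ^ q) := fun h hh q hq =>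
    integrable_of_continuous_unit ((hh.comp hc).norm.rpow_const fun _ => Or.inr hq.le)
  have sq_half : ∀ t : ℝ, 0 ≤ t → (t ^ (p / 2)) ^ 2 = t ^ p := fun t ht => by
    rw [← Real.rpow_natCast, ← Real.rpow_mul ht]; congr 1; push_cast; ring
  have i0 := hint id continuous_id p hp0
  have i1 := hint id continuous_id (p / 2) hq0
  have i2 := hint (fun z => (z + g 0) / 2) (by fun_prop) p hp0
  simp only [id] at i0 i1
  have hmean := norm_rpow_le_integral (g := fun w => (g w + g 0) / 2)
    (fun w hw => ((hg w hw).add analyticAt_const).div_const) hp0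
  have hmean' := norm_rpow_le_integral hg hq0
  simp only [add_self_div_two] at hmean
  have hle : ∀ x, ‖g (unitPt x) - g 0‖ ^ p ≤ 8 ^ p * (κ * (‖g (unitPt x)‖ ^ p + ‖g 0‖ ^ p) +
      κ⁻¹ * (2 * ‖g (unitPt x)‖ ^ p + 2 * ‖g 0‖ ^ p - 2 * ‖g 0‖ ^ (p / 2) *
        ‖g (unitPt x)‖ ^ (p / 2) - 2 * ‖(g (unitPt x) + g 0) / 2‖ ^ p)) := fun x => by
    refine (norm_sub_rpow_le hp hκ (g (unitPt x)) (g 0)).trans (le_of_eq ?_)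
    have e1 := sq_half ‖g (unitPt x)‖ (norm_nonneg _)
    have e2 := sq_half ‖g 0‖ (norm_nonneg _)
    rw [← e1, ← e2]
    ring
  have i3 : Integrable (fun x : UnitAddCircle => 2 * ‖g (unitPt x)‖ ^ p + 2 * ‖g 0‖ ^ p) :=
    (i0.const_mul 2).add (integrable_const _)
  have i4 : Integrable (fun x : UnitAddCircle => 2 * ‖g (unitPt x)‖ ^ p + 2 * ‖g 0‖ ^ p -
      2 * ‖g 0‖ ^ (p / 2) * ‖g (unitPt x)‖ ^ (p / 2)) := i3.sub (i1.const_mul _)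
  have i5 : Integrable (fun x : UnitAddCircle => 2 * ‖g (unitPt x)‖ ^ p + 2 * ‖g 0‖ ^ p -
      2 * ‖g 0‖ ^ (p / 2) * ‖g (unitPt x)‖ ^ (p / 2) - 2 * ‖(g (unitPt x) + g 0) / 2‖ ^ p) :=
    i4.sub (i2.const_mul _)
  have i6 : Integrable (fun x : UnitAddCircle => ‖g (unitPt x)‖ ^ p + ‖g 0‖ ^ p) :=
    i0.add (integrable_const _)
  have i7 := fun h1 h2 : UnitAddCircle → ℝ => fun (e1 : Integrable h1) (e2 : Integrable h2) =>
    (show Integrable (fun x => κ * h1 x + κ⁻¹ * h2 x) from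
      (e1.const_mul κ).add (e2.const_mul κ⁻¹))
  refine (integral_mono (hint (fun z => z - g 0) (by fun_prop) p hp0)
    ((i7 _ _ i6 i5).const_mul (8 ^ p)) hle).trans ?_
  rw [integral_const_mul, integral_add (i6.const_mul κ) (i5.const_mul κ⁻¹), integral_const_mul,
    integral_const_mul, integral_sub i4 (i2.const_mul _), integral_sub i3 (i1.const_mul _),
    integral_add (i0.const_mul 2) (integrable_const _), integral_add i0 (integrable_const _),
    integral_const_mul, integral_const_mul, integral_const_mul]
  simp only [integral_const_mul, integral_const, probReal_univ, one_smul]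
  have hκi : 0 < κ⁻¹ := inv_pos.2 hκ
  rw [mul_assoc 2 κ⁻¹, ← mul_left_comm κ⁻¹ 2]
  gcongr 8 ^ p * (_ + κ⁻¹ * ?_)
  have e2 := sq_half ‖g 0‖ (norm_nonneg _)
  nlinarith [mul_le_mul_of_nonneg_left hmean' (Real.rpow_nonneg (norm_nonneg (g 0)) (p / 2))]

section Dilation

variable {f : ℂ → ℂ} {p R s κ : ℝ}

lemma analyticOnNhd_comp_mul_mob (hf : DifferentiableOn ℂ f (ball 0 1)) (hR : 0 ≤ R) (hR1 : R < 1)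
    (hs0 : 0 ≤ s) (hs : s < 1) {c : ℂ} (hc : ‖c‖ ≤ 1) :
    AnalyticOnNhd ℂ (fun w => f (c * mob R s w)) (closedBall 0 1) := by
  intro w hw
  have hw' : ‖w‖ ≤ 1 := by simpa using hw
  refine AnalyticAt.fun_comp (g := f) (hf.analyticAt (isOpen_ball.mem_nhds ?_))
    (analyticAt_const.mul (analyticAt_mob hs0 hs hw'))
  rw [mem_ball_zero_iff, norm_mul]
  nlinarith [norm_mob_le hR hs0 hs hw', norm_nonneg c, norm_nonneg (mob R s w)]

lemma continuous_comp_of_norm_lt {X : Type*} [TopologicalSpace X]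
    (hf : DifferentiableOn ℂ f (ball 0 1)) {v : X → ℂ} (hv : Continuous v)
    (h : ∀ x, ‖v x‖ < 1) : Continuous fun x => f (v x) :=
  hf.continuousOn.comp_continuous hv fun x => by simpa using h x

lemma continuous_mean_kernel (hf : DifferentiableOn ℂ f (ball 0 1)) (hR : 0 ≤ R) (hR1 : R < 1)
    (hs0 : 0 ≤ s) (hs : s < 1) {c : ℂ} (hc : ‖c‖ ≤ 1) :
    Continuous fun z : UnitAddCircle × UnitAddCircle =>
      f (c * unitPt z.1 * mob R s (unitPt z.2)) := by
  refine continuous_comp_of_norm_lt hf ?_ fun z => ?_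
  · have := (continuous_mob_unitPt (R := R) hs0 hs).comp
      (continuous_snd (X := UnitAddCircle) (Y := UnitAddCircle))
    exact (continuous_const.mul (continuous_unitPt.comp continuous_fst)).mul this
  · rw [norm_mul, norm_mul, norm_unitPt, norm_mob_eq hR hs0 hs (norm_unitPt _), mul_one]
    nlinarith [norm_nonneg c]

lemma norm_mul_unitPt_of_nonneg {r : ℝ} (hr : 0 ≤ r) (x : UnitAddCircle) :
    ‖(r : ℂ) * unitPt x‖ = r := by
  rw [norm_mul, norm_unitPt, mul_one, norm_real, Real.norm_of_nonneg hr]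

lemma continuous_comp_mul_unitPt (hf : DifferentiableOn ℂ f (ball 0 1)) {r : ℝ} (hr : 0 ≤ r)
    (hr1 : r < 1) : Continuous fun x => f (r * unitPt x) :=
  continuous_comp_of_norm_lt hf (by fun_prop) fun x => by
    rwa [norm_mul_unitPt_of_nonneg hr]

lemma integrable_norm_rpow {X : Type*} [TopologicalSpace X] [CompactSpace X] [MeasurableSpace X]
    [OpensMeasurableSpace X] {μ : Measure X} [IsFiniteMeasure μ] {v : X → ℂ} (hv : Continuous v)
    (hp : 0 ≤ p) : Integrable (fun x => ‖v x‖ ^ p) μ :=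
  integrable_of_continuous_unit (hv.norm.rpow_const fun _ => Or.inr hp)

lemma integral_integral_mob (hf : DifferentiableOn ℂ f (ball 0 1)) (hp : 0 ≤ p) (hR : 0 ≤ R)
    (hR1 : R < 1) (hs0 : 0 ≤ s) (hs : s < 1) :
    ∫ t, ∫ x, ‖f (unitPt t * mob R s (unitPt x))‖ ^ p = powMean p f R := by
  have hc := continuous_mean_kernel hf hR hR1 hs0 hs (c := 1) (by simp)
  simp only [one_mul] at hc
  rw [integral_integral_swap (integrable_norm_rpow hc hp)]
  have : ∀ x, ∫ t, ‖f (unitPt t * mob R s (unitPt x))‖ ^ p = powMean p f R := fun x => by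
    simp_rw [mul_comm (unitPt _) (mob _ _ _)]
    exact integral_mul_unitPt_of_norm_eq (fun z => ‖f z‖ ^ p)
      (norm_mob_eq hR hs0 hs (norm_unitPt x))
  simp_rw [this, integral_const, probReal_univ, one_smul]

lemma powMean_mul_eq : powMean p f (R * s) = ∫ t, ‖f (unitPt t * mob R s 0)‖ ^ p := by
  simp only [powMean, mob_zero, ofReal_mul, mul_comm (unitPt _)]

/-- Integral means of holomorphic functions increase with the radius. -/
lemma powMean_mul_le (hf : DifferentiableOn ℂ f (ball 0 1)) (hp : 0 < p) (hR : 0 ≤ R)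
    (hR1 : R < 1) (hs0 : 0 ≤ s) (hs : s < 1) : powMean p f (R * s) ≤ powMean p f R := by
  rw [← integral_integral_mob hf hp.le hR hR1 hs0 hs, powMean_mul_eq]
  have hc := continuous_mean_kernel hf hR hR1 hs0 hs (c := 1) (by simp)
  simp only [one_mul] at hc
  refine integral_mono (integrable_norm_rpow ?_ hp.le)
    (integrable_norm_rpow hc hp.le).integral_prod_left fun t => ?_
  · refine continuous_comp_of_norm_lt hf (by fun_prop) fun t => ?_
    rw [norm_mul, norm_unitPt, one_mul]
    exact (norm_mob_le hR hs0 hs (by simp)).trans_lt hR1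
  · exact norm_rpow_le_integral
      (analyticOnNhd_comp_mul_mob hf hR hR1 hs0 hs (norm_unitPt t).le) hp

lemma powMean_mono (hf : DifferentiableOn ℂ f (ball 0 1)) (hp : 0 < p) {r : ℝ} (hr : 0 ≤ r)
    (hrR : r ≤ R) (hR1 : R < 1) : powMean p f r ≤ powMean p f R := by
  rcases hrR.eq_or_lt with rfl | h
  · rfl
  · have hR : 0 < R := hr.trans_lt h
    have := powMean_mul_le hf hp hR.le hR1 (div_nonneg hr hR.le) ((div_lt_one hR).2 h)
    rwa [mul_div_cancel₀ _ hR.ne'] at this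

lemma integral_norm_sub_mob_le (hf : DifferentiableOn ℂ f (ball 0 1)) (hp : 1 ≤ p) (hκ : 0 < κ)
    (hR : 0 ≤ R) (hR1 : R < 1) (hs0 : 0 ≤ s) (hs : s < 1) :
    ∫ t, ∫ x, ‖f (unitPt t * mob R s (unitPt x)) - f (unitPt t * mob R s 0)‖ ^ p ≤
      8 ^ p * (κ * (powMean p f R + powMean p f (R * s)) +
        2 * κ⁻¹ * (powMean p f R - powMean p f (R * s))) := by
  have hp0 : 0 ≤ p := by linarith
  have hc := continuous_mean_kernel hf hR hR1 hs0 hs (c := 1) (by simp)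
  simp only [one_mul] at hc
  have hc0 : Continuous fun t => f (unitPt t * mob R s 0) := by
    refine continuous_comp_of_norm_lt hf (by fun_prop) fun t => ?_
    rw [norm_mul, norm_unitPt, one_mul]
    exact (norm_mob_le hR hs0 hs (by simp)).trans_lt hR1
  have iX := (integrable_norm_rpow (μ := volume.prod volume) hc hp0).integral_prod_left
  have iY := integrable_norm_rpow (μ := volume) hc0 hp0
  have iD := (integrable_norm_rpow (μ := volume.prod volume)
    (hc.sub (hc0.comp continuous_fst)) hp0).integral_prod_left
  have iS := (iX.add iY).const_mul κ
  have iT := (iX.sub iY).const_mul (2 * κ⁻¹)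
  simp only [Pi.add_apply, Pi.sub_apply] at iS iT
  rw [← integral_integral_mob hf hp0 hR hR1 hs0 hs, powMean_mul_eq, ← integral_add iX iY,
    ← integral_sub iX iY, ← integral_const_mul, ← integral_const_mul, ← integral_add iS iT,
    ← integral_const_mul]
  refine integral_mono iD ((iS.add iT).const_mul _) fun t => ?_
  exact integral_norm_sub_apply_zero_rpow_le
    (analyticOnNhd_comp_mul_mob hf hR hR1 hs0 hs (norm_unitPt t).le) hp hκ

lemma integral_norm_sub_dilate_le_mob (hf : DifferentiableOn ℂ f (ball 0 1)) (hp : 0 < p)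
    (hR : 0 < R) (hR1 : R < 1) (hs0 : 0 ≤ s) (hs : s < 1) :
    powMean p (fun z => f z - f (s ^ 2 * z)) R ≤
      ∫ t, ∫ x, ‖f (unitPt t * mob R s (unitPt x)) - f (unitPt t * mob R s 0)‖ ^ p := by
  have hc := continuous_mean_kernel hf hR.le hR1 hs0 hs (c := s)
    (by rw [norm_real, Real.norm_of_nonneg hs0]; exact hs.le)
  have hcR := continuous_comp_mul_unitPt hf hR.le hR1
  have hcont : Continuous fun z : UnitAddCircle × UnitAddCircle =>
      f (R * unitPt z.1) - f (s * unitPt z.1 * mob R s (unitPt z.2)) :=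
    (hcR.comp continuous_fst).sub hc
  have hint := integrable_norm_rpow (μ := volume.prod volume) hcont hp.le
  have hdil : Continuous fun x => f (R * unitPt x) - f (s ^ 2 * (R * unitPt x)) := by
    refine hcR.sub (continuous_comp_of_norm_lt hf (by fun_prop) fun x => ?_)
    rw [norm_mul, norm_mul_unitPt_of_nonneg hR.le, norm_pow, norm_real, Real.norm_of_nonneg hs0]
    nlinarith
  have h1 : powMean p (fun z => f z - f (s ^ 2 * z)) R ≤
      ∫ t, ∫ x, ‖f (R * unitPt t) - f (s * unitPt t * mob R s (unitPt x))‖ ^ p := by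
    refine integral_mono (integrable_norm_rpow hdil hp.le) hint.integral_prod_left fun t => ?_
    have := norm_rpow_le_integral (g := fun w => f (R * unitPt t) - f (s * unitPt t * mob R s w))
      (fun w hw => analyticAt_const.sub (analyticOnNhd_comp_mul_mob hf hR.le hR1 hs0 hs
        (c := s * unitPt t) (by rw [norm_mul_unitPt_of_nonneg hs0]; exact hs.le) w hw)) hp
    simp only [mob_zero] at this
    refine le_of_eq_of_le ?_ this
    simp only
    congr 4
    ring
  refine h1.trans (le_of_eq ?_)
  rw [integral_integral_swap hint]
  have h2 : ∀ x, ∫ t, ‖f (R * unitPt t) - f (s * unitPt t * mob R s (unitPt x))‖ ^ p =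
      ∫ t, ‖f (unitPt t * mob R s ((starRingEnd ℂ) (unitPt x))) -
        f (unitPt t * mob R s 0)‖ ^ p := fun x => by
    have hm := norm_mob_eq (R := R) hR.le hs0 hs (norm_unitPt x)
    have hRc : (R : ℂ) ≠ 0 := by exact_mod_cast hR.ne'
    rw [← integral_mul_unitPt
      (fun u => ‖f (R * u) - f (s * u * mob R s (unitPt x))‖ ^ p)
      (c := mob R s ((starRingEnd ℂ) (unitPt x)) / R) (by
        rw [← conj_mob, norm_div, norm_conj, hm, norm_real, Real.norm_of_nonneg hR.le,
          div_self hR.ne'])]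
    congr 1 with t
    have e : mob R s ((starRingEnd ℂ) (unitPt x)) * mob R s (unitPt x) = R ^ 2 := by
      rw [← conj_mob, mul_comm, mul_conj, normSq_eq_norm_sq, hm]; push_cast; rfl
    congr 4
    · field_simp
    · rw [mob_zero]
      field_simp
      linear_combination s * e
  simp_rw [h2]
  have hc1 := continuous_mean_kernel hf hR.le hR1 hs0 hs (c := 1) (by simp)
  simp only [one_mul] at hc1
  have hc0 : Continuous fun t => f (unitPt t * mob R s 0) := by
    refine continuous_comp_of_norm_lt hf (by fun_prop) fun t => ?_
    rw [norm_mul, norm_unitPt, one_mul]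
    exact (norm_mob_le hR.le hs0 hs (by simp)).trans_lt hR1
  rw [integral_conj_unitPt (fun u => ∫ t, ‖f (unitPt t * mob R s u) - f (unitPt t * mob R s 0)‖ ^ p),
    integral_integral_swap]
  exact integrable_norm_rpow ((hc1.comp continuous_swap).sub (hc0.comp continuous_snd)) hp.le

end Dilation

section HardyNorm

variable {p : ℝ} {f g : ℂ → ℂ}

lemma powMean_nonneg (p : ℝ) (f : ℂ → ℂ) (r : ℝ) : 0 ≤ powMean p f r :=
  integral_nonneg fun x => by positivity

lemma mean_eq_powMean (p : ℝ) (f : ℂ → ℂ) (r : ℝ) :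
    (1 / (2 * Real.pi)) * ∫ θ in (0:ℝ)..(2 * Real.pi),
      ‖f ((r : ℂ) * Complex.exp ((θ : ℂ) * Complex.I))‖ ^ p = powMean p f r := by
  rw [powMean, integral_unitPt_eq_circleAverage (fun z => ‖f (r * z)‖ ^ p), Real.circleAverage]
  simp [circleMap]

lemma hardyNorm_eq (p : ℝ) (f : ℂ → ℂ) :
    hardyNorm p f = ⨆ r : Ioo (0:ℝ) 1, powMean p f r ^ (1 / p) := by
  simp only [hardyNorm, mean_eq_powMean]

lemma memHp_iff (p : ℝ) (f : ℂ → ℂ) : MemHp p f ↔ DifferentiableOn ℂ f (ball 0 1) ∧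
    BddAbove (range fun r : Ioo (0:ℝ) 1 => powMean p f r ^ (1 / p)) := by
  simp only [MemHp, mean_eq_powMean]

lemma hardyNorm_nonneg (p : ℝ) (f : ℂ → ℂ) : 0 ≤ hardyNorm p f := by
  rw [hardyNorm_eq]
  exact Real.iSup_nonneg fun r => Real.rpow_nonneg (powMean_nonneg _ _ _) _

lemma hardyNorm_le {C : ℝ} (hC : 0 ≤ C) (h : ∀ r ∈ Ioo (0:ℝ) 1, powMean p f r ^ (1 / p) ≤ C) :
    hardyNorm p f ≤ C := by
  rw [hardyNorm_eq]
  exact Real.iSup_le (fun r => h r r.2) hC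

lemma memHp_of_le {C : ℝ} (hf : DifferentiableOn ℂ f (ball 0 1))
    (h : ∀ r ∈ Ioo (0:ℝ) 1, powMean p f r ^ (1 / p) ≤ C) : MemHp p f := by
  rw [memHp_iff]
  refine ⟨hf, C, ?_⟩
  rintro _ ⟨r, rfl⟩
  exact h r r.2

lemma MemHp.mean_le (hf : MemHp p f) {r : ℝ} (hr : r ∈ Ioo (0:ℝ) 1) :
    powMean p f r ^ (1 / p) ≤ hardyNorm p f := by
  rw [hardyNorm_eq]
  exact le_ciSup ((memHp_iff p f).1 hf).2 ⟨r, hr⟩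

lemma MemHp.powMean_le (hp : 0 < p) (hf : MemHp p f) {r : ℝ} (hr : r ∈ Ioo (0:ℝ) 1) :
    powMean p f r ≤ hardyNorm p f ^ p := by
  have := Real.rpow_le_rpow (Real.rpow_nonneg (powMean_nonneg _ _ _) _) (hf.mean_le hr) hp.le
  rwa [← Real.rpow_mul (powMean_nonneg _ _ _), one_div_mul_cancel hp.ne', Real.rpow_one] at this

lemma mean_le_of_powMean_le (hp : 0 < p) {C r : ℝ} (hC : 0 ≤ C) (h : powMean p f r ≤ C ^ p) :
    powMean p f r ^ (1 / p) ≤ C := by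
  have := Real.rpow_le_rpow (powMean_nonneg _ _ _) h (one_div_nonneg.2 hp.le)
  rwa [← Real.rpow_mul hC, mul_one_div_cancel hp.ne', Real.rpow_one] at this

/-- Minkowski's inequality on a circle. -/
lemma mean_sub_le (hp : 1 ≤ p) (hf : DifferentiableOn ℂ f (ball 0 1))
    (hg : DifferentiableOn ℂ g (ball 0 1)) {r : ℝ} (hr : r ∈ Ioo (0:ℝ) 1) :
    powMean p (fun z => f z - g z) r ^ (1 / p) ≤
      powMean p f r ^ (1 / p) + powMean p g r ^ (1 / p) := by
  have hp0 : 0 ≤ p := by linarith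
  have hcf := continuous_comp_mul_unitPt hf hr.1.le hr.2
  have hcg := continuous_comp_mul_unitPt hg hr.1.le hr.2
  have h0 : ENNReal.ofReal p ≠ 0 := by
    rw [Ne, ENNReal.ofReal_eq_zero]; linarith
  have key : ∀ h : UnitAddCircle → ℂ, Continuous h →
      lpNorm h (ENNReal.ofReal p) volume = (∫ x, ‖h x‖ ^ p) ^ (1 / p) := fun h hh => by
    rw [lpNorm_eq_integral_norm_rpow_toReal h0 ENNReal.ofReal_ne_top hh.aestronglyMeasurable,
      ENNReal.toReal_ofReal hp0, one_div]
  have := lpNorm_sub_le (p := ENNReal.ofReal p) (μ := (volume : Measure UnitAddCircle))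
    (hcf.memLp_of_hasCompactSupport (HasCompactSupport.of_compactSpace _))
    (by simpa using hp) (g := fun x => g (r * unitPt x))
  rwa [key _ (hcf.sub hcg), key _ hcf, key _ hcg] at this

lemma MemHp.sub (hp : 1 ≤ p) (hf : MemHp p f) (hg : MemHp p g) :
    MemHp p (fun z => f z - g z) :=
  memHp_of_le (C := hardyNorm p f + hardyNorm p g) (hf.1.sub hg.1) fun _ hr =>
    (mean_sub_le hp hf.1 hg.1 hr).trans (add_le_add (hf.mean_le hr) (hg.mean_le hr))

lemma hardyNorm_sub_le (hp : 1 ≤ p) (hf : MemHp p f) (hg : MemHp p g) :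
    hardyNorm p (fun z => f z - g z) ≤ hardyNorm p f + hardyNorm p g :=
  hardyNorm_le (add_nonneg (hardyNorm_nonneg _ _) (hardyNorm_nonneg _ _)) fun _ hr =>
    (mean_sub_le hp hf.1 hg.1 hr).trans (add_le_add (hf.mean_le hr) (hg.mean_le hr))

lemma hardyNorm_sub_comm (p : ℝ) (f g : ℂ → ℂ) :
    hardyNorm p (fun z => f z - g z) = hardyNorm p (fun z => g z - f z) := by
  simp only [hardyNorm, norm_sub_rev]

lemma hardyNorm_zero (hp : 0 < p) : hardyNorm p (fun _ => 0) = 0 := by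
  simp [hardyNorm_eq, powMean, Real.zero_rpow hp.ne', Real.zero_rpow (inv_ne_zero hp.ne')]

lemma memHp_zero (hp : 0 < p) : MemHp p (fun _ => 0) :=
  memHp_of_le (C := 0) (differentiableOn_const _) fun r _ => by
    simp [powMean, Real.zero_rpow hp.ne', Real.zero_rpow (inv_ne_zero hp.ne')]

lemma MemHp.add (hp : 1 ≤ p) (hf : MemHp p f) (hg : MemHp p g) :
    MemHp p (fun z => f z + g z) := by
  have := hf.sub hp ((memHp_zero (by linarith)).sub hp hg)
  simpa using this

/-- Dilations of a Hardy function converge to it in norm. -/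
lemma MemHp.exists_dilate (hp : 1 ≤ p) (hf : MemHp p f) {ε : ℝ} (hε : 0 < ε) :
    ∃ σ ∈ Ioo (0:ℝ) 1, MemHp p (fun z => f z - f (σ * z)) ∧
      hardyNorm p (fun z => f z - f (σ * z)) ≤ ε := by
  have hp0 : 0 < p := by linarith
  set C := hardyNorm p f ^ p + 1 with hCdef
  have hC1 : 1 ≤ C := by
    have := Real.rpow_nonneg (hardyNorm_nonneg p f) p
    linarith
  have hb : ∀ r ∈ Ioo (0:ℝ) 1, powMean p f r ≤ C := fun r hr =>
    (hf.powMean_le hp0 hr).trans (by linarith)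
  set κ := ε ^ p / (8 ^ p * (4 * C)) with hκ
  have hκ0 : 0 < κ := by positivity
  set δ := ε ^ p / (8 ^ p * (4 * κ⁻¹)) with hδ
  have hδ0 : 0 < δ := by positivity
  have hbdd : BddAbove (range fun r : Ioo (0:ℝ) 1 => powMean p f r) := by
    refine ⟨C, ?_⟩
    rintro _ ⟨r, rfl⟩
    exact hb r r.2
  have : Nonempty (Ioo (0:ℝ) 1) := ⟨⟨1 / 2, by norm_num, by norm_num⟩⟩
  obtain ⟨⟨R₀, hR₀⟩, hlt⟩ := exists_lt_of_lt_ciSup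
    (sub_lt_self (⨆ r : Ioo (0:ℝ) 1, powMean p f r) hδ0)
  simp only at hlt
  set s := (1 + R₀) / 2 with hs
  have hs0 : 0 < s := by rw [hs]; linarith [hR₀.1]
  have hs1 : s < 1 := by rw [hs]; linarith [hR₀.2]
  have hR₀s : R₀ < s := by rw [hs]; linarith [hR₀.2]
  have hdil : DifferentiableOn ℂ (fun z => f z - f (((s ^ 2 : ℝ) : ℂ) * z)) (ball 0 1) := by
    refine hf.1.sub (hf.1.comp (differentiableOn_id.const_mul _) fun z hz => ?_)
    simp only [mem_ball_zero_iff, norm_mul, norm_real, Real.norm_of_nonneg (sq_nonneg s)] at *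
    nlinarith [norm_nonneg z]
  have key : ∀ r ∈ Ioo (0:ℝ) 1, powMean p (fun z => f z - f (((s ^ 2 : ℝ) : ℂ) * z)) r ≤ ε ^ p := by
    intro r hr
    set R := max r (R₀ / s)
    have hR : R ∈ Ioo (0:ℝ) 1 := ⟨hr.1.trans_le (le_max_left _ _),
      max_lt hr.2 ((div_lt_one hs0).2 hR₀s)⟩
    have hRs : R₀ ≤ R * s := (div_le_iff₀ hs0).1 (le_max_right _ _)
    have hRs1 : R * s < 1 := by nlinarith [hR.1, hR.2]
    refine (powMean_mono hdil hp0 hr.1.le (le_max_left _ _) hR.2).trans ?_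
    push_cast
    refine (integral_norm_sub_dilate_le_mob hf.1 hp0 hR.1 hR.2 hs0.le hs1).trans
      ((integral_norm_sub_mob_le hf.1 hp hκ0 hR.1.le hR.2 hs0.le hs1).trans ?_)
    have h1 := hb R hR
    have h2 := hb (R * s) ⟨mul_pos hR.1 hs0, hRs1⟩
    have h3 := le_ciSup hbdd ⟨R, hR⟩
    have h4 := powMean_mono hf.1 hp0 hR₀.1.le hRs hRs1
    simp only at h3
    calc 8 ^ p * (κ * (powMean p f R + powMean p f (R * s)) +
          2 * κ⁻¹ * (powMean p f R - powMean p f (R * s)))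
        ≤ 8 ^ p * (κ * (C + C) + 2 * κ⁻¹ * δ) := by
          gcongr
          linarith
      _ = ε ^ p := by
          rw [hδ, hκ]
          field_simp
          ring
  have key' := fun r hr => mean_le_of_powMean_le hp0 hε.le (key r hr)
  exact ⟨s ^ 2, ⟨by positivity, by nlinarith⟩, memHp_of_le hdil key', hardyNorm_le hε.le key'⟩

/-- Point evaluations are bounded on Hardy space, locally uniformly. -/
lemma MemHp.norm_apply_le (hp : 1 ≤ p) (hf : MemHp p f) {R : ℝ} (hR : R ∈ Ioo (0:ℝ) 1) {w : ℂ}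
    (hw : ‖w‖ < R) : ‖f w‖ ≤ R / (R - ‖w‖) * hardyNorm p f := by
  have hp0 : 0 < p := by linarith
  have habs : |R| = R := abs_of_pos hR.1
  have hd : DiffContOnCl ℂ f (ball 0 |R|) := by
    rw [habs]
    refine DifferentiableOn.diffContOnCl (hf.1.mono ?_)
    rw [closure_ball _ hR.1.ne']
    exact closedBall_subset_ball hR.2
  have h1 := hd.circleAverage_smul_div (w := w) (by rw [habs]; simpa using hw)
  have hcont := continuous_comp_mul_unitPt hf.1 hR.1.le hR.2
  have h2 : Real.circleAverage (fun z => ((z - 0) / (z - w)) • f z) 0 R =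
      ∫ x, ((R * unitPt x - 0) / (R * unitPt x - w)) • f (R * unitPt x) := by
    rw [integral_unitPt_eq_circleAverage
      (fun z => ((R * z - 0) / (R * z - w)) • f (R * z)),
      Real.circleAverage_eq_circleAverage_zero_one]
    simp
  rw [← h1, h2]
  have hi := integrable_of_continuous_unit (μ := (volume : Measure UnitAddCircle)) hcont.norm
  have hjen : (∫ x, ‖f (R * unitPt x)‖) ≤ hardyNorm p f := by
    have := (convexOn_rpow hp).map_integral_le (μ := (volume : Measure UnitAddCircle))
      (f := fun x => ‖f (R * unitPt x)‖)
      (fun x _ => (Real.continuousAt_rpow_const _ _ (Or.inr hp0.le)).continuousWithinAt) isClosed_Ici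
      (Eventually.of_forall fun x => norm_nonneg _) hi (integrable_norm_rpow hcont hp0.le)
    exact (Real.rpow_le_rpow_iff (integral_nonneg fun x => norm_nonneg _) (hardyNorm_nonneg _ _)
      hp0).1 (this.trans (hf.powMean_le hp0 hR))
  refine (norm_integral_le_integral_norm _).trans ?_
  have hpos : 0 < R - ‖w‖ := by linarith
  have hle : ∀ x, ‖((R * unitPt x - 0) / (R * unitPt x - w)) • f (R * unitPt x)‖ ≤
      R / (R - ‖w‖) * ‖f (R * unitPt x)‖ := fun x => by
    rw [norm_smul, norm_div, sub_zero, norm_mul_unitPt_of_nonneg hR.1.le]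
    have hR0 := hR.1.le
    gcongr
    have := norm_sub_norm_le (R * unitPt x) w
    rwa [norm_mul_unitPt_of_nonneg hR.1.le] at this
  refine (integral_mono_of_nonneg (Eventually.of_forall fun x => norm_nonneg _)
    (hi.const_mul _) (Eventually.of_forall hle)).trans ?_
  rw [integral_const_mul]
  gcongr
  exact div_nonneg hR.1.le hpos.le

lemma exists_norm_iteratedDeriv_le (hp : 1 ≤ p) {t : ℝ} (ht : t < 1) (l : ℕ) :
    ∃ C, 0 < C ∧ ∀ f, MemHp p f → ∀ w, ‖w‖ ≤ t → ‖iteratedDeriv l f w‖ ≤ C * hardyNorm p f := by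
  rcases lt_or_ge t 0 with h0 | h0
  · exact ⟨1, one_pos, fun f _ w hw => absurd (norm_nonneg w) (by linarith)⟩
  set d := (1 - t) / 3 with hd
  have hd0 : 0 < d := by rw [hd]; linarith
  have hR : t + 2 * d ∈ Ioo (0:ℝ) 1 := ⟨by linarith, by rw [hd]; linarith⟩
  refine ⟨l.factorial * ((t + 2 * d) / d) / d ^ l, by positivity, fun f hf w hw => ?_⟩
  have hsub : closedBall w d ⊆ ball 0 1 := by
    intro z hz
    rw [mem_ball_zero_iff]
    have := norm_le_norm_add_norm_sub' z w
    have hz' : ‖z - w‖ ≤ d := by simpa [dist_eq_norm] using hz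
    linarith [hR.2]
  have := norm_iteratedDeriv_le_of_forall_mem_sphere_norm_le (C := (t + 2 * d) / d * hardyNorm p f)
    (f := f) (c := w) l hd0
    (DifferentiableOn.diffContOnCl (hf.1.mono (by rwa [closure_ball _ hd0.ne']))) ?_
  · refine this.trans (le_of_eq ?_)
    ring
  · intro z hz
    have hz' : ‖z - w‖ = d := by simpa [dist_eq_norm] using hz
    have hzt : ‖z‖ ≤ t + d := by
      have := norm_le_norm_add_norm_sub' z w
      linarith
    refine (hf.norm_apply_le hp hR (w := z) (by linarith)).trans ?_
    have := hardyNorm_nonneg p f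
    have := hR.1
    gcongr
    linarith

/-- The pseudometric on `H^p` induced by the Hardy norm (functions that agree on the disk are at
distance zero). -/
@[reducible] def hpPseudoMetricAux (hp : 1 ≤ p) : PseudoMetricSpace (HpSpace p) where
  dist f g := hardyNorm p (fun z => f.1 z - g.1 z)
  dist_self f := by simpa using hardyNorm_zero (p := p) (by linarith)
  dist_comm f g := hardyNorm_sub_comm _ _ _
  dist_triangle f g h := by
    have := hardyNorm_sub_le hp (f.2.sub hp g.2) (h.2.sub hp g.2)
    simp only [sub_sub_sub_cancel_right] at this
    rwa [hardyNorm_sub_comm p h.1 g.1] at this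

lemma hpTopology_eq (hp : 1 ≤ p) :
    hpTopology p = (hpPseudoMetricAux hp).toUniformSpace.toTopologicalSpace := by
  let m := hpPseudoMetricAux hp
  have hball : ∀ (f : HpSpace p) (ε : ℝ),
      {g : HpSpace p | hardyNorm p (fun z => g.1 z - f.1 z) < ε} = ball f ε := fun _ _ => rfl
  apply le_antisymm
  · intro s hs
    have hs' : ∀ f ∈ s, ∃ ε > 0, ball f ε ⊆ s := Metric.isOpen_iff.1 hs
    choose! ε hε hsub using hs'
    have : s = ⋃ f ∈ s, ball f (ε f) := by
      refine Subset.antisymm (fun f hf => ?_) (iUnion₂_subset hsub)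
      exact mem_iUnion₂.2 ⟨f, hf, mem_ball_self (hε f hf)⟩
    rw [this]
    exact @isOpen_biUnion _ _ (hpTopology p) _ _ fun f hf =>
      TopologicalSpace.isOpen_generateFrom_of_mem ⟨f, ε f, hε f hf, (hball _ _).symm⟩
  · refine le_generateFrom ?_
    rintro _ ⟨f, ε, -, rfl⟩
    rw [hball]
    exact isOpen_ball

@[reducible] def hpPseudoMetric (hp : 1 ≤ p) : PseudoMetricSpace (HpSpace p) :=
  (hpPseudoMetricAux hp).replaceTopology (hpTopology_eq hp)

lemma hpPseudoMetric_complete (hp : 1 ≤ p) :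
    @CompleteSpace (HpSpace p) (hpPseudoMetric hp).toUniformSpace := by
  let _ := hpPseudoMetric hp
  have hp0 : 0 < p := by linarith
  refine Metric.complete_of_cauchySeq_tendsto fun u hu => ?_
  have hcau : ∀ ε > 0, ∃ N, ∀ m ≥ N, ∀ n ≥ N,
      hardyNorm p (fun z => (u m).1 z - (u n).1 z) < ε := fun ε hε => Metric.cauchySeq_iff.1 hu ε hε
  have hev : ∀ t < 1, ∃ C, 0 < C ∧ ∀ m n, ∀ w, ‖w‖ ≤ t →
      ‖(u m).1 w - (u n).1 w‖ ≤ C * hardyNorm p (fun z => (u m).1 z - (u n).1 z) := fun t ht => by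
    obtain ⟨C, hC, h⟩ := exists_norm_iteratedDeriv_le hp ht 0
    refine ⟨C, hC, fun m n w hw => ?_⟩
    simpa using h _ ((u m).2.sub hp (u n).2) w hw
  have hlim : ∀ w, ‖w‖ < 1 → ∃ a, Tendsto (fun n => (u n).1 w) atTop (𝓝 a) := fun w hw => by
    obtain ⟨C, hC, h⟩ := hev ‖w‖ hw
    refine cauchySeq_tendsto_of_complete (Metric.cauchySeq_iff.2 fun ε hε => ?_)
    obtain ⟨N, hN⟩ := hcau (ε / C) (by positivity)
    refine ⟨N, fun m hm n hn => ?_⟩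
    rw [dist_eq_norm]
    refine (h m n w le_rfl).trans_lt ?_
    have := hN m hm n hn
    rwa [lt_div_iff₀' hC] at this
  choose! F hF using hlim
  have hlu : TendstoLocallyUniformlyOn (fun n => (u n).1) F atTop (ball 0 1) := by
    rw [tendstoLocallyUniformlyOn_iff_forall_isCompact isOpen_ball]
    intro L hL1 hL
    obtain ⟨t, ht, hLt⟩ : ∃ t < 1, L ⊆ closedBall 0 t := by
      obtain ⟨t, ht, h⟩ := exists_lt_subset_ball hL.isClosed hL1
      exact ⟨t, ht, h.trans ball_subset_closedBall⟩
    obtain ⟨C, hC, h⟩ := hev t ht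
    rw [Metric.tendstoUniformlyOn_iff]
    intro ε hε
    obtain ⟨N, hN⟩ := hcau (ε / (2 * C)) (by positivity)
    filter_upwards [eventually_ge_atTop N] with n hn w hw
    have hwt : ‖w‖ ≤ t := by simpa using hLt hw
    have h1 : Tendsto (fun m => ‖(u m).1 w - (u n).1 w‖) atTop (𝓝 ‖F w - (u n).1 w‖) :=
      ((hF w (hwt.trans_lt ht)).sub_const _).norm
    have h2 : ‖F w - (u n).1 w‖ ≤ ε / 2 := by
      refine le_of_tendsto h1 ?_
      filter_upwards [eventually_ge_atTop N] with m hm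
      refine (h m n w hwt).trans ?_
      have := (hN m hm n hn).le
      rw [le_div_iff₀ (by positivity)] at this
      linarith
    rw [dist_eq_norm]
    linarith
  have hFd : DifferentiableOn ℂ F (ball 0 1) :=
    hlu.differentiableOn (Eventually.of_forall fun n => (u n).2.1) isOpen_ball
  have hbound : ∀ ε > 0, ∃ N, ∀ n ≥ N, ∀ r ∈ Ioo (0:ℝ) 1,
      powMean p (fun z => F z - (u n).1 z) r ^ (1 / p) ≤ ε := fun ε hε => by
    obtain ⟨N, hN⟩ := hcau ε hε
    refine ⟨N, fun n hn r hr => mean_le_of_powMean_le hp0 hε.le ?_⟩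
    obtain ⟨C, hC, h⟩ := hev r hr.2
    have hlimr : Tendsto (fun m => powMean p (fun z => (u m).1 z - (u n).1 z) r) atTop
        (𝓝 (powMean p (fun z => F z - (u n).1 z) r)) := by
      refine tendsto_integral_filter_of_dominated_convergence (fun _ => (C * ε) ^ p) ?_ ?_
        (integrable_const _) ?_
      · exact Eventually.of_forall fun m => ((continuous_comp_mul_unitPt
          ((u m).2.1.sub (u n).2.1) hr.1.le hr.2).norm.rpow_const
            fun _ => Or.inr hp0.le).aestronglyMeasurable
      · filter_upwards [eventually_ge_atTop N] with m hm
        refine Eventually.of_forall fun x => ?_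
        rw [Real.norm_of_nonneg (by positivity)]
        refine Real.rpow_le_rpow (norm_nonneg _) ?_ hp0.le
        refine (h m n _ (norm_mul_unitPt_of_nonneg hr.1.le x).le).trans ?_
        have := (hN m hm n hn).le
        gcongr
      · refine Eventually.of_forall fun x => Tendsto.rpow_const ?_ (Or.inr hp0.le)
        exact ((hF _ (by rw [norm_mul_unitPt_of_nonneg hr.1.le]; exact hr.2)).sub_const _).norm
    refine le_of_tendsto hlimr ?_
    filter_upwards [eventually_ge_atTop N] with m hm
    refine (((u m).2.sub hp (u n).2).powMean_le hp0 hr).trans ?_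
    exact Real.rpow_le_rpow (hardyNorm_nonneg _ _) (hN m hm n hn).le hp0.le
  have hFm : MemHp p F := by
    obtain ⟨N, hN⟩ := hbound 1 one_pos
    have := (memHp_of_le (hFd.sub (u N).2.1) (hN N le_rfl)).add hp (u N).2
    simpa using this
  refine ⟨⟨F, hFm⟩, Metric.tendsto_atTop.2 fun ε hε => ?_⟩
  obtain ⟨N, hN⟩ := hbound (ε / 2) (by positivity)
  refine ⟨N, fun n hn => ?_⟩
  refine lt_of_eq_of_lt (hardyNorm_sub_comm p (u n).1 F) ?_
  exact (hardyNorm_le (by positivity) (hN n hn)).trans_lt (by linarith)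

lemma hpSpace_baireSpace (hp : 1 ≤ p) : BaireSpace (HpSpace p) := by
  let _ := hpPseudoMetric hp
  have _ := hpPseudoMetric_complete hp
  infer_instance

end HardyNorm

section Covering

variable {C : Set ℂ}

lemma exists_angle {z : ℂ} (hz : ‖z‖ = 1) :
    ∃ θ ∈ Ico (0:ℝ) (2 * Real.pi), Complex.exp (θ * I) = z := by
  have harg : Complex.exp (z.arg * I) = z := by
    have := norm_mul_exp_arg_mul_I z
    rwa [hz, ofReal_one, one_mul] at this
  have h1 := neg_pi_lt_arg z
  have h2 := arg_le_pi z
  have h3 := Real.pi_pos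
  rcases le_or_gt 0 z.arg with h | h
  · exact ⟨z.arg, ⟨h, by linarith⟩, harg⟩
  · refine ⟨z.arg + 2 * Real.pi, ⟨by linarith, by linarith⟩, ?_⟩
    push_cast
    rw [add_mul, exp_add, exp_two_pi_mul_I, mul_one, harg]

/-- The angles in `[0, 2π)` of the points of `C`. -/
def angles (C : Set ℂ) : Set ℝ :=
  {θ : ℝ | θ ∈ Ico (0:ℝ) (2 * Real.pi) ∧ Complex.exp ((θ : ℂ) * I) ∈ C}

lemma exists_angles (hC : C ⊆ sphere 0 1) {z : ℂ} (hz : z ∈ C) :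
    ∃ θ ∈ angles C, Complex.exp (θ * I) = z := by
  obtain ⟨θ, hθ, rfl⟩ := exists_angle (by simpa using hC hz)
  exact ⟨θ, ⟨hθ, hz⟩, rfl⟩

lemma norm_exp_mul_I_sub_le (x y : ℝ) :
    ‖Complex.exp (x * I) - Complex.exp (y * I)‖ ≤ |x - y| := by
  have h : Complex.exp (x * I) - Complex.exp (y * I) =
      Complex.exp (y * I) * (Complex.exp (I * ((x - y : ℝ) : ℂ)) - 1) := by
    rw [mul_sub, ← exp_add]
    push_cast
    ring_nf
  rw [h, norm_mul, norm_exp_ofReal_mul_I, one_mul]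
  exact Real.norm_exp_I_mul_ofReal_sub_one_le

/-- A compact null subset of the circle is covered by finitely many disks centred on it with small
total radius. -/
lemma exists_finite_cover_sum_lt (hCc : IsCompact C) (hCT : C ⊆ sphere 0 1)
    (hCm : arcMeasure C = 0) {ε : ℝ} (hε : 0 < ε) :
    ∃ (s : Finset ℝ) (δ : ℝ → ℝ), (∀ x ∈ s, 0 < δ x) ∧
      (C ⊆ ⋃ x ∈ s, ball (Complex.exp (x * I)) (δ x)) ∧
      (∀ x ∈ s, Complex.exp (x * I) ∈ C) ∧ ∑ x ∈ s, δ x ≤ ε := by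
  obtain ⟨t, r, -, htA, hr, hcov, hsum⟩ := Besicovitch.exists_closedBall_covering_tsum_measure_le
    (volume : Measure ℝ) (ε := ENNReal.ofReal ε) (by simpa using hε) (fun _ => Ioi 0) (angles C)
    (fun x _ δ hδ => ⟨δ / 2, by simpa using hδ, by constructor <;> linarith⟩)
  have hnull : volume (angles C) = 0 := hCm
  have hcovC : C ⊆ ⋃ x ∈ t, ball (Complex.exp (x * I)) (2 * r x) := by
    intro z hz
    obtain ⟨θ, hθ, rfl⟩ := exists_angles hCT hz
    obtain ⟨x, hx, hθx⟩ := mem_iUnion₂.1 (hcov hθ)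
    refine mem_iUnion₂.2 ⟨x, hx, ?_⟩
    rw [mem_ball, dist_eq_norm]
    have h1 : |θ - x| ≤ r x := by simpa [Real.dist_eq] using hθx
    have h2 : 0 < r x := hr x hx
    linarith [norm_exp_mul_I_sub_le θ x]
  obtain ⟨b, hbt, hb, hbC⟩ := hCc.elim_finite_subcover_image (fun _ _ => isOpen_ball) hcovC
  refine ⟨hb.toFinset, fun x => 2 * r x, fun x hx => ?_, by simpa using hbC, fun x hx => ?_, ?_⟩
  · have : 0 < r x := hr x (hbt (by simpa using hx))
    positivity
  · exact (htA (hbt (by simpa using hx))).2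
  · rw [hnull, zero_add] at hsum
    have h1 : ∑ x ∈ hb.toFinset, ENNReal.ofReal (2 * r x) ≤ ENNReal.ofReal ε := by
      refine le_trans ?_ hsum
      rw [tsum_subtype t (fun x => volume (closedBall x (r x)))]
      refine le_trans (le_of_eq ?_) (ENNReal.sum_le_tsum hb.toFinset)
      refine Finset.sum_congr rfl fun x hx => ?_
      rw [indicator_of_mem (hbt (by simpa using hx)), Real.volume_closedBall]
    rw [← ENNReal.ofReal_sum_of_nonneg, ENNReal.ofReal_le_ofReal_iff hε.le] at h1
    · exact h1
    · intro x hx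
      have : 0 < r x := hr x (hbt (by simpa using hx))
      positivity

lemma IsPreconnected.subsingleton_of_volume_eq_zero {S : Set ℝ} (hS : IsPreconnected S)
    (h0 : volume S = 0) : S.Subsingleton := by
  have key : ∀ a ∈ S, ∀ b ∈ S, b ≤ a := fun a ha b hb => by
    have := measure_mono_null (hS.Icc_subset ha hb) h0
    rwa [Real.volume_Icc, ENNReal.ofReal_eq_zero, sub_nonpos] at this
  exact fun a ha b hb => le_antisymm (key b hb a ha) (key a ha b hb)

lemma isTotallyDisconnected_of_arcMeasure_eq_zero (hCT : C ⊆ sphere 0 1)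
    (hCm : arcMeasure C = 0) : IsTotallyDisconnected C := by
  have hnull : volume (angles C) = 0 := hCm
  have hproj : ∀ f : ℂ → ℝ, Continuous f →
      Differentiable ℝ (fun θ : ℝ => f (Complex.exp (θ * I))) →
      ∀ S ⊆ C, IsPreconnected S → (f '' S).Subsingleton := fun f hf hd S hS hSc => by
    refine (hSc.image f hf.continuousOn).subsingleton_of_volume_eq_zero ?_
    refine measure_mono_null ?_
      (addHaar_image_eq_zero_of_differentiableOn_of_addHaar_eq_zero volume hd.differentiableOn hnull)
    rintro _ ⟨z, hz, rfl⟩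
    obtain ⟨θ, hθ, rfl⟩ := exists_angles hCT (hS hz)
    exact ⟨θ, hθ, rfl⟩
  intro S hS hSc z hz w hw
  apply Complex.ext
  · refine hproj re continuous_re ?_ S hS hSc (mem_image_of_mem _ hz) (mem_image_of_mem _ hw)
    simp only [exp_ofReal_mul_I_re]
    exact Real.differentiable_cos
  · refine hproj im continuous_im ?_ S hS hSc (mem_image_of_mem _ hz) (mem_image_of_mem _ hw)
    simp only [exp_ofReal_mul_I_im]
    exact Real.differentiable_sin

end Covering

section PeakFunction

variable {c : ℂ} {δ : ℝ} {z : ℂ}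

lemma re_mul_conj_le (hc : ‖c‖ = 1) (hz : ‖z‖ ≤ 1) : (z * (starRingEnd ℂ) c).re ≤ 1 := by
  refine (re_le_norm _).trans ?_
  rwa [norm_mul, norm_conj, hc, mul_one]

lemma norm_one_sub_mul_conj (hc : ‖c‖ = 1) : ‖1 - z * (starRingEnd ℂ) c‖ = ‖c - z‖ := by
  have : c - z = c * (1 - z * (starRingEnd ℂ) c) := by
    have h : c * (starRingEnd ℂ) c = 1 := by
      rw [mul_conj, normSq_eq_norm_sq, hc]; norm_num
    linear_combination z * h
  rw [this, norm_mul, hc, one_mul]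

/-- A function with nonnegative real part on the disk, comparable to `1` near `c`. -/
def bump (c : ℂ) (δ : ℝ) (z : ℂ) : ℂ := δ / (1 + δ - z * (starRingEnd ℂ) c)

lemma bump_denom_re_pos (hc : ‖c‖ = 1) (hz : ‖z‖ < 1 + δ) :
    0 < (1 + δ - z * (starRingEnd ℂ) c).re := by
  have : (z * (starRingEnd ℂ) c).re ≤ ‖z‖ := by
    refine (re_le_norm _).trans (le_of_eq ?_)
    rw [norm_mul, norm_conj, hc, mul_one]
  simp only [sub_re, add_re, one_re, ofReal_re]
  linarith

lemma bump_re_nonneg (hc : ‖c‖ = 1) (hδ : 0 < δ) (hz : ‖z‖ ≤ 1) : 0 ≤ (bump c δ z).re := by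
  rw [bump, div_eq_mul_inv, re_ofReal_mul, inv_re]
  exact mul_nonneg hδ.le (div_nonneg (bump_denom_re_pos hc (by linarith)).le (normSq_nonneg _))

lemma bump_re_ge (hc : ‖c‖ = 1) (hδ : 0 < δ) (hz : ‖z‖ ≤ 1) (hcz : ‖c - z‖ ≤ δ) :
    1 / 4 ≤ (bump c δ z).re := by
  have h0 := bump_denom_re_pos (c := c) (z := z) (δ := δ) hc (by linarith)
  have e : (bump c δ z).re = δ * ((1 + δ - z * (starRingEnd ℂ) c).re /
      normSq (1 + δ - z * (starRingEnd ℂ) c)) := by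
    rw [bump, div_eq_mul_inv, re_ofReal_mul, inv_re]
  rw [e]
  set w := 1 + (δ : ℂ) - z * (starRingEnd ℂ) c with hw
  have h1 : δ ≤ w.re := by
    have := re_mul_conj_le hc hz
    rw [hw]; simp only [sub_re, add_re, one_re, ofReal_re]; linarith
  have h2 : ‖w‖ ≤ 2 * δ := by
    have e : w = δ + (1 - z * (starRingEnd ℂ) c) := by rw [hw]; ring
    rw [e]
    refine (norm_add_le _ _).trans ?_
    rw [norm_one_sub_mul_conj hc, norm_real, Real.norm_of_nonneg hδ.le]
    linarith
  have h3 : normSq w ≤ (2 * δ) ^ 2 := by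
    rw [normSq_eq_norm_sq]; gcongr
  have h4 : 0 < normSq w := normSq_pos.2 fun h => by rw [h] at h0; simp at h0
  rw [← mul_div_assoc, div_le_div_iff₀ (by norm_num) h4]
  nlinarith

lemma norm_bump_le (hc : ‖c‖ = 1) (hδ : 0 < δ) (hz : ‖z‖ ≤ 1) {d : ℝ} (hd : 0 < d)
    (hcz : d ≤ ‖c - z‖) : ‖bump c δ z‖ ≤ δ / d := by
  rw [bump, norm_div, norm_real, Real.norm_of_nonneg hδ.le]
  gcongr
  refine hcz.trans ?_
  rw [← norm_one_sub_mul_conj hc]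
  have hre := re_mul_conj_le hc hz
  apply le_of_sq_le_sq _ (norm_nonneg _)
  rw [← normSq_eq_norm_sq, ← normSq_eq_norm_sq, normSq_apply, normSq_apply]
  simp only [sub_re, add_re, one_re, ofReal_re, sub_im, add_im, one_im, ofReal_im]
  nlinarith

lemma differentiableAt_bump (hc : ‖c‖ = 1) (hz : ‖z‖ < 1 + δ) :
    DifferentiableAt ℂ (bump c δ) z := by
  unfold bump
  refine (differentiableAt_const _).div (by fun_prop) fun h => ?_
  have := bump_denom_re_pos hc hz
  rw [h] at this
  simp at this

lemma bump_zero_re_le (hδ : 0 < δ) : bump c δ 0 = ((δ / (1 + δ) : ℝ) : ℂ) ∧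
    δ / (1 + δ) ≤ δ := by
  refine ⟨by simp [bump], div_le_self hδ.le (by linarith)⟩

end PeakFunction

lemma integral_comp_mul_unitPt_eq {f : ℂ → ℂ} {R : ℝ} (hf : DifferentiableOn ℂ f (ball 0 R)) {r : ℝ}
    (hr : 0 ≤ r) (hrR : r < R) : ∫ x, f (r * unitPt x) = f 0 := by
  rw [integral_unitPt_eq_circleAverage (fun z => f (r * z))]
  rcases hr.eq_or_lt with rfl | hr0
  · simpa using Real.circleAverage_const (f 0) 0 1
  · have hd : DiffContOnCl ℂ f (ball 0 |r|) := by
      rw [abs_of_pos hr0]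
      refine DifferentiableOn.diffContOnCl (hf.mono ?_)
      rw [closure_ball _ hr0.ne']
      exact closedBall_subset_ball hrR
    have := hd.circleAverage
    rw [Real.circleAverage_eq_circleAverage_zero_one] at this
    simpa using this

/-- Holomorphic functions close to `1` on a compact null set, close to `0` on a disjoint compact
set, and with small integral means. -/
lemma exists_peak {C C' : Set ℂ} (hCc : IsCompact C) (hCT : C ⊆ sphere 0 1)
    (hCm : arcMeasure C = 0) (hC'c : IsCompact C') (hC'T : C' ⊆ sphere 0 1) (hdis : Disjoint C C')
    {η : ℝ} (hη : 0 < η) :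
    ∃ (q : ℂ → ℂ) (R : ℝ), 1 < R ∧ DifferentiableOn ℂ q (ball 0 R) ∧
      (∀ z ∈ closedBall (0:ℂ) 1, ‖q z‖ ≤ 2) ∧ (∀ z ∈ C, ‖q z - 1‖ ≤ η) ∧ (∀ z ∈ C', ‖q z‖ ≤ η) ∧
      ∀ r ∈ Icc (0:ℝ) 1, ∫ x, ‖q (r * unitPt x)‖ ≤ η := by
  obtain ⟨d, hd0, hd⟩ : ∃ d > 0, ∀ x ∈ C, ∀ y ∈ C', d ≤ ‖x - y‖ := by
    obtain ⟨d, hd, h⟩ := hdis.exists_thickenings hCc hC'c.isClosed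
    refine ⟨d, hd, fun x hx y hy => ?_⟩
    by_contra! hlt
    have hyC : y ∈ thickening d C :=
      mem_thickening_iff.2 ⟨x, hx, by rwa [dist_comm, dist_eq_norm]⟩
    exact Set.disjoint_left.1 h hyC (self_subset_thickening hd _ hy)
  obtain ⟨M, hM0, hM⟩ : ∃ M : ℝ, 0 < M ∧ Real.exp (-(M / 4)) ≤ η := by
    refine ⟨4 * max 1 (-Real.log η), by positivity, ?_⟩
    rw [← Real.le_log_iff_exp_le hη]
    have := le_max_right 1 (-Real.log η)
    linarith
  obtain ⟨ε, hε0, hε1, hε2, hε3⟩ : ∃ ε > 0, 2 * M * ε ≤ η ^ 2 ∧ M * (ε / d) ≤ 1 ∧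
      2 * (M * (ε / d)) ≤ η := by
    refine ⟨min (η ^ 2 / (2 * M)) (min (d / M) (η * d / (2 * M))), by positivity, ?_, ?_, ?_⟩
    · have := min_le_left (η ^ 2 / (2 * M)) (min (d / M) (η * d / (2 * M)))
      rwa [le_div_iff₀ (by positivity), mul_comm] at this
    · have := (min_le_right (η ^ 2 / (2 * M)) (min (d / M) (η * d / (2 * M)))).trans (min_le_left _ _)
      rw [le_div_iff₀ hM0] at this
      rw [← mul_div_assoc, div_le_one hd0]
      linarith
    · have := (min_le_right (η ^ 2 / (2 * M)) (min (d / M) (η * d / (2 * M)))).trans (min_le_right _ _)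
      rw [le_div_iff₀ (by positivity)] at this
      rw [← mul_div_assoc, ← mul_div_assoc, div_le_iff₀ hd0]
      linarith
  obtain ⟨s, δ, hδ, hcov, hsC, hsum⟩ := exists_finite_cover_sum_lt hCc hCT hCm hε0
  obtain ⟨m, hm0, hm⟩ : ∃ m > 0, ∀ x ∈ s, m ≤ δ x := by
    rcases s.eq_empty_or_nonempty with rfl | hne
    · exact ⟨1, one_pos, by simp⟩
    · obtain ⟨x, hx, hxmin⟩ := s.exists_min_image δ hne
      exact ⟨δ x, hδ x hx, hxmin⟩
  set F : ℂ → ℂ := fun z => ∑ x ∈ s, bump (Complex.exp (x * I)) (δ x) z with hF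
  have hnorm : ∀ x : ℝ, ‖Complex.exp (x * I)‖ = 1 := norm_exp_ofReal_mul_I
  have hFre : ∀ z, ‖z‖ ≤ 1 → 0 ≤ (F z).re := fun z hz => by
    rw [hF, re_sum]
    exact Finset.sum_nonneg fun x hx => bump_re_nonneg (hnorm x) (hδ x hx) hz
  have hFd : DifferentiableOn ℂ F (ball 0 (1 + m)) := by
    refine DifferentiableOn.fun_sum fun x hx z hz => ?_
    rw [mem_ball_zero_iff] at hz
    exact (differentiableAt_bump (hnorm x)
      (hz.trans_le (by linarith [hm x hx]))).differentiableWithinAt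
  have hEd : DifferentiableOn ℂ (fun z => Complex.exp (-(M * F z))) (ball 0 (1 + m)) :=
    ((hFd.const_mul _).neg).cexp
  have hEn : ∀ z, ‖z‖ ≤ 1 → ‖Complex.exp (-(M * F z))‖ ≤ 1 := fun z hz => by
    rw [norm_exp, Real.exp_le_one_iff, neg_re, re_ofReal_mul, neg_nonpos]
    exact mul_nonneg hM0.le (hFre z hz)
  refine ⟨fun z => 1 - Complex.exp (-(M * F z)), 1 + m, by linarith, hEd.const_sub 1, ?_, ?_, ?_, ?_⟩
  · intro z hz
    refine (norm_sub_le _ _).trans ?_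
    have := hEn z (by simpa using hz)
    rw [norm_one]; linarith
  · intro z hz
    have hz1 : ‖z‖ = 1 := by simpa using hCT hz
    rw [sub_sub_cancel_left, norm_neg, norm_exp, neg_re, re_ofReal_mul]
    refine le_trans (Real.exp_le_exp.2 ?_) hM
    obtain ⟨x, hx, hzx⟩ := mem_iUnion₂.1 (hcov hz)
    have h1 : 1 / 4 ≤ (bump (Complex.exp (x * I)) (δ x) z).re :=
      bump_re_ge (hnorm x) (hδ x hx) hz1.le (by rw [norm_sub_rev, ← dist_eq_norm]; exact hzx.le)
    have h2 : (bump (Complex.exp (x * I)) (δ x) z).re ≤ (F z).re := by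
      rw [hF, re_sum]
      exact Finset.single_le_sum (f := fun x : ℝ => (bump (Complex.exp (x * I)) (δ x) z).re)
        (fun y hy => bump_re_nonneg (hnorm y) (hδ y hy) hz1.le) hx
    nlinarith
  · intro z hz
    have hz1 : ‖z‖ = 1 := by simpa using hC'T hz
    have hFn : ‖F z‖ ≤ ε / d := by
      refine (norm_sum_le _ _).trans ?_
      refine (Finset.sum_le_sum fun x hx => norm_bump_le (hnorm x) (hδ x hx) hz1.le hd0
        (hd _ (hsC x hx) z hz)).trans ?_
      rw [← Finset.sum_div]
      gcongr
    have hMF : ‖-(M * F z)‖ ≤ M * (ε / d) := by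
      rw [norm_neg, norm_mul, norm_real, Real.norm_of_nonneg hM0.le]
      gcongr
    rw [norm_sub_rev]
    refine (norm_exp_sub_one_le (hMF.trans hε2)).trans (le_trans ?_ hε3)
    gcongr
  · intro r hr
    have hcE : Continuous fun x => Complex.exp (-(M * F (r * unitPt x))) :=
      hEd.continuousOn.comp_continuous (by fun_prop) fun x => by
        rw [mem_ball_zero_iff, norm_mul_unitPt_of_nonneg hr.1]; linarith [hr.2]
    have hmean := integral_comp_mul_unitPt_eq hEd hr.1 (hr.2.trans_lt (by linarith))
    have hint : Integrable (fun x => Complex.exp (-(M * F (r * unitPt x)))) :=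
      integrable_of_continuous_unit hcE
    have hF0 : ∃ t : ℝ, F 0 = t ∧ t ≤ ε := by
      refine ⟨∑ x ∈ s, δ x / (1 + δ x), ?_, (Finset.sum_le_sum fun x hx =>
        (bump_zero_re_le (c := 0) (hδ x hx)).2).trans hsum⟩
      rw [hF, ofReal_sum]
      exact Finset.sum_congr rfl fun x hx => (bump_zero_re_le (hδ x hx)).1
    obtain ⟨t, htF, htε⟩ := hF0
    have hpt : ∀ x, ‖1 - Complex.exp (-(M * F (r * unitPt x)))‖ ≤
        (η + η⁻¹ * (2 - 2 * (Complex.exp (-(M * F (r * unitPt x)))).re)) / 2 := fun x => by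
      have h1 := hEn (r * unitPt x) (by rw [norm_mul_unitPt_of_nonneg hr.1]; exact hr.2)
      set E := Complex.exp (-(M * F (r * unitPt x)))
      have h2 : ‖1 - E‖ ^ 2 ≤ 2 - 2 * E.re := by
        have h3 : ‖E‖ ^ 2 ≤ 1 := by nlinarith [norm_nonneg E]
        rw [← normSq_eq_norm_sq, normSq_apply] at *
        simp only [sub_re, one_re, sub_im, one_im]
        nlinarith
      have h4 : 2 * ‖1 - E‖ ≤ η + η⁻¹ * ‖1 - E‖ ^ 2 := by
        have : η + η⁻¹ * ‖1 - E‖ ^ 2 - 2 * ‖1 - E‖ = η⁻¹ * (‖1 - E‖ - η) ^ 2 := by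
          field_simp; ring
        nlinarith [mul_nonneg (inv_nonneg.2 hη.le) (sq_nonneg (‖1 - E‖ - η))]
      have h5 : η⁻¹ * ‖1 - E‖ ^ 2 ≤ η⁻¹ * (2 - 2 * E.re) := by gcongr
      linarith
    have hintre : Integrable (fun x => (Complex.exp (-(M * F (r * unitPt x)))).re) := hint.re
    have hi1 : Integrable (fun x => 2 - 2 * (Complex.exp (-(M * F (r * unitPt x)))).re) :=
      (integrable_const _).sub (hintre.const_mul 2)
    have hi2 : Integrable
        (fun x => η + η⁻¹ * (2 - 2 * (Complex.exp (-(M * F (r * unitPt x)))).re)) :=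
      (integrable_const _).add (hi1.const_mul _)
    refine (integral_mono (integrable_of_continuous_unit (continuous_const.sub hcE).norm)
      (hi2.div_const 2) hpt).trans ?_
    have hre : ∫ x, (Complex.exp (-(M * F (r * unitPt x)))).re = Real.exp (-(M * t)) := by
      have := (integral_re hint).trans (congrArg re hmean)
      refine this.trans ?_
      rw [htF]
      exact_mod_cast exp_ofReal_re (-(M * t))
    rw [integral_div, integral_add (integrable_const _) (hi1.const_mul _), integral_const_mul,
      integral_sub (integrable_const _) (hintre.const_mul 2), integral_const_mul, hre]
    simp only [integral_const, probReal_univ, one_smul]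
    have h6 := Real.add_one_le_exp (-(M * t))
    have h7 : M * t ≤ M * ε := by gcongr
    have h8 : η⁻¹ * (2 - 2 * Real.exp (-(M * t))) ≤ η⁻¹ * η ^ 2 := by
      gcongr
      linarith
    rw [sq, ← mul_assoc, inv_mul_cancel₀ hη.ne', one_mul] at h8
    linarith

/-- A continuous function on a compact null subset of the circle is approximated by boundedly many
holomorphic functions with arbitrarily small integral means. -/
lemma exists_approx_small_mean {K : Set ℂ} (hKc : IsCompact K) (hKT : K ⊆ sphere 0 1)
    (hKm : arcMeasure K = 0) {ψ : ℂ → ℂ} (hψ : ContinuousOn ψ K) {ε : ℝ} (hε : 0 < ε) :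
    ∃ B : ℝ, ∀ η > 0, ∃ (G : ℂ → ℂ) (R : ℝ), 1 < R ∧ DifferentiableOn ℂ G (ball 0 R) ∧
      (∀ z ∈ closedBall (0:ℂ) 1, ‖G z‖ ≤ B) ∧
      (∀ r ∈ Icc (0:ℝ) 1, ∫ x, ‖G (r * unitPt x)‖ ≤ η) ∧ ∀ ζ ∈ K, ‖G ζ - ψ ζ‖ ≤ ε := by
  have : CompactSpace K := isCompact_iff_compactSpace.1 hKc
  have : TotallyDisconnectedSpace K :=
    totallyDisconnectedSpace_subtype_iff.2 (isTotallyDisconnected_of_arcMeasure_eq_zero hKT hKm)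
  obtain ⟨n, g, h, hg, hgh⟩ := ContinuousMap.exists_finite_approximation_of_mem_nhds_diagonal
    (⟨K.domRestrict ψ, hψ.domRestrict⟩ : C(K, ℂ)) (S := {q | dist q.1 q.2 < ε / 2})
      ((isOpen_lt (by fun_prop) continuous_const).mem_nhdsSet.2 fun q hq => by
        have hq : q.1 = q.2 := hq
        simpa [hq] using hε)
  set B := ∑ j, ‖h j‖ with hB
  have hB0 : 0 ≤ B := Finset.sum_nonneg fun j _ => norm_nonneg _
  set C : Fin n → Set ℂ := fun j => (↑) '' (g ⁻¹' {j}) with hC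
  set C' : Fin n → Set ℂ := fun j => (↑) '' (g ⁻¹' {j}ᶜ) with hC'
  have hCK : ∀ j, C j ⊆ K := fun j => by rintro _ ⟨x, -, rfl⟩; exact x.2
  have hCK' : ∀ j, C' j ⊆ K := fun j => by rintro _ ⟨x, -, rfl⟩; exact x.2
  have hCm : ∀ j, arcMeasure (C j) = 0 := fun j =>
    measure_mono_null (show angles (C j) ⊆ angles K from fun θ hθ => ⟨hθ.1, hCK j hθ.2⟩) hKm
  have hCc : ∀ (s : Set (Fin n)), IsCompact ((↑) '' (g ⁻¹' s) : Set ℂ) := fun s =>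
    ((isClosed_discrete s).preimage hg).isCompact.image continuous_subtype_val
  refine ⟨2 * B, fun η hη => ?_⟩
  set κ := min η (ε / 2) / (B + 1) with hκ
  have hκ0 : 0 < κ := by positivity
  have hκB : B * κ ≤ min η (ε / 2) := by
    rw [hκ, ← mul_div_assoc, div_le_iff₀ (by positivity)]
    nlinarith [lt_min hη (half_pos hε)]
  have hpeak : ∀ j, ∃ (q : ℂ → ℂ) (R : ℝ), 1 < R ∧ DifferentiableOn ℂ q (ball 0 R) ∧
      (∀ z ∈ closedBall (0:ℂ) 1, ‖q z‖ ≤ 2) ∧ (∀ z ∈ C j, ‖q z - 1‖ ≤ κ) ∧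
      (∀ z ∈ C' j, ‖q z‖ ≤ κ) ∧ ∀ r ∈ Icc (0:ℝ) 1, ∫ x, ‖q (r * unitPt x)‖ ≤ κ := fun j =>
    exists_peak (hCc _) ((hCK j).trans hKT) (hCm j) (hCc _)
      ((hCK' j).trans hKT)
      ((disjoint_image_iff Subtype.val_injective).2
        (disjoint_compl_right.preimage g)) hκ0
  choose q R hR hqd hq2 hqC hqC' hqm using hpeak
  obtain ⟨R₀, hR₀, hR₀R⟩ : ∃ R₀ > 1, ∀ j, R₀ ≤ R j := by
    rcases isEmpty_or_nonempty (Fin n) with hn | hn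
    · exact ⟨2, one_lt_two, fun j => hn.elim j⟩
    · obtain ⟨j, hj⟩ := Finite.exists_min R
      exact ⟨R j, hR j, hj⟩
  have hsum : ∀ (c : ℝ) (v : Fin n → ℝ), (∀ j, v j ≤ c) → ∑ j, ‖h j‖ * v j ≤ B * c :=
    fun c v hv => by
      rw [hB, Finset.sum_mul]
      exact Finset.sum_le_sum fun j _ => mul_le_mul_of_nonneg_left (hv j) (norm_nonneg _)
  refine ⟨fun z => ∑ j, h j * q j z, R₀, hR₀, ?_, ?_, ?_, ?_⟩
  · exact DifferentiableOn.fun_sum fun j _ => ((hqd j).mono (ball_subset_ball (hR₀R j))).const_mul _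
  · intro z hz
    refine (norm_sum_le _ _).trans ?_
    simp only [norm_mul]
    rw [mul_comm]
    exact hsum 2 _ fun j => hq2 j z hz
  · intro r hr
    have hint : ∀ j, Integrable fun x => ‖h j‖ * ‖q j (r * unitPt x)‖ := fun j => by
      refine (integrable_of_continuous_unit ?_).const_mul _
      refine ((hqd j).continuousOn.comp_continuous (by fun_prop) fun x => ?_).norm
      rw [mem_ball_zero_iff, norm_mul_unitPt_of_nonneg hr.1]
      exact hr.2.trans_lt (hR j)
    calc ∫ x, ‖∑ j, h j * q j (r * unitPt x)‖
        ≤ ∫ x, ∑ j, ‖h j‖ * ‖q j (r * unitPt x)‖ := by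
          refine integral_mono_of_nonneg (.of_forall fun x => norm_nonneg _)
            (integrable_finsetSum _ fun j _ => hint j) (.of_forall fun x => ?_)
          refine (norm_sum_le _ _).trans (le_of_eq ?_)
          simp only [norm_mul]
      _ = ∑ j, ‖h j‖ * ∫ x, ‖q j (r * unitPt x)‖ := by
          rw [integral_finsetSum _ fun j _ => hint j]
          simp only [integral_const_mul]
      _ ≤ B * κ := hsum κ _ fun j => hqm j r hr
      _ ≤ η := hκB.trans (min_le_left _ _)
  · intro ζ hζ
    set i := g ⟨ζ, hζ⟩ with hi
    have h1 : ‖∑ j, h j * q j ζ - h i‖ ≤ ε / 2 := by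
      have e : h i = ∑ j, h j * (if j = i then 1 else 0) := by simp
      rw [e, ← Finset.sum_sub_distrib]
      simp only [← mul_sub]
      refine (norm_sum_le _ _).trans ?_
      simp only [norm_mul]
      refine (hsum κ _ fun j => ?_).trans (hκB.trans (min_le_right _ _))
      split_ifs with hj
      · exact hqC j ζ ⟨⟨ζ, hζ⟩, hj.symm, rfl⟩
      · rw [sub_zero]
        exact hqC' j ζ ⟨⟨ζ, hζ⟩, fun h => hj h.symm, rfl⟩
    have h2 : dist (ψ ζ) (h i) < ε / 2 := hgh ⟨ζ, hζ⟩
    rw [dist_comm, dist_eq_norm] at h2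
    calc _ = ‖(∑ j, h j * q j ζ - h i) + (h i - ψ ζ)‖ := by rw [sub_add_sub_cancel]
      _ ≤ _ := norm_add_le _ _
      _ ≤ ε := by linarith

lemma exists_antideriv {G : ℂ → ℂ} {R B η : ℝ} (hR : 1 < R) (hG : DifferentiableOn ℂ G (ball 0 R))
    (hB : ∀ z ∈ closedBall (0:ℂ) 1, ‖G z‖ ≤ B)
    (hη : ∀ r ∈ Icc (0:ℝ) 1, ∫ x, ‖G (r * unitPt x)‖ ≤ η) :
    ∃ g : ℂ → ℂ, (∀ z ∈ ball (0:ℂ) R, HasDerivAt g (G z) z) ∧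
      (∀ z ∈ closedBall (0:ℂ) 1, ‖g z‖ ≤ B) ∧
      ∀ r ∈ Icc (0:ℝ) 1, ∫ x, ‖g (r * unitPt x)‖ ≤ η := by
  obtain ⟨g, hg0, hg⟩ := hG.isExactOn_ball.with_val_at 0 0
  have hmem : ∀ (t : unitInterval) (z : ℂ), ‖z‖ ≤ 1 → ((t : ℝ) : ℂ) * z ∈ closedBall (0:ℂ) 1 :=
    fun t z hz => by
      rw [mem_closedBall_zero_iff, norm_mul, norm_real, Real.norm_of_nonneg t.2.1]
      exact mul_le_one₀ t.2.2 (norm_nonneg _) hz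
  have hGc : ContinuousOn G (closedBall 0 1) :=
    hG.continuousOn.mono (closedBall_subset_ball hR)
  have hle : ∀ z ∈ closedBall (0:ℂ) 1, ‖g z‖ ≤ ∫ t : unitInterval, ‖G ((t : ℝ) * z)‖ := by
    intro z hz
    have hz1 : ‖z‖ ≤ 1 := by simpa using hz
    have hpath : ∀ t ∈ uIcc (0:ℝ) 1, (t : ℂ) * z ∈ closedBall (0:ℂ) 1 := fun t ht =>
      hmem ⟨t, by rwa [uIcc_of_le zero_le_one] at ht⟩ z hz1
    have hd : ∀ t ∈ uIcc (0:ℝ) 1,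
        HasDerivAt (fun t : ℝ => g (t * z)) (G (t * z) * z) t := fun t ht => by
      have h1 : HasDerivAt (fun w : ℂ => w * z) z (t : ℂ) := by
        simpa using (hasDerivAt_id (t : ℂ)).mul_const z
      exact ((hg _ (closedBall_subset_ball hR (hpath t ht))).comp (t : ℂ) h1).comp_ofReal
    have hc : ContinuousOn (fun t : ℝ => G (t * z)) (uIcc 0 1) :=
      hGc.comp (by fun_prop) hpath
    have hftc := intervalIntegral.integral_eq_sub_of_hasDerivAt hd
      (hc.mul continuousOn_const).intervalIntegrable
    have e : g z = ∫ t in (0:ℝ)..1, G (t * z) * z := by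
      rw [hftc]; simp [hg0]
    rw [e]
    refine (intervalIntegral.norm_integral_le_integral_norm zero_le_one).trans ?_
    have e2 : ∫ t : unitInterval, ‖G ((t : ℝ) * z)‖ = ∫ t in (0:ℝ)..1, ‖G (t * z)‖ := by
      rw [intervalIntegral.integral_of_le zero_le_one, ← integral_Icc_eq_integral_Ioc]
      exact integral_subtype_comap measurableSet_Icc (fun t : ℝ => ‖G (t * z)‖)
    rw [e2]
    refine intervalIntegral.integral_mono_on zero_le_one
      (hc.mul continuousOn_const).norm.intervalIntegrable hc.norm.intervalIntegrable fun t ht => ?_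
    rw [norm_mul]
    exact mul_le_of_le_one_right (norm_nonneg _) hz1
  refine ⟨g, hg, fun z hz => (hle z hz).trans ?_, fun r hr => ?_⟩
  · have hz1 : ‖z‖ ≤ 1 := by simpa using hz
    have hc : Continuous fun t : unitInterval => ‖G ((t : ℝ) * z)‖ :=
      (hGc.comp_continuous (by fun_prop) fun t => hmem t z hz1).norm
    refine (integral_mono (integrable_of_continuous_unit hc) (integrable_const B)
      fun t => hB _ (hmem t z hz1)).trans ?_
    simp
  · have hu : ∀ x, ‖(r : ℂ) * unitPt x‖ ≤ 1 := fun x => by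
      rw [norm_mul_unitPt_of_nonneg hr.1]; exact hr.2
    have hgc : Continuous fun x => ‖g (r * unitPt x)‖ := by
      have : ContinuousOn g (ball 0 R) := fun z hz => (hg z hz).continuousAt.continuousWithinAt
      exact (this.comp_continuous (by fun_prop) fun x => mem_ball_zero_iff.2
        ((hu x).trans_lt hR)).norm
    have hc : Continuous fun w : UnitAddCircle × unitInterval =>
        ‖G ((w.2 : ℝ) * (r * unitPt w.1))‖ := by
      have hv : Continuous fun w : UnitAddCircle × unitInterval =>
          ((w.2 : ℝ) : ℂ) * (r * unitPt w.1) :=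
        (continuous_ofReal.comp (continuous_subtype_val.comp continuous_snd)).mul
          (continuous_const.mul (continuous_unitPt.comp continuous_fst))
      exact (hGc.comp_continuous hv fun w => hmem w.2 _ (hu w.1)).norm
    have hint := integrable_of_continuous_unit
      (μ := (volume : Measure UnitAddCircle).prod (volume : Measure unitInterval)) hc
    have hint₁ : Integrable fun x => ∫ t : unitInterval, ‖G ((t : ℝ) * (r * unitPt x))‖ :=
      hint.integral_prod_left
    have hpt : ∀ x, ‖g (r * unitPt x)‖ ≤ ∫ t : unitInterval, ‖G ((t : ℝ) * (r * unitPt x))‖ :=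
      fun x => hle _ (mem_closedBall_zero_iff.2 (hu x))
    refine (integral_mono (integrable_of_continuous_unit hgc) hint₁ hpt).trans ?_
    rw [integral_integral_swap hint]
    refine (integral_mono hint.integral_prod_right (integrable_const η) fun t => ?_).trans (by simp)
    have := hη (t * r) ⟨mul_nonneg t.2.1 hr.1, mul_le_one₀ t.2.2 hr.1 hr.2⟩
    simpa [mul_assoc] using this

lemma exists_iterated_antideriv {R B η : ℝ} (hR : 1 < R) (l : ℕ) : ∀ {G : ℂ → ℂ},
    DifferentiableOn ℂ G (ball 0 R) → (∀ z ∈ closedBall (0:ℂ) 1, ‖G z‖ ≤ B) →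
    (∀ r ∈ Icc (0:ℝ) 1, ∫ x, ‖G (r * unitPt x)‖ ≤ η) →
    ∃ g : ℂ → ℂ, DifferentiableOn ℂ g (ball 0 R) ∧
      (∀ z ∈ ball (0:ℂ) R, iteratedDeriv l g z = G z) ∧
      (∀ z ∈ closedBall (0:ℂ) 1, ‖g z‖ ≤ B) ∧
      ∀ r ∈ Icc (0:ℝ) 1, ∫ x, ‖g (r * unitPt x)‖ ≤ η := by
  induction l with
  | zero => exact fun hG hB hη => ⟨_, hG, fun z _ => by simp, hB, hη⟩
  | succ l ih =>
    intro G hG hB hη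
    obtain ⟨g, hgd, hgl, hgB, hgη⟩ := ih hG hB hη
    obtain ⟨h, hh, hhB, hhη⟩ := exists_antideriv hR hgd hgB hgη
    refine ⟨h, fun z hz => (hh z hz).differentiableAt.differentiableWithinAt, fun z hz => ?_,
      hhB, hhη⟩
    have : deriv h =ᶠ[𝓝 z] g := by
      filter_upwards [isOpen_ball.mem_nhds hz] with w hw using (hh w hw).deriv
    rw [iteratedDeriv_succ', this.iteratedDeriv_eq, hgl z hz]

/-- Functions of small Hardy norm, holomorphic past the closed disk, whose `l`-th derivative
approximates a given continuous function on a compact null subset of the circle. -/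
lemma exists_small_approx_iteratedDeriv {p : ℝ} (hp : 1 ≤ p) {K : Set ℂ} (hKc : IsCompact K)
    (hKT : K ⊆ sphere 0 1) (hKm : arcMeasure K = 0) {ψ : ℂ → ℂ} (hψ : ContinuousOn ψ K) {ε : ℝ}
    (hε : 0 < ε) (l : ℕ) :
    ∃ (h : ℂ → ℂ) (R : ℝ), 1 < R ∧ DifferentiableOn ℂ h (ball 0 R) ∧ MemHp p h ∧
      hardyNorm p h ≤ ε ∧ ∀ ζ ∈ K, ‖iteratedDeriv l h ζ - ψ ζ‖ ≤ ε := by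
  have hp0 : 0 < p := by linarith
  obtain ⟨B₀, hB₀⟩ := exists_approx_small_mean hKc hKT hKm hψ hε
  set B := max B₀ 1
  have hB0 : 0 < B := by positivity
  obtain ⟨G, R, hR, hG, hGB, hGm, hGK⟩ := hB₀ (ε ^ p / B ^ (p - 1)) (by positivity)
  obtain ⟨h, hd, hl, hhB, hhm⟩ := exists_iterated_antideriv hR l hG
    (fun z hz => (hGB z hz).trans (le_max_left _ 1)) hGm
  have hd1 : DifferentiableOn ℂ h (ball 0 1) := hd.mono (ball_subset_ball hR.le)
  have hmean : ∀ r ∈ Ioo (0:ℝ) 1, powMean p h r ^ (1 / p) ≤ ε := fun r hr => by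
    refine mean_le_of_powMean_le hp0 hε.le ?_
    have hc := continuous_comp_mul_unitPt hd1 hr.1.le hr.2
    have hpt : ∀ x, ‖h (r * unitPt x)‖ ^ p ≤ B ^ (p - 1) * ‖h (r * unitPt x)‖ := fun x => by
      have h1 : ‖h (r * unitPt x)‖ ≤ B := hhB _ (by
        rw [mem_closedBall_zero_iff, norm_mul_unitPt_of_nonneg hr.1.le]; exact hr.2.le)
      have h2 : ‖h (r * unitPt x)‖ ^ p = ‖h (r * unitPt x)‖ ^ (p - 1) * ‖h (r * unitPt x)‖ := by
        have := Real.rpow_add_one' (x := ‖h (r * unitPt x)‖) (y := p - 1) (norm_nonneg _)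
          (by rw [sub_add_cancel]; exact hp0.ne')
        rwa [sub_add_cancel] at this
      rw [h2]
      exact mul_le_mul_of_nonneg_right
        (Real.rpow_le_rpow (norm_nonneg _) h1 (by linarith)) (norm_nonneg _)
    calc powMean p h r ≤ ∫ x, B ^ (p - 1) * ‖h (r * unitPt x)‖ :=
          integral_mono (integrable_norm_rpow hc hp0.le)
            ((integrable_of_continuous_unit hc.norm).const_mul _) hpt
      _ = B ^ (p - 1) * ∫ x, ‖h (r * unitPt x)‖ := integral_const_mul _ _
      _ ≤ B ^ (p - 1) * (ε ^ p / B ^ (p - 1)) := by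
          gcongr
          exact hhm r (Ioo_subset_Icc_self hr)
      _ = ε ^ p := mul_div_cancel₀ _ (by positivity)
  refine ⟨h, R, hR, hd, memHp_of_le hd1 hmean, hardyNorm_le hε.le hmean, fun ζ hζ => ?_⟩
  rw [hl ζ (by rw [mem_ball_zero_iff, mem_sphere_zero_iff_norm.1 (hKT hζ)]; exact hR)]
  exact hGK ζ hζ

section IteratedDeriv

variable {f g : ℂ → ℂ} {U : Set ℂ}

lemma DifferentiableOn.iteratedDeriv_of_isOpen (hf : DifferentiableOn ℂ f U) (hU : IsOpen U)
    (l : ℕ) : DifferentiableOn ℂ (iteratedDeriv l f) U := by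
  induction l with
  | zero => simpa using hf
  | succ l ih => rw [iteratedDeriv_succ]; exact ih.deriv hU

lemma iteratedDeriv_add_of_isOpen (hf : DifferentiableOn ℂ f U) (hg : DifferentiableOn ℂ g U)
    (hU : IsOpen U) (l : ℕ) {z : ℂ} (hz : z ∈ U) :
    iteratedDeriv l (fun w => f w + g w) z = iteratedDeriv l f z + iteratedDeriv l g z :=
  iteratedDeriv_add (hf.analyticAt (hU.mem_nhds hz)).contDiffAt
    (hg.analyticAt (hU.mem_nhds hz)).contDiffAt

lemma iteratedDeriv_sub_of_isOpen (hf : DifferentiableOn ℂ f U) (hg : DifferentiableOn ℂ g U)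
    (hU : IsOpen U) (l : ℕ) {z : ℂ} (hz : z ∈ U) :
    iteratedDeriv l (fun w => f w - g w) z = iteratedDeriv l f z - iteratedDeriv l g z :=
  iteratedDeriv_sub (hf.analyticAt (hU.mem_nhds hz)).contDiffAt
    (hg.analyticAt (hU.mem_nhds hz)).contDiffAt

end IteratedDeriv

section Universality

variable {p : ℝ} {ρ : Set ℝ} {K : Set ℂ} {φ : ℂ → ℂ} {l : ℕ} {t ε : ℝ}

/-- The Hardy functions whose `l`-th derivative is, for some dilation parameter in `ρ` close to `1`,
uniformly close to `φ` on `K`. -/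
def approxSet (p : ℝ) (ρ : Set ℝ) (K : Set ℂ) (φ : ℂ → ℂ) (l : ℕ) (t ε : ℝ) : Set (HpSpace p) :=
  {f | ∃ r ∈ ρ, 1 - ε < r ∧ ∃ c < ε, ∀ ζ ∈ K, ∀ z ∈ closedBall (0:ℂ) t,
    ‖iteratedDeriv l f.1 ((r : ℂ) * (ζ - z) + z) - φ ζ‖ ≤ c}

lemma norm_radial_le {r : ℝ} (hr : r ∈ Ico (0:ℝ) 1) {ζ z : ℂ} (hζ : ‖ζ‖ = 1) (hz : ‖z‖ ≤ t) :
    ‖(r : ℂ) * (ζ - z) + z‖ ≤ r + (1 - r) * t := by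
  have e : (r : ℂ) * (ζ - z) + z = r * ζ + ((1 - r : ℝ) : ℂ) * z := by push_cast; ring
  have h1 : 0 ≤ 1 - r := by linarith [hr.2]
  rw [e]
  refine (norm_add_le _ _).trans ?_
  rw [norm_mul, norm_mul, hζ, norm_real, norm_real, Real.norm_of_nonneg hr.1, mul_one,
    Real.norm_of_nonneg h1]
  gcongr

lemma radial_radius_lt {r : ℝ} (hr : r ∈ Ico (0:ℝ) 1) (ht : t < 1) : r + (1 - r) * t < 1 := by
  nlinarith [mul_pos (sub_pos.2 hr.2) (sub_pos.2 ht)]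

lemma isOpen_approxSet (hp : 1 ≤ p) (hρ : ρ ⊆ Ico 0 1) (hKT : K ⊆ sphere 0 1) (ht : t < 1) :
    IsOpen (approxSet p ρ K φ l t ε) := by
  let _ := hpPseudoMetric hp
  refine Metric.isOpen_iff.2 ?_
  rintro f ⟨r, hr, hrε, c, hc, hf⟩
  have hR := radial_radius_lt (hρ hr) ht
  obtain ⟨C, hC0, hC⟩ := exists_norm_iteratedDeriv_le hp hR l
  have hεc : 0 < ε - c := sub_pos.2 hc
  refine ⟨(ε - c) / (2 * C), by positivity, fun g hg => ⟨r, hr, hrε, (ε + c) / 2, by linarith,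
    fun ζ hζ z hz => ?_⟩⟩
  have hg : hardyNorm p (fun z => g.1 z - f.1 z) < (ε - c) / (2 * C) := hg
  set w := (r : ℂ) * (ζ - z) + z with hw
  have hwR : ‖w‖ ≤ r + (1 - r) * t :=
    norm_radial_le (hρ hr) (by simpa using hKT hζ) (by simpa using hz)
  have h1 := hC _ (g.2.sub hp f.2) w hwR
  rw [iteratedDeriv_sub_of_isOpen g.2.1 f.2.1 isOpen_ball l
    (mem_ball_zero_iff.2 (hwR.trans_lt hR))] at h1
  have h2 : C * hardyNorm p (fun z => g.1 z - f.1 z) ≤ (ε - c) / 2 := by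
    rw [lt_div_iff₀ (by positivity)] at hg
    linarith
  calc _ = ‖(iteratedDeriv l g.1 w - iteratedDeriv l f.1 w) + (iteratedDeriv l f.1 w - φ ζ)‖ := by
        rw [sub_add_sub_cancel]
    _ ≤ _ := norm_add_le _ _
    _ ≤ (ε + c) / 2 := by linarith [hf ζ hζ z hz]

lemma AccPt.exists_mem_gt (hρ1 : AccPt (1:ℝ) (𝓟 ρ)) {a : ℝ} (ha : a < 1) :
    ∃ r ∈ ρ, a < r := by
  obtain ⟨r, ⟨hr, hrρ⟩, -⟩ := accPt_iff_nhds.1 hρ1 (Ioi a) (Ioi_mem_nhds ha)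
  exact ⟨r, hrρ, hr⟩

lemma dense_approxSet (hp : 1 ≤ p) (hρ : ρ ⊆ Ico 0 1) (hρ1 : AccPt (1:ℝ) (𝓟 ρ))
    (hKc : IsCompact K) (hKT : K ⊆ sphere 0 1) (hKm : arcMeasure K = 0) (hφ : ContinuousOn φ K)
    (ht : t < 1) (hε : 0 < ε) : Dense (approxSet p ρ K φ l t ε) := by
  let _ := hpPseudoMetric hp
  refine Metric.dense_iff.2 fun f κ hκ => ?_
  set μ := min (ε / 3) (κ / 3) with hμ
  have hμ0 : 0 < μ := by positivity
  have hμε : μ ≤ ε / 3 := min_le_left _ _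
  have hμκ : μ ≤ κ / 3 := min_le_right _ _
  obtain ⟨σ, hσ, hσm, hσn⟩ := f.2.exists_dilate hp hμ0
  set a : ℂ → ℂ := fun z => f.1 (σ * z) with ha
  have hσ1 : 1 < σ⁻¹ := (one_lt_inv₀ hσ.1).2 hσ.2
  have had : DifferentiableOn ℂ a (ball 0 σ⁻¹) :=
    f.2.1.comp (by fun_prop) fun z hz => by
      rw [mem_ball_zero_iff] at hz ⊢
      rw [norm_mul, norm_real, Real.norm_of_nonneg hσ.1.le]
      calc σ * ‖z‖ < σ * σ⁻¹ := by gcongr; exact hσ.1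
        _ = 1 := mul_inv_cancel₀ hσ.1.ne'
  have ham : MemHp p a := by
    have := f.2.sub hp hσm
    simpa using this
  have hψ : ContinuousOn (fun ζ => φ ζ - iteratedDeriv l a ζ) K :=
    hφ.sub ((had.iteratedDeriv_of_isOpen isOpen_ball l).continuousOn.mono
      ((hKT.trans sphere_subset_closedBall).trans (closedBall_subset_ball hσ1)))
  obtain ⟨h, R, hR, hhd, hhm, hhn, hhK⟩ :=
    exists_small_approx_iteratedDeriv hp hKc hKT hKm hψ hμ0 l
  set S := min σ⁻¹ R with hS
  have hS1 : 1 < S := lt_min hσ1 hR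
  have haS : DifferentiableOn ℂ a (ball 0 S) := had.mono (ball_subset_ball (min_le_left _ _))
  have hhS : DifferentiableOn ℂ h (ball 0 S) := hhd.mono (ball_subset_ball (min_le_right _ _))
  set F : ℂ → ℂ := fun z => a z + h z with hF
  have hFc : ContinuousOn (iteratedDeriv l F) (closedBall 0 1) :=
    (((haS.add hhS).iteratedDeriv_of_isOpen isOpen_ball l).continuousOn).mono
      (closedBall_subset_ball hS1)
  have hu := (isCompact_closedBall (0:ℂ) 1).uniformContinuousOn_of_continuous hFc
  obtain ⟨δ, hδ0, hδ⟩ := Metric.uniformContinuousOn_iff.1 hu μ hμ0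
  obtain ⟨r, hr, hrgt⟩ := hρ1.exists_mem_gt (a := max (1 - ε) (1 - δ / 2))
    (max_lt (by linarith) (by linarith))
  refine ⟨⟨F, ham.add hp hhm⟩, ?_, r, hr, (le_max_left _ _).trans_lt hrgt, 2 * μ, by linarith,
    fun ζ hζ z hz => ?_⟩
  · have h1 : hardyNorm p (fun z => F z - f.1 z) ≤ 2 * μ := by
      have e : (fun z => F z - f.1 z) = fun z => h z - (f.1 z - f.1 (σ * z)) := by
        funext z; simp only [hF, ha]; ring
      rw [e]
      exact (hardyNorm_sub_le hp hhm hσm).trans (by linarith)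
    exact h1.trans_lt (by linarith)
  · have hζ1 : ‖ζ‖ = 1 := by simpa using hKT hζ
    have hz1 : ‖z‖ ≤ t := by simpa using hz
    have hr1 := (le_max_right _ _).trans_lt hrgt
    have hw : ‖(r : ℂ) * (ζ - z) + z‖ ≤ 1 :=
      (norm_radial_le (hρ hr) hζ1 hz1).trans (radial_radius_lt (hρ hr) ht).le
    have hdist : dist ((r : ℂ) * (ζ - z) + z) ζ < δ := by
      have e : (r : ℂ) * (ζ - z) + z - ζ = ((1 - r : ℝ) : ℂ) * (z - ζ) := by push_cast; ring
      rw [dist_eq_norm, e, norm_mul, norm_real, Real.norm_of_nonneg (by linarith [(hρ hr).2])]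
      have h2 : ‖z - ζ‖ ≤ 2 := (norm_sub_le _ _).trans (by linarith)
      nlinarith [norm_nonneg (z - ζ), (hρ hr).2]
    have h3 := hδ _ (mem_closedBall_zero_iff.2 hw) _ (mem_closedBall_zero_iff.2 hζ1.le) hdist
    rw [dist_eq_norm] at h3
    have h4 := hhK ζ hζ
    have h5 : iteratedDeriv l F ζ = iteratedDeriv l a ζ + iteratedDeriv l h ζ :=
      iteratedDeriv_add_of_isOpen haS hhS isOpen_ball l
        (mem_ball_zero_iff.2 (hζ1.trans_lt hS1))
    have h6 : ‖iteratedDeriv l F ζ - φ ζ‖ ≤ μ := by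
      rw [h5]
      convert h4 using 2
      ring
    calc _ = ‖(iteratedDeriv l F ((r : ℂ) * (ζ - z) + z) - iteratedDeriv l F ζ) +
          (iteratedDeriv l F ζ - φ ζ)‖ := by rw [sub_add_sub_cancel]
      _ ≤ _ := norm_add_le _ _
      _ ≤ 2 * μ := by linarith

lemma exists_dense_seq_continuousOn (hKc : IsCompact K) :
    ∃ φ : ℕ → ℂ → ℂ, (∀ j, ContinuousOn (φ j) K) ∧ ∀ ψ : ℂ → ℂ, ContinuousOn ψ K → ∀ ε > 0,
      ∃ j, ∀ ζ ∈ K, ‖φ j ζ - ψ ζ‖ ≤ ε := by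
  have : CompactSpace K := isCompact_iff_compactSpace.1 hKc
  set u : ℕ → C(K, ℂ) := TopologicalSpace.denseSeq C(K, ℂ)
  have hext : ∀ j (ζ : K), Function.extend (↑) (u j) (0 : ℂ → ℂ) (ζ : ℂ) = u j ζ := fun j =>
    Subtype.val_injective.extend_apply _ _
  refine ⟨fun j => Function.extend (↑) (u j) (0 : ℂ → ℂ), fun j => ?_, fun ψ hψ ε hε => ?_⟩
  · rw [continuousOn_iff_continuous_domRestrict]
    convert (u j).continuous using 1
    funext ζ
    exact hext j ζ
  · obtain ⟨j, hj⟩ := (TopologicalSpace.denseRange_denseSeq C(K, ℂ)).exists_dist_lt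
      ⟨K.domRestrict ψ, hψ.domRestrict⟩ hε
    refine ⟨j, fun ζ hζ => ?_⟩
    beta_reduce
    rw [hext j ⟨ζ, hζ⟩, ← dist_eq_norm, dist_comm]
    exact (ContinuousMap.dist_apply_le_dist (⟨ζ, hζ⟩ : K)).trans hj.le

lemma le_biSup_biSup {α β : Type*} {s : Set α} {u : Set β} {F : α → β → ℝ} {M : ℝ} (hM : 0 ≤ M)
    (hF : ∀ x ∈ s, ∀ y ∈ u, F x y ≤ M) {x : α} (hx : x ∈ s) {y : β} (hy : y ∈ u) :
    F x y ≤ ⨆ x ∈ s, ⨆ y ∈ u, F x y := by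
  have h2 : ∀ x ∈ s, ⨆ y ∈ u, F x y ≤ M := fun x hx =>
    Real.iSup_le (fun y => Real.iSup_le (fun hy => hF x hx y hy) hM) hM
  calc F x y ≤ ⨆ _ : y ∈ u, F x y :=
        le_ciSup (f := fun _ : y ∈ u => F x y) ⟨M, by rintro _ ⟨hy, rfl⟩; exact hF x hx y hy⟩ hy
    _ ≤ ⨆ y ∈ u, F x y :=
        le_ciSup (f := fun y => ⨆ _ : y ∈ u, F x y)
          ⟨M, by rintro _ ⟨y, rfl⟩; exact Real.iSup_le (fun hy => hF x hx y hy) hM⟩ y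
    _ ≤ ⨆ _ : x ∈ s, ⨆ y ∈ u, F x y :=
        le_ciSup (f := fun _ : x ∈ s => ⨆ y ∈ u, F x y)
          ⟨M, by rintro _ ⟨hx, rfl⟩; exact h2 x hx⟩ hx
    _ ≤ ⨆ x ∈ s, ⨆ y ∈ u, F x y :=
        le_ciSup (f := fun x => ⨆ _ : x ∈ s, ⨆ y ∈ u, F x y)
          ⟨M, by rintro _ ⟨x, rfl⟩; exact Real.iSup_le (fun hx => h2 x hx) hM⟩ x

lemma mem_approxSet_of_mem_DVHp (hp : 1 ≤ p) (hρ : ρ ⊆ Ico 0 1) (hKc : IsCompact K)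
    (hKT : K ⊆ sphere 0 1) (hφ : ContinuousOn φ K) (ht : t < 1) (hε : 0 < ε) {f : HpSpace p}
    (hf : f ∈ DVHp p ρ K) : f ∈ approxSet p ρ K φ l t ε := by
  obtain ⟨r, hrρ, -, hr1, hlim⟩ := hf φ hφ (closedBall 0 t) (isCompact_closedBall _ _)
    (closedBall_subset_ball ht) l
  obtain ⟨n, hn, hn'⟩ := ((hr1.eventually_const_lt (sub_lt_self 1 hε)).and
    (hlim.eventually_lt_const hε)).exists
  refine ⟨r n, hrρ n, hn, _, hn', ?_⟩
  obtain ⟨C, hC0, hC⟩ := exists_norm_iteratedDeriv_le hp (radial_radius_lt (hρ (hrρ n)) ht) l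
  obtain ⟨M, hM⟩ := hKc.exists_bound_of_continuousOn hφ
  have hbd : ∀ ζ ∈ K, ∀ z ∈ closedBall (0:ℂ) t,
      ‖iteratedDeriv l f.1 ((r n : ℂ) * (ζ - z) + z) - φ ζ‖ ≤ max (C * hardyNorm p f.1 + M) 0 :=
    fun ζ hζ z hz => by
      refine ((norm_sub_le _ _).trans (add_le_add (hC _ f.2 _ ?_) (hM ζ hζ))).trans (le_max_left _ _)
      exact norm_radial_le (hρ (hrρ n)) (by simpa using hKT hζ) (by simpa using hz)
  exact fun ζ hζ z hz => le_biSup_biSup (le_max_right _ _) hbd hζ hz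

lemma exists_strictMono_subseq_of_tendsto_one {u : ℕ → ℝ} (hu : ∀ n, u n < 1)
    (hlim : Tendsto u atTop (𝓝 1)) : ∃ s : ℕ → ℕ, StrictMono s ∧ StrictMono (u ∘ s) := by
  have h1 : Tendsto (fun n => (1 - u n)⁻¹) atTop atTop := by
    refine tendsto_inv_nhdsGT_zero.comp (tendsto_nhdsWithin_iff.2 ⟨?_, .of_forall fun n => ?_⟩)
    · simpa using hlim.const_sub 1
    · simpa using hu n
  obtain ⟨s, hs, hs'⟩ := strictMono_subseq_of_tendsto_atTop h1
  refine ⟨s, hs, fun a b hab => ?_⟩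
  have := hs' hab
  simp only [Function.comp_apply] at this ⊢
  rw [inv_lt_inv₀ (sub_pos.2 (hu _)) (sub_pos.2 (hu _))] at this
  linarith

lemma mem_DVHp_of_forall_mem_approxSet (hρ : ρ ⊆ Ico 0 1) {Φ : ℕ → ℂ → ℂ}
    (hΦ : ∀ ψ : ℂ → ℂ, ContinuousOn ψ K → ∀ ε > 0, ∃ j, ∀ ζ ∈ K, ‖Φ j ζ - ψ ζ‖ ≤ ε) {T : ℕ → ℝ}
    (hT : ∀ t < 1, ∃ k, t ≤ T k) {f : HpSpace p}
    (hf : ∀ j l k n : ℕ, f ∈ approxSet p ρ K (Φ j) l (T k) (1 / (n + 1))) : f ∈ DVHp p ρ K := by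
  intro φ hφ L hLc hL l
  obtain ⟨t, ht, hLt⟩ := exists_lt_subset_ball hLc.isClosed hL
  obtain ⟨k, hk⟩ := hT t ht
  have hLk : L ⊆ closedBall 0 (T k) :=
    (hLt.trans ball_subset_closedBall).trans (closedBall_subset_closedBall hk)
  have hstep : ∀ n : ℕ, ∃ r ∈ ρ, 1 - 1 / ((n : ℝ) + 1) < r ∧ ∀ ζ ∈ K, ∀ z ∈ L,
      ‖iteratedDeriv l f.1 ((r : ℂ) * (ζ - z) + z) - φ ζ‖ ≤ 2 * (1 / (n + 1)) := fun n => by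
    obtain ⟨j, hj⟩ := hΦ φ hφ (1 / ((n : ℝ) + 1)) (by positivity)
    obtain ⟨r, hr, hr1, c, hc, hfc⟩ := hf j l k n
    refine ⟨r, hr, hr1, fun ζ hζ z hz => ?_⟩
    have h1 := hfc ζ hζ z (hLk hz)
    have h2 := hj ζ hζ
    rw [← sub_add_sub_cancel _ (Φ j ζ)]
    exact (norm_add_le _ _).trans (by linarith)
  choose u huρ hu1 huL using hstep
  have hult : ∀ n, u n < 1 := fun n => (hρ (huρ n)).2
  have h0 := tendsto_one_div_add_atTop_nhds_zero_nat (𝕜 := ℝ)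
  have hlim : Tendsto u atTop (𝓝 1) :=
    tendsto_of_tendsto_of_tendsto_of_le_of_le (by simpa using h0.const_sub 1) tendsto_const_nhds
      (fun n => (hu1 n).le) (fun n => (hult n).le)
  obtain ⟨s, hs, hus⟩ := exists_strictMono_subseq_of_tendsto_one hult hlim
  refine ⟨u ∘ s, fun n => huρ _, hus, hlim.comp hs.tendsto_atTop, ?_⟩
  have h2 : Tendsto (fun n => 2 * (1 / ((s n : ℝ) + 1))) atTop (𝓝 0) := by
    simpa using (h0.comp hs.tendsto_atTop).const_mul 2
  refine squeeze_zero (fun n => ?_) (fun n => ?_) h2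
  · exact Real.iSup_nonneg fun ζ => Real.iSup_nonneg fun _ => Real.iSup_nonneg fun z =>
      Real.iSup_nonneg fun _ => norm_nonneg _
  · have hb : (0:ℝ) ≤ 2 * (1 / ((s n : ℝ) + 1)) := by positivity
    exact Real.iSup_le (fun ζ => Real.iSup_le (fun hζ => Real.iSup_le (fun z =>
      Real.iSup_le (fun hz => huL (s n) ζ hζ z hz) hb) hb) hb) hb

end Universality

/-- Theorem (hardydermain): for `1 ≤ p < ∞`, `ρ ⊆ [0,1)` with `1` as a limit point and
`K ⊆ 𝕋` compact of zero arc length, `𝒟𝒱_{H^p}^K(𝔻,ρ)` is a dense `G_δ` subset of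
`H^p(𝔻)`. -/
theorem statement_9 (p : ℝ) (hp : 1 ≤ p)
    (ρ : Set ℝ) (hρ : ρ ⊆ Set.Ico (0:ℝ) 1) (hρ1 : AccPt (1:ℝ) (Filter.principal ρ))
    (K : Set ℂ) (hKc : IsCompact K) (hKT : K ⊆ Metric.sphere (0:ℂ) 1)
    (hKm : arcMeasure K = 0) :
    IsGδ (DVHp p ρ K) ∧ Dense (DVHp p ρ K) := by
  have := hpSpace_baireSpace hp
  obtain ⟨Φ, hΦc, hΦ⟩ := exists_dense_seq_continuousOn hKc
  set T : ℕ → ℝ := fun k => 1 - 1 / ((k : ℝ) + 1) with hTdef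
  have hT1 : ∀ k, T k < 1 := fun k => sub_lt_self _ (by positivity)
  have hT : ∀ t < 1, ∃ k, t ≤ T k := fun t ht => by
    obtain ⟨k, hk⟩ := exists_nat_one_div_lt (sub_pos.2 ht)
    exact ⟨k, by simp only [hTdef]; linarith⟩
  set U : ℕ × ℕ × ℕ × ℕ → Set (HpSpace p) := fun i =>
    approxSet p ρ K (Φ i.1) i.2.1 (T i.2.2.1) (1 / ((i.2.2.2 : ℝ) + 1)) with hU
  have hUo : ∀ i, IsOpen (U i) := fun i => isOpen_approxSet hp hρ hKT (hT1 _)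
  have hUd : ∀ i, Dense (U i) := fun i =>
    dense_approxSet hp hρ hρ1 hKc hKT hKm (hΦc _) (hT1 _) (by positivity)
  have heq : DVHp p ρ K = ⋂ i, U i := by
    refine Subset.antisymm (fun f hf => mem_iInter.2 fun i => ?_) fun f hf => ?_
    · exact mem_approxSet_of_mem_DVHp hp hρ hKc hKT (hΦc _) (hT1 _) (by positivity) hf
    · exact mem_DVHp_of_forall_mem_approxSet hρ hΦ hT fun j l k n => mem_iInter.1 hf (j, l, k, n)
  rw [heq]
  exact ⟨.iInter_of_isOpen hUo, dense_iInter_of_isOpen hUo hUd⟩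
end
end

section
/- Let 1 ≤ p < ∞, let ρ ⊆ [0,1) have 1 as a limit point, and let K ⊆ 𝕋 be compact with m(K) = 0. Then 𝒟𝒱_{H^p}^K(𝔻,ρ) = ⋂_{j∈ℕ, s∈ℕ*, l∈ℕ} ⋃_{r∈ρ} U(j,s,l,r). -/
open Complex Metric Set Filter MeasureTheory Polynomial Topology

noncomputable section

/-- A complex polynomial has rational coefficients if the real and imaginary part of each
coefficient is rational. -/
def RatPoly (q : Polynomial ℂ) : Prop :=
  ∀ n : ℕ, ∃ a b : ℚ, q.coeff n = (a : ℂ) + (b : ℂ) * Complex.I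

/-- The set `U(j,s,l,r)` of `f ∈ H^p(𝔻)` with
`sup_{ζ∈K} sup_{|z| ≤ s/(s+1)} |f^{(l)}(r(ζ-z)+z) - P_j(ζ)| < 1/s`. -/
def UHpD (p : ℝ) (K : Set ℂ) (P : ℕ → Polynomial ℂ) (j s l : ℕ) (r : ℝ) :
    Set (HpSpace p) :=
  {f : HpSpace p |
    (⨆ ζ ∈ K, ⨆ z ∈ Metric.closedBall (0:ℂ) ((s : ℝ) / ((s : ℝ) + 1)),
      ‖iteratedDeriv l f.1 ((r : ℂ) * (ζ - z) + z) - (P j).eval ζ‖) < 1 / (s : ℝ)}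

/-- A subset of the unit circle of arc length zero is a proper subset. -/
lemma exists_mem_sphere_notMem_of_arcMeasure_eq_zero {K : Set ℂ} (hK : arcMeasure K = 0) :
    ∃ w ∈ Metric.sphere (0 : ℂ) 1, w ∉ K := by
  by_contra! h
  have hset : {θ : ℝ | θ ∈ Set.Ico (0:ℝ) (2 * Real.pi) ∧
      Complex.exp ((θ : ℂ) * Complex.I) ∈ K} = Set.Ico (0:ℝ) (2 * Real.pi) := by
    ext θ
    simp only [mem_ofPred_eq, and_iff_left_iff_imp]
    exact fun _ => h _ (by simp [Complex.norm_exp_ofReal_mul_I])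
  rw [arcMeasure, hset, Real.volume_Ico] at hK
  simp only [sub_zero, ENNReal.ofReal_eq_zero] at hK
  linarith [Real.pi_pos]

/-- On a compact proper subset of the unit circle, the conjugate of the coordinate function
is a uniform limit of polynomials. -/
lemma star_X_mem_topologicalClosure_polynomialFunctions {K : Set ℂ} [CompactSpace K]
    (hKT : K ⊆ Metric.sphere (0 : ℂ) 1) {w : ℂ} (hw : w ∈ Metric.sphere (0 : ℂ) 1)
    (hwK : w ∉ K) :
    star (toContinuousMapOnAlgHom K X) ∈ (polynomialFunctions K).topologicalClosure := by
  set A := (polynomialFunctions K).topologicalClosure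
  have : IsClosed (A : Set C(K, ℂ)) := Subalgebra.isClosed_topologicalClosure _
  have hX : toContinuousMapOnAlgHom K X ∈ A := by
    apply Subalgebra.le_topologicalClosure
    rw [polynomialFunctions.eq_adjoin_X]
    exact Algebra.subset_adjoin rfl
  let x : A := ⟨toContinuousMapOnAlgHom K X, hX⟩
  have hspec : spectrum ℂ (x : C(K, ℂ)) = K := by
    rw [ContinuousMap.spectrum_eq_range]
    ext z
    simp [x]
  have h0 : (0 : ℂ) ∉ spectrum ℂ x := by
    intro h0
    have hb := Subalgebra.spectrum_isBounded_connectedComponentIn A x h0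
    rw [hspec] at hb
    let R : Set ℂ := (fun t : ℝ => (t : ℂ) * w) '' Set.Ici 0
    have hw1 : ‖w‖ = 1 := by simpa using hw
    have hRK : R ⊆ Kᶜ := by
      rintro _ ⟨t, ht, rfl⟩ htK
      have h1 : ‖(t : ℂ) * w‖ = 1 := by simpa using hKT htK
      rw [norm_mul, hw1, mul_one, Complex.norm_real, Real.norm_of_nonneg ht] at h1
      exact hwK (by simpa [h1] using htK)
    have hRc : IsPreconnected R :=
      isPreconnected_Ici.image _ (by fun_prop)
    have hRb := hb.subset (hRc.subset_connectedComponentIn ⟨0, by simp, by simp⟩ hRK)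
    obtain ⟨C, hC⟩ := hRb.exists_norm_le
    have hCR := hC (((|C| + 1 : ℝ) : ℂ) * w) ⟨|C| + 1, by simp; positivity, rfl⟩
    rw [norm_mul, hw1, mul_one, Complex.norm_real, Real.norm_of_nonneg (by positivity)] at hCR
    linarith [le_abs_self C]
  rw [spectrum.zero_notMem_iff] at h0
  obtain ⟨y, hy⟩ := h0.exists_right_inv
  have hy' : star (toContinuousMapOnAlgHom K X) = (y : C(K, ℂ)) := by
    ext ζ
    have h1 : (ζ : ℂ) * (y : C(K, ℂ)) ζ = 1 := by
      have := congrArg (fun g : A => (g : C(K, ℂ)) ζ) hy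
      simpa [x] using this
    have h2 : (starRingEnd ℂ) (ζ : ℂ) * ζ = 1 := by
      have h3 : ‖(ζ : ℂ)‖ = 1 := by simpa using hKT ζ.2
      rw [← Complex.normSq_eq_conj_mul_self, Complex.normSq_eq_norm_sq, h3]
      simp
    have h4 : star (toContinuousMapOnAlgHom K X) ζ = (starRingEnd ℂ) (ζ : ℂ) := by simp
    rw [h4]
    calc (starRingEnd ℂ) (ζ : ℂ) = (starRingEnd ℂ) (ζ : ℂ) * (ζ * (y : C(K, ℂ)) ζ) := by
          rw [h1, mul_one]
      _ = (y : C(K, ℂ)) ζ := by rw [← mul_assoc, h2, one_mul]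
  rw [hy']
  exact y.2

/-- Polynomials are dense in the continuous functions on a compact proper subset of the
unit circle. -/
lemma topologicalClosure_polynomialFunctions_eq_top {K : Set ℂ} [CompactSpace K]
    (hKT : K ⊆ Metric.sphere (0 : ℂ) 1) {w : ℂ} (hw : w ∈ Metric.sphere (0 : ℂ) 1)
    (hwK : w ∉ K) : (polynomialFunctions K).topologicalClosure = ⊤ := by
  have hle : (polynomialFunctions K).starClosure.toSubalgebra ≤
      (polynomialFunctions K).topologicalClosure := by
    refine sup_le (Subalgebra.le_topologicalClosure _) ?_
    rw [polynomialFunctions.eq_adjoin_X, Subalgebra.star_adjoin_comm,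
      ← polynomialFunctions.eq_adjoin_X]
    refine Algebra.adjoin_le ?_
    rintro g hg
    rw [Set.star_singleton, Set.mem_singleton_iff] at hg
    rw [hg]
    exact star_X_mem_topologicalClosure_polynomialFunctions hKT hw hwK
  rw [eq_top_iff]
  intro g _
  have hg : g ∈ (polynomialFunctions K).starClosure.topologicalClosure := by
    rw [polynomialFunctions.starClosure_topologicalClosure]; trivial
  have hg' : g ∈ closure ((polynomialFunctions K).starClosure : Set C(K, ℂ)) := hg
  exact closure_minimal hle (Subalgebra.isClosed_topologicalClosure _) hg'

/-- Every continuous function on a compact proper subset of the unit circle is uniformly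
approximable by polynomials. -/
lemma exists_polynomial_near_of_ssubset_sphere {K : Set ℂ} (hKc : IsCompact K)
    (hKT : K ⊆ Metric.sphere (0 : ℂ) 1) {w : ℂ} (hw : w ∈ Metric.sphere (0 : ℂ) 1)
    (hwK : w ∉ K) {φ : ℂ → ℂ} (hφ : ContinuousOn φ K) {ε : ℝ} (hε : 0 < ε) :
    ∃ q : ℂ[X], ∀ ζ ∈ K, ‖q.eval ζ - φ ζ‖ < ε := by
  have : CompactSpace K := isCompact_iff_compactSpace.mp hKc
  let g : C(K, ℂ) := ⟨K.domRestrict φ, hφ.domRestrict⟩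
  have hg : g ∈ closure (polynomialFunctions K : Set C(K, ℂ)) := by
    rw [← Subalgebra.topologicalClosure_coe,
      topologicalClosure_polynomialFunctions_eq_top hKT hw hwK]
    trivial
  obtain ⟨_, ⟨q, -, rfl⟩, hq⟩ := Metric.mem_closure_iff.mp hg ε hε
  refine ⟨q, fun ζ hζ => ?_⟩
  have := (ContinuousMap.dist_apply_le_dist (⟨ζ, hζ⟩ : K)).trans_lt hq
  rw [dist_comm, dist_eq_norm] at this
  simpa [g] using this

/-- Complex polynomials are uniformly approximable on the closed unit disk by polynomials
with rational coefficients. -/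
lemma exists_ratPoly_near (q : ℂ[X]) :
    ∀ ε > 0, ∃ q' : ℂ[X], RatPoly q' ∧ ∀ ζ : ℂ, ‖ζ‖ ≤ 1 → ‖q'.eval ζ - q.eval ζ‖ < ε := by
  induction q using Polynomial.induction_on' with
  | add a b ha hb =>
    intro ε hε
    obtain ⟨a', ha', ha''⟩ := ha (ε / 2) (by positivity)
    obtain ⟨b', hb', hb''⟩ := hb (ε / 2) (by positivity)
    refine ⟨a' + b', fun n => ?_, fun ζ hζ => ?_⟩
    · obtain ⟨x, y, hxy⟩ := ha' n
      obtain ⟨u, v, huv⟩ := hb' n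
      exact ⟨x + u, y + v, by rw [coeff_add, hxy, huv]; push_cast; ring⟩
    · rw [eval_add, eval_add, add_sub_add_comm]
      exact (norm_add_le _ _).trans_lt (by linarith [ha'' ζ hζ, hb'' ζ hζ])
  | monomial n c =>
    intro ε hε
    obtain ⟨x, hx⟩ := exists_rat_near c.re (half_pos hε)
    obtain ⟨y, hy⟩ := exists_rat_near c.im (half_pos hε)
    refine ⟨monomial n ((x : ℂ) + (y : ℂ) * Complex.I), fun k => ?_, fun ζ hζ => ?_⟩
    · rw [coeff_monomial]
      split_ifs
      · exact ⟨x, y, rfl⟩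
      · exact ⟨0, 0, by simp⟩
    · rw [eval_monomial, eval_monomial, ← sub_mul, norm_mul, norm_pow]
      have h1 : ‖ζ‖ ^ n ≤ 1 := pow_le_one₀ (norm_nonneg _) hζ
      have h2 : ‖(x : ℂ) + (y : ℂ) * Complex.I - c‖ < ε := by
        refine (Complex.norm_le_abs_re_add_abs_im _).trans_lt ?_
        simp only [sub_re, add_re, mul_re, sub_im, add_im, mul_im, Complex.I_re, Complex.I_im,
          Complex.ratCast_re, Complex.ratCast_im, mul_zero, mul_one, zero_add, add_zero,
          sub_zero]
        rw [abs_sub_comm] at hx hy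
        linarith
      exact (mul_le_of_le_one_right (norm_nonneg _) h1).trans_lt h2

/-- A double supremum over sets of a real function dominates each of its values, as soon
as the function is bounded on the product. -/
lemma le_biSup_biSup_s10 {α β : Type*} {F : α → β → ℝ} {K : Set α} {L : Set β}
    {C : ℝ} (hC : ∀ a ∈ K, ∀ b ∈ L, F a b ≤ C) {a : α} (ha : a ∈ K) {b : β} (hb : b ∈ L) :
    F a b ≤ ⨆ a ∈ K, ⨆ b ∈ L, F a b := by
  have hin : ∀ a ∈ K, ∀ b, (⨆ _ : b ∈ L, F a b) ≤ |C| := fun a ha b =>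
    Real.iSup_le (fun hb => (hC a ha b hb).trans (le_abs_self C)) (abs_nonneg C)
  have hout : ∀ a, (⨆ _ : a ∈ K, ⨆ b, ⨆ _ : b ∈ L, F a b) ≤ |C| := fun a =>
    Real.iSup_le (fun ha => Real.iSup_le (hin a ha) (abs_nonneg C)) (abs_nonneg C)
  calc F a b = ⨆ _ : b ∈ L, F a b := (ciSup_pos (f := fun _ : b ∈ L => F a b) hb).symm
    _ ≤ ⨆ b, ⨆ _ : b ∈ L, F a b :=
        le_ciSup (f := fun b => ⨆ _ : b ∈ L, F a b) ⟨|C|, forall_mem_range.2 (hin a ha)⟩ b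
    _ = ⨆ _ : a ∈ K, ⨆ b, ⨆ _ : b ∈ L, F a b :=
        (ciSup_pos (f := fun _ : a ∈ K => ⨆ b, ⨆ _ : b ∈ L, F a b) ha).symm
    _ ≤ ⨆ a ∈ K, ⨆ b ∈ L, F a b :=
        le_ciSup (f := fun a => ⨆ _ : a ∈ K, ⨆ b, ⨆ _ : b ∈ L, F a b)
          ⟨|C|, forall_mem_range.2 hout⟩ a

lemma biSup_biSup_le {α β : Type*} {F : α → β → ℝ} {K : Set α} {L : Set β}
    {C : ℝ} (hC0 : 0 ≤ C) (hC : ∀ a ∈ K, ∀ b ∈ L, F a b ≤ C) :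
    ⨆ a ∈ K, ⨆ b ∈ L, F a b ≤ C :=
  Real.iSup_le (fun a => Real.iSup_le (fun ha => Real.iSup_le (fun b =>
    Real.iSup_le (hC a ha b) hC0) hC0) hC0) hC0

lemma mul_sub_add_mem_ball {r : ℝ} (hr : r ∈ Set.Ico (0:ℝ) 1) {ζ z : ℂ}
    (hζ : ζ ∈ Metric.sphere (0 : ℂ) 1) (hz : z ∈ Metric.ball (0 : ℂ) 1) :
    (r : ℂ) * (ζ - z) + z ∈ Metric.ball (0 : ℂ) 1 := by
  rw [mem_sphere_zero_iff_norm] at hζ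
  rw [mem_ball_zero_iff] at hz ⊢
  have h : (r : ℂ) * (ζ - z) + z = (r : ℂ) * ζ + ((1 - r : ℝ) : ℂ) * z := by push_cast; ring
  rw [h]
  refine (norm_add_le _ _).trans_lt ?_
  rw [norm_mul, norm_mul, Complex.norm_real, Complex.norm_real, hζ,
    Real.norm_of_nonneg hr.1, Real.norm_of_nonneg (by linarith [hr.2])]
  nlinarith [hr.2]

lemma closedBall_div_succ_subset_ball (s : ℕ) :
    Metric.closedBall (0 : ℂ) ((s : ℝ) / ((s : ℝ) + 1)) ⊆ Metric.ball (0 : ℂ) 1 :=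
  Metric.closedBall_subset_ball (by rw [div_lt_one (by positivity)]; linarith)

/-- A compact subset of the open unit disk lies in all but finitely many of the closed disks
of radius `s / (s + 1)`. -/
lemma eventually_subset_closedBall_div_succ {L : Set ℂ} (hL : IsCompact L)
    (hLD : L ⊆ Metric.ball (0 : ℂ) 1) :
    ∀ᶠ s : ℕ in atTop, L ⊆ Metric.closedBall (0 : ℂ) ((s : ℝ) / ((s : ℝ) + 1)) := by
  obtain ⟨R, hR, hLR⟩ : ∃ R < 1, L ⊆ Metric.closedBall (0 : ℂ) R := by
    rcases L.eq_empty_or_nonempty with rfl | hne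
    · exact ⟨0, one_pos, empty_subset _⟩
    · obtain ⟨x, hx, hmax⟩ := hL.exists_isMaxOn hne continuous_norm.continuousOn
      exact ⟨‖x‖, by simpa using hLD hx, fun y hy => by simpa using hmax hy⟩
  filter_upwards [(tendsto_natCast_div_add_atTop (1 : ℝ)).eventually_const_lt hR] with s hs
  exact hLR.trans (Metric.closedBall_subset_closedBall hs.le)

lemma analyticOnNhd_iteratedDeriv_of_memHp {p : ℝ} {f : ℂ → ℂ} (hf : MemHp p f) (l : ℕ) :
    AnalyticOnNhd ℂ (iteratedDeriv l f) (Metric.ball (0 : ℂ) 1) := by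
  rw [iteratedDeriv_eq_iterate]
  exact (hf.1.analyticOnNhd Metric.isOpen_ball).iterated_deriv l

/-- The quantity whose suprema define `DVHp` and `UHpD` is bounded. -/
lemma exists_norm_comp_sub_le {g φ : ℂ → ℂ} (hg : ContinuousOn g (Metric.ball (0 : ℂ) 1))
    {K L : Set ℂ} (hKc : IsCompact K) (hKT : K ⊆ Metric.sphere (0 : ℂ) 1)
    (hL : IsCompact L) (hLD : L ⊆ Metric.ball (0 : ℂ) 1) (hφ : ContinuousOn φ K)
    {r : ℝ} (hr : r ∈ Set.Ico (0:ℝ) 1) :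
    ∃ C, ∀ ζ ∈ K, ∀ z ∈ L, ‖g ((r : ℂ) * (ζ - z) + z) - φ ζ‖ ≤ C := by
  have hcont : ContinuousOn (fun x : ℂ × ℂ => g ((r : ℂ) * (x.1 - x.2) + x.2) - φ x.1)
      (K ×ˢ L) := by
    refine ContinuousOn.sub ?_ (hφ.comp continuousOn_fst fun x hx => hx.1)
    exact hg.comp (by fun_prop) fun x hx => mul_sub_add_mem_ball hr (hKT hx.1) (hLD hx.2)
  obtain ⟨C, hC⟩ := (hKc.prod hL).exists_bound_of_continuousOn hcont
  exact ⟨C, fun ζ hζ z hz => hC (ζ, z) ⟨hζ, hz⟩⟩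

/-- If the values `g (r (ζ - z) + z)` for `z` in the unit disk can be kept arbitrarily close to
a constant `c` with `r` bounded away from `1`, then `g` is constant on the unit disk. -/
lemma eqOn_const_of_forall_exists_le {g : ℂ → ℂ}
    (hg : AnalyticOnNhd ℂ g (Metric.ball (0 : ℂ) 1)) {ζ : ℂ}
    (hζ : ζ ∈ Metric.sphere (0 : ℂ) 1) {c : ℂ} {δ : ℝ} (hδ : δ < 1) {r : ℕ → ℝ}
    (hr0 : ∀ n, 0 ≤ r n) (hrδ : ∀ n, r n ≤ δ)
    (hr : ∀ z ∈ Metric.ball (0 : ℂ) 1,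
      Tendsto (fun n => g ((r n : ℂ) * (ζ - z) + z)) atTop (𝓝 c)) :
    EqOn g (fun _ => c) (Metric.ball (0 : ℂ) 1) := by
  obtain ⟨a, ha, ψ, hψ, hlim⟩ :=
    isCompact_Icc.tendsto_subseq (x := r) (s := Set.Icc 0 δ) fun n => ⟨hr0 n, hrδ n⟩
  have ha1 : a ∈ Set.Ico (0:ℝ) 1 := ⟨ha.1, ha.2.trans_lt hδ⟩
  have hval : ∀ z ∈ Metric.ball (0 : ℂ) 1, g ((a : ℂ) * (ζ - z) + z) = c := by
    intro z hz
    have h1 : Tendsto (fun n => ((r (ψ n) : ℝ) : ℂ) * (ζ - z) + z) atTop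
        (𝓝 ((a : ℂ) * (ζ - z) + z)) :=
      ((((Complex.continuous_ofReal.tendsto a).comp hlim).mul_const _).add_const _)
    have h2 := ((hg _ (mul_sub_add_mem_ball ha1 hζ hz)).continuousAt.tendsto).comp h1
    exact tendsto_nhds_unique h2 ((hr z hz).comp hψ.tendsto_atTop)
  have h0 : (0 : ℂ) ∈ Metric.ball (0 : ℂ) 1 := by simp
  have h1a : (1 : ℂ) - a ≠ 0 := by
    have : ((1 - a : ℝ) : ℂ) ≠ 0 := Complex.ofReal_ne_zero.mpr (by linarith [ha1.2])
    simpa using this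
  refine hg.eqOn_of_preconnected_of_eventuallyEq analyticOnNhd_const
    (convex_ball _ _).isPreconnected (mul_sub_add_mem_ball ha1 hζ h0) ?_
  have hinv : Tendsto (fun w : ℂ => (w - a * ζ) / (1 - a))
      (𝓝 ((a : ℂ) * (ζ - 0) + 0)) (𝓝 0) := by
    have : ContinuousAt (fun w : ℂ => (w - a * ζ) / (1 - a)) ((a : ℂ) * (ζ - 0) + 0) := by
      fun_prop
    simpa [ContinuousAt] using this
  filter_upwards [hinv (Metric.isOpen_ball.mem_nhds h0)] with w hw
  rw [← hval _ hw]
  congr 1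
  field_simp
  ring

/-- The members of all `⋃ r ∈ ρ, UHpD p K P j s l r` approximate every rational polynomial with
dilation parameters arbitrarily close to `1`. -/
lemma exists_gt_mem_UHpD {p : ℝ} {ρ : Set ℝ} (hρ : ρ ⊆ Set.Ico (0:ℝ) 1)
    {K : Set ℂ} (hKc : IsCompact K) (hKT : K ⊆ Metric.sphere (0:ℂ) 1) (hKne : K.Nonempty)
    {P : ℕ → Polynomial ℂ} (hP : ∀ q : Polynomial ℂ, RatPoly q → ∃ j, P j = q)
    {f : HpSpace p} {l : ℕ} (hf : ∀ j s : ℕ, 1 ≤ s → ∃ r ∈ ρ, f ∈ UHpD p K P j s l r)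
    (j s₀ : ℕ) {δ : ℝ} (hδ : δ < 1) :
    ∃ s ≥ s₀, 1 ≤ s ∧ ∃ r ∈ ρ, δ < r ∧ f ∈ UHpD p K P j s l r := by
  have hg := analyticOnNhd_iteratedDeriv_of_memHp f.2 l
  set g := iteratedDeriv l f.1
  have hpt : ∀ {j s : ℕ} {r : ℝ}, r ∈ ρ → f ∈ UHpD p K P j s l r → ∀ ζ ∈ K,
      ∀ z ∈ Metric.closedBall (0 : ℂ) ((s : ℝ) / ((s : ℝ) + 1)),
        ‖g ((r : ℂ) * (ζ - z) + z) - (P j).eval ζ‖ < 1 / (s : ℝ) := by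
    intro j s r hr hU ζ hζ z hz
    obtain ⟨C, hC⟩ := exists_norm_comp_sub_le (φ := fun ζ => (P j).eval ζ) hg.continuousOn hKc
      hKT (isCompact_closedBall _ _) (closedBall_div_succ_subset_ball s)
      (P j).continuous.continuousOn (hρ hr)
    exact (le_biSup_biSup_s10
      (F := fun ζ z : ℂ => ‖g ((r : ℂ) * (ζ - z) + z) - (P j).eval ζ‖) hC hζ hz).trans_lt hU
  by_contra! hno
  obtain ⟨ζ, hζ⟩ := hKne
  choose r hrρ hrU using fun n : ℕ => hf j (max s₀ 1 + n) (by omega)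
  have hconst := eqOn_const_of_forall_exists_le hg (hKT hζ) (c := (P j).eval ζ) hδ
    (fun n => (hρ (hrρ n)).1)
    (fun n => not_lt.mp fun h => hno _ (by omega) (by omega) _ (hrρ n) h (hrU n)) <| by
      intro z hz
      rw [tendsto_iff_norm_sub_tendsto_zero]
      have hs : Tendsto (fun n : ℕ => max s₀ 1 + n) atTop atTop :=
        tendsto_atTop_mono (fun n => Nat.le_add_left _ _) tendsto_id
      refine squeeze_zero' (Eventually.of_forall fun n => norm_nonneg _) ?_
        (tendsto_one_div_atTop_nhds_zero_nat.comp hs)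
      filter_upwards [hs.eventually (eventually_subset_closedBall_div_succ
        (isCompact_singleton (x := z)) (by simpa using hz))] with n hn
      exact (hpt (hrρ n) (hrU n) ζ hζ z (hn rfl)).le
  obtain ⟨q, hq⟩ : ∃ q : ℚ, 1 ≤ ‖(P j).eval ζ - (q : ℂ)‖ := by
    by_cases h : 1 ≤ ‖(P j).eval ζ‖
    · exact ⟨0, by simpa using h⟩
    · refine ⟨2, ?_⟩
      have h2 := norm_sub_norm_le (2 : ℂ) ((P j).eval ζ)
      rw [norm_sub_rev] at h2
      simp only [Complex.norm_ofNat] at h2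
      push_cast
      linarith
  obtain ⟨k, hk⟩ := hP (Polynomial.C (q : ℂ)) fun n => by
    rw [coeff_C]
    split_ifs
    · exact ⟨q, 0, by simp⟩
    · exact ⟨0, 0, by simp⟩
  obtain ⟨t, htρ, htU⟩ := hf k 1 le_rfl
  have h0 : (0 : ℂ) ∈ Metric.closedBall (0 : ℂ) (((1 : ℕ) : ℝ) / (((1 : ℕ) : ℝ) + 1)) := by
    simp
  have hlt := hpt htρ htU ζ hζ 0 h0
  rw [hconst (mul_sub_add_mem_ball (hρ htρ) (hKT hζ) (by simp)), hk, eval_C] at hlt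
  norm_num at hlt
  linarith

/-- A point below `1` is exceeded by some element of a set of reals accumulating at `1`. -/
lemma exists_gt_of_accPt_one {ρ : Set ℝ}
    (hρ1 : AccPt (1:ℝ) (Filter.principal ρ)) {δ : ℝ} (hδ : δ < 1) : ∃ r ∈ ρ, δ < r := by
  obtain ⟨r, ⟨hr, hrρ⟩, -⟩ := accPt_iff_nhds.mp hρ1 (Set.Ioi δ) (Ioi_mem_nhds hδ)
  exact ⟨r, hrρ, hr⟩

/-- A family of properties each of which holds for elements of `ρ` arbitrarily close to `1`
is realised along a strictly increasing sequence in `ρ` tending to `1`. -/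
lemma exists_strictMono_tendsto_one {ρ : Set ℝ} (hρ : ρ ⊆ Set.Ico (0:ℝ) 1)
    {Q : ℕ → ℝ → Prop} (hQ : ∀ n, ∀ δ < 1, ∃ r ∈ ρ, δ < r ∧ Q n r) :
    ∃ r : ℕ → ℝ, (∀ n, r n ∈ ρ) ∧ StrictMono r ∧ Tendsto r atTop (𝓝 1) ∧ ∀ n, Q n (r n) := by
  have hδ : ∀ (n : ℕ) (a : ρ), max (a : ℝ) (1 - 1 / ((n : ℝ) + 1)) < 1 := fun n a =>
    max_lt (hρ a.2).2 (sub_lt_self _ (by positivity))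
  have hex : ∀ (n : ℕ) (a : ρ), ∃ b : ρ, (a : ℝ) < b ∧ 1 - 1 / ((n : ℝ) + 1) < b ∧ Q n b := by
    intro n a
    obtain ⟨r, hr, hlt, hq⟩ := hQ n _ (hδ n a)
    exact ⟨⟨r, hr⟩, (le_max_left _ _).trans_lt hlt, (le_max_right _ _).trans_lt hlt, hq⟩
  choose step h1 h2 h3 using hex
  obtain ⟨a₀, ha₀, -⟩ := hQ 0 0 one_pos
  let u : ℕ → ρ := fun n => Nat.rec ⟨a₀, ha₀⟩ (fun k a => step k a) n
  refine ⟨fun n => u (n + 1), fun n => (u (n + 1)).2,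
    strictMono_nat_of_lt_succ fun n => h1 (n + 1) (u (n + 1)), ?_, fun n => h3 n (u n)⟩
  have hlim : Tendsto (fun n : ℕ => 1 - 1 / ((n : ℝ) + 1)) atTop (𝓝 1) := by
    simpa using (tendsto_one_div_add_atTop_nhds_zero_nat (𝕜 := ℝ)).const_sub 1
  exact tendsto_of_tendsto_of_tendsto_of_le_of_le hlim tendsto_const_nhds
    (fun n => (h2 n (u n)).le) (fun n => (hρ (u (n + 1)).2).2.le)

/-- Lemma (hardyderint): `𝒟𝒱_{H^p}^K(𝔻,ρ) = ⋂_{j,l∈ℕ, s∈ℕ*} ⋃_{r∈ρ} U(j,s,l,r)`. -/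
theorem statement_10 (p : ℝ) (hp : 1 ≤ p)
    (ρ : Set ℝ) (hρ : ρ ⊆ Set.Ico (0:ℝ) 1) (hρ1 : AccPt (1:ℝ) (Filter.principal ρ))
    (K : Set ℂ) (hKc : IsCompact K) (hKT : K ⊆ Metric.sphere (0:ℂ) 1)
    (hKm : arcMeasure K = 0)
    (P : ℕ → Polynomial ℂ) (hP1 : ∀ j, RatPoly (P j))
    (hP2 : ∀ q : Polynomial ℂ, RatPoly q → ∃ j, P j = q) :
    DVHp p ρ K =
      ⋂ j : ℕ, ⋂ s : ℕ, ⋂ (_ : 1 ≤ s), ⋂ l : ℕ, ⋃ r ∈ ρ, UHpD p K P j s l r := by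
  ext f
  simp only [mem_iInter, mem_iUnion, exists_prop]
  constructor
  · intro hf j s hs l
    obtain ⟨r, hr, -, -, hlim⟩ := hf (fun ζ => (P j).eval ζ) (P j).continuous.continuousOn
      (Metric.closedBall (0:ℂ) ((s : ℝ) / ((s : ℝ) + 1))) (isCompact_closedBall _ _)
      (closedBall_div_succ_subset_ball s) l
    have hs0 : (0 : ℝ) < 1 / s := by
      have : (0 : ℝ) < s := by exact_mod_cast hs
      positivity
    obtain ⟨n, hn⟩ := (hlim.eventually_lt_const hs0).exists
    exact ⟨r n, hr n, hn⟩
  · intro hf φ hφ L hL hLD l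
    obtain ⟨w, hw, hwK⟩ := exists_mem_sphere_notMem_of_arcMeasure_eq_zero hKm
    have hg := analyticOnNhd_iteratedDeriv_of_memHp f.2 l
    have key : ∀ n : ℕ, ∀ δ < (1:ℝ), ∃ r ∈ ρ, δ < r ∧
        (⨆ ζ ∈ K, ⨆ z ∈ L, ‖iteratedDeriv l f.1 ((r : ℂ) * (ζ - z) + z) - φ ζ‖)
          ≤ 1 / ((n : ℝ) + 1) := by
      intro n δ hδ
      rcases K.eq_empty_or_nonempty with rfl | hKne
      · obtain ⟨r, hr, hlt⟩ := exists_gt_of_accPt_one hρ1 hδ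
        exact ⟨r, hr, hlt, biSup_biSup_le (by positivity) (by simp)⟩
      set ε : ℝ := 1 / ((n : ℝ) + 1) with hε
      have hε0 : 0 < ε := by positivity
      obtain ⟨q, hq⟩ := exists_polynomial_near_of_ssubset_sphere hKc hKT hw hwK hφ
        (show 0 < ε / 3 by positivity)
      obtain ⟨q', hq', hqq⟩ := exists_ratPoly_near q (ε / 3) (by positivity)
      obtain ⟨j, rfl⟩ := hP2 q' hq'
      obtain ⟨s₀, hs₀⟩ := ((eventually_subset_closedBall_div_succ hL hLD).and
        (tendsto_one_div_atTop_nhds_zero_nat.eventually_lt_const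
          (show 0 < ε / 3 by positivity))).exists_forall_of_atTop
      obtain ⟨s, hs, -, r, hr, hlt, hU⟩ := exists_gt_mem_UHpD hρ hKc hKT hKne hP2
        (fun j s hs => hf j s hs l) j s₀ hδ
      refine ⟨r, hr, hlt, biSup_biSup_le hε0.le fun ζ hζ z hz => ?_⟩
      obtain ⟨C, hC⟩ := exists_norm_comp_sub_le (φ := fun ζ => (P j).eval ζ) hg.continuousOn
        hKc hKT (isCompact_closedBall _ _) (closedBall_div_succ_subset_ball s)
        (P j).continuous.continuousOn (hρ hr)
      have h1 := (le_biSup_biSup_s10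
        (F := fun ζ z : ℂ => ‖iteratedDeriv l f.1 ((r : ℂ) * (ζ - z) + z) - (P j).eval ζ‖)
        hC hζ ((hs₀ s hs).1 hz)).trans_lt hU
      have h2 := hqq ζ (mem_sphere_zero_iff_norm.mp (hKT hζ)).le
      have h3 := hq ζ hζ
      have h4 := norm_sub_le_norm_sub_add_norm_sub
        (iteratedDeriv l f.1 ((r : ℂ) * (ζ - z) + z)) ((P j).eval ζ) (φ ζ)
      have h5 := norm_sub_le_norm_sub_add_norm_sub ((P j).eval ζ) (q.eval ζ) (φ ζ)
      linarith [(hs₀ s hs).2]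
    obtain ⟨r, hr, hmono, hlim, hle⟩ := exists_strictMono_tendsto_one hρ key
    refine ⟨r, hr, hmono, hlim, squeeze_zero (fun n => ?_) hle
      tendsto_one_div_add_atTop_nhds_zero_nat⟩
    exact Real.iSup_nonneg fun ζ => Real.iSup_nonneg fun _ => Real.iSup_nonneg fun z =>
      Real.iSup_nonneg fun _ => norm_nonneg _
end
end

section
/- Let 1 ≤ p < ∞, let K ⊆ 𝕋 be compact with m(K) = 0 and let l ∈ ℕ. For every continuous function φ on K and every ε > 0, there exists a complex polynomial P such that ‖P‖_{H^p} < ε and sup_{ζ∈K} |P^{(l)}(ζ) − φ(ζ)| < ε. -/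
open Complex Metric Set Filter MeasureTheory Polynomial Topology

noncomputable section

/-! ### Mean squares of polynomials on the unit circle -/

/-- The sum of the squared moduli of the coefficients of a polynomial. -/
def meanSq (P : ℂ[X]) : ℝ := ∑ n ∈ P.support, ‖P.coeff n‖ ^ 2

lemma meanSq_eq_circleAverage (P : ℂ[X]) :
    meanSq P = Real.circleAverage (fun z ↦ ‖P.eval z‖ ^ 2) 0 1 :=
  P.sum_sq_norm_coeff_eq_circleAverage

lemma circleIntegrable_of_continuous {f : ℂ → ℝ} (hf : Continuous f) :
    CircleIntegrable f 0 1 :=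
  hf.continuousOn.circleIntegrable zero_le_one

lemma meanSq_nonneg (P : ℂ[X]) : 0 ≤ meanSq P :=
  Finset.sum_nonneg fun _ _ ↦ by positivity

lemma meanSq_le_of_coeff_le {P Q : ℂ[X]} (h : ∀ n, ‖Q.coeff n‖ ≤ ‖P.coeff n‖) :
    meanSq Q ≤ meanSq P := by
  have hsub : Q.support ⊆ P.support := by
    intro n hn
    rw [mem_support_iff] at hn ⊢
    intro h0
    have := h n
    rw [h0, norm_zero] at this
    exact hn (norm_le_zero_iff.1 this)
  calc meanSq Q ≤ ∑ n ∈ Q.support, ‖P.coeff n‖ ^ 2 := by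
        unfold meanSq
        gcongr with n
        exact h n
    _ ≤ meanSq P := Finset.sum_le_sum_of_subset_of_nonneg hsub fun _ _ _ ↦ by positivity

lemma meanSq_le_of_norm_eval_sq_le {P : ℂ[X]} {f : ℂ → ℝ} (hf : Continuous f)
    (h : ∀ z ∈ sphere (0 : ℂ) 1, ‖P.eval z‖ ^ 2 ≤ f z) :
    meanSq P ≤ Real.circleAverage f 0 1 := by
  rw [meanSq_eq_circleAverage]
  exact Real.circleAverage_mono (circleIntegrable_of_continuous (by fun_prop))
    (circleIntegrable_of_continuous hf) (by simpa using h)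

lemma norm_coeff_zero_sq_le_meanSq (P : ℂ[X]) : ‖P.coeff 0‖ ^ 2 ≤ meanSq P := by
  by_cases h : 0 ∈ P.support
  · exact Finset.single_le_sum (f := fun n ↦ ‖P.coeff n‖ ^ 2) (fun _ _ ↦ by positivity) h
  · rw [notMem_support_iff.1 h]
    simpa using meanSq_nonneg P

lemma eval_divX_mul (P : ℂ[X]) (z : ℂ) : P.divX.eval z * z = P.eval z - P.coeff 0 := by
  conv_rhs => rw [← divX_mul_X_add P]
  simp

lemma norm_eval_divX {z : ℂ} (hz : z ∈ sphere (0 : ℂ) 1) (P : ℂ[X]) :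
    ‖P.divX.eval z‖ = ‖P.eval z - P.coeff 0‖ := by
  rw [← eval_divX_mul, norm_mul, mem_sphere_zero_iff_norm.1 hz, mul_one]

lemma meanSq_divX_le (P : ℂ[X]) : meanSq P.divX ≤ meanSq P := by
  calc meanSq P.divX ≤ Real.circleAverage (fun z ↦ ‖(P - C (P.coeff 0)).eval z‖ ^ 2) 0 1 :=
        meanSq_le_of_norm_eval_sq_le (by fun_prop) fun z hz ↦ by simp [norm_eval_divX hz]
    _ = meanSq (P - C (P.coeff 0)) := (meanSq_eq_circleAverage _).symm
    _ ≤ meanSq P := meanSq_le_of_coeff_le fun n ↦ by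
        rcases n with _ | n <;> simp [coeff_C]

lemma meanSq_mul_le {h : ℂ[X]} {c : ℝ} (hc : ∀ z ∈ sphere (0 : ℂ) 1, ‖h.eval z‖ ≤ c)
    (P : ℂ[X]) : meanSq (h * P) ≤ c ^ 2 * meanSq P := by
  rw [meanSq_eq_circleAverage P, ← smul_eq_mul (c ^ 2), ← Real.circleAverage_fun_smul]
  refine meanSq_le_of_norm_eval_sq_le (by fun_prop) fun z hz ↦ ?_
  rw [eval_mul, norm_mul, mul_pow, smul_eq_mul]
  gcongr
  exact hc z hz

lemma norm_eval_le_of_sphere {P : ℂ[X]} {B : ℝ}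
    (h : ∀ z ∈ sphere (0 : ℂ) 1, ‖P.eval z‖ ≤ B) {z : ℂ} (hz : ‖z‖ ≤ 1) : ‖P.eval z‖ ≤ B := by
  refine Complex.norm_le_of_forall_mem_frontier_norm_le (U := ball (0 : ℂ) 1) isBounded_ball
    P.differentiable.diffContOnCl (fun w hw ↦ h w ?_) ?_
  · rwa [frontier_ball _ one_ne_zero] at hw
  · rw [closure_ball _ one_ne_zero]
    simpa using hz

/-- A polynomial that is bounded and has small mean square on the circle has small Hardy norm. -/
lemma hardyNorm_le_s12 {p : ℝ} (hp : 1 ≤ p) {P : ℂ[X]} {B η : ℝ} (hη : 0 < η)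
    (hB : ∀ z ∈ sphere (0 : ℂ) 1, ‖P.eval z‖ ≤ B) (hP : meanSq P ≤ η ^ 2) :
    hardyNorm p (fun z ↦ P.eval z) ≤ (B ^ (p - 1) * η) ^ (1 / p) := by
  have hB0 : 0 ≤ B := (norm_nonneg _).trans (hB 1 (by simp))
  have : Nonempty (Ioo (0 : ℝ) 1) := ⟨⟨1 / 2, by norm_num⟩⟩
  refine ciSup_le fun r ↦ ?_
  obtain ⟨r, hr0, hr1⟩ := r
  set Q : ℂ[X] := P.comp (C (r : ℂ) * X) with hQ
  have hQe : ∀ z, Q.eval z = P.eval (r * z) := fun z ↦ by simp [hQ]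
  have hQm : meanSq Q ≤ η ^ 2 := by
    refine (meanSq_le_of_coeff_le fun n ↦ ?_).trans hP
    rw [hQ, comp_C_mul_X_coeff, norm_mul, norm_pow, Complex.norm_real, Real.norm_eq_abs,
      abs_of_pos hr0]
    exact mul_le_of_le_one_right (norm_nonneg _) (pow_le_one₀ hr0.le hr1.le)
  have hint : (1 / (2 * Real.pi)) * ∫ θ in (0 : ℝ)..(2 * Real.pi),
      ‖P.eval ((r : ℂ) * Complex.exp ((θ : ℂ) * Complex.I))‖ ^ p =
      Real.circleAverage (fun z ↦ ‖Q.eval z‖ ^ p) 0 1 := by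
    simp [Real.circleAverage, circleMap, hQe]
  have hpt : ∀ z ∈ sphere (0 : ℂ) 1,
      ‖Q.eval z‖ ^ p ≤ B ^ (p - 1) / 2 * η + (B ^ (p - 1) / (2 * η)) * ‖Q.eval z‖ ^ 2 := by
    intro z hz
    have hle : ‖Q.eval z‖ ≤ B := by
      rw [hQe]
      refine norm_eval_le_of_sphere hB ?_
      rw [norm_mul, mem_sphere_zero_iff_norm.1 hz, Complex.norm_real, Real.norm_eq_abs,
        abs_of_pos hr0]
      linarith
    have hnn := norm_nonneg (Q.eval z)
    generalize ‖Q.eval z‖ = t at hle hnn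
    have h1 : t ≤ (η + t ^ 2 / η) / 2 := by
      have : t ≤ (η ^ 2 + t ^ 2) / (2 * η) := by
        rw [le_div_iff₀ (by positivity)]
        nlinarith [sq_nonneg (η - t)]
      refine this.trans_eq ?_
      field_simp
    calc t ^ p = t ^ (p - 1) * t := by
          rw [← Real.rpow_add_one' hnn (by linarith), sub_add_cancel]
      _ ≤ B ^ (p - 1) * ((η + t ^ 2 / η) / 2) := by
          have := Real.rpow_le_rpow hnn hle (by linarith : 0 ≤ p - 1)
          gcongr
      _ = _ := by field_simp
  have hc : Continuous fun z ↦ ‖Q.eval z‖ ^ p :=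
    (by fun_prop : Continuous fun z ↦ ‖Q.eval z‖).rpow_const fun _ ↦ Or.inr (by linarith)
  have hpow : 0 ≤ B ^ (p - 1) := Real.rpow_nonneg hB0 _
  dsimp only
  rw [hint]
  refine Real.rpow_le_rpow (Real.circleAverage_nonneg_of_nonneg fun z _ ↦ by positivity) ?_
    (by positivity)
  calc Real.circleAverage (fun z ↦ ‖Q.eval z‖ ^ p) 0 1
      ≤ Real.circleAverage (fun z ↦
          B ^ (p - 1) / 2 * η + (B ^ (p - 1) / (2 * η)) • ‖Q.eval z‖ ^ 2) 0 1 :=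
        Real.circleAverage_mono (circleIntegrable_of_continuous hc)
          (circleIntegrable_of_continuous (by fun_prop)) (by simpa using hpt)
    _ = B ^ (p - 1) / 2 * η + B ^ (p - 1) / (2 * η) * meanSq Q := by
        rw [Real.circleAverage_fun_add (circleIntegrable_of_continuous (by fun_prop))
          (circleIntegrable_of_continuous (by fun_prop)), Real.circleAverage_const,
          Real.circleAverage_fun_smul, ← meanSq_eq_circleAverage, smul_eq_mul]
    _ ≤ B ^ (p - 1) / 2 * η + B ^ (p - 1) / (2 * η) * η ^ 2 := by gcongr
    _ = B ^ (p - 1) * η := by field_simp; ring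

/-- Every polynomial has an antiderivative that vanishes at the origin and whose mean square is
no larger. -/
lemma exists_antiderivative (P : ℂ[X]) :
    ∃ Q : ℂ[X], derivative Q = P ∧ Q.eval 0 = 0 ∧ meanSq Q ≤ meanSq P := by
  set R : ℂ[X] := ∑ n ∈ P.support, monomial n (P.coeff n / (n + 1)) with hR
  have hcoeff : ∀ n, R.coeff n = P.coeff n / (n + 1) := fun n ↦ by
    simp +contextual [hR, coeff_monomial]
  refine ⟨X * R, ?_, by simp, ?_⟩
  · ext n
    rw [coeff_derivative, coeff_X_mul, hcoeff]
    field_simp [Nat.cast_add_one_ne_zero]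
  · have h := meanSq_mul_le (h := X) (c := 1) (fun z hz ↦ by simpa using hz.le) R
    rw [one_pow, one_mul] at h
    refine h.trans (meanSq_le_of_coeff_le fun n ↦ ?_)
    rw [hcoeff, norm_div]
    refine div_le_self (norm_nonneg _) ?_
    rw [← Nat.cast_add_one, Complex.norm_natCast]
    simp

lemma norm_eval_le_of_derivative {Q : ℂ[X]} {B : ℝ} (h0 : Q.eval 0 = 0)
    (h : ∀ z ∈ sphere (0 : ℂ) 1, ‖(derivative Q).eval z‖ ≤ B) :
    ∀ z ∈ sphere (0 : ℂ) 1, ‖Q.eval z‖ ≤ B := by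
  intro z hz
  have := (convex_closedBall (0 : ℂ) 1).norm_image_sub_le_of_norm_deriv_le
    (f := fun w ↦ Q.eval w) (C := B) (x := 0) (y := z)
    (fun w _ ↦ Q.differentiable w)
    (fun w hw ↦ by
      rw [Polynomial.deriv]
      exact norm_eval_le_of_sphere h (by simpa using hw)) (by simp) (sphere_subset_closedBall hz)
  simpa [h0, mem_sphere_zero_iff_norm.1 hz] using this

lemma exists_iterate_antiderivative (l : ℕ) (P : ℂ[X]) {B : ℝ}
    (hB : ∀ z ∈ sphere (0 : ℂ) 1, ‖P.eval z‖ ≤ B) :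
    ∃ Q : ℂ[X], derivative^[l] Q = P ∧ (∀ z ∈ sphere (0 : ℂ) 1, ‖Q.eval z‖ ≤ B) ∧
      meanSq Q ≤ meanSq P := by
  induction l with
  | zero => exact ⟨P, rfl, hB, le_rfl⟩
  | succ l ih =>
    obtain ⟨Q, hQ, hQB, hQm⟩ := ih
    obtain ⟨S, hS, hS0, hSm⟩ := exists_antiderivative Q
    refine ⟨S, by rw [Function.iterate_succ_apply, hS, hQ], ?_, hSm.trans hQm⟩
    exact norm_eval_le_of_derivative hS0 (hS ▸ hQB)

lemma iteratedDeriv_eval (l : ℕ) (P : ℂ[X]) :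
    iteratedDeriv l (fun z ↦ P.eval z) = fun z ↦ (derivative^[l] P).eval z := by
  induction l with
  | zero => simp
  | succ l ih =>
    rw [iteratedDeriv_succ, ih, Function.iterate_succ_apply']
    ext z
    exact Polynomial.deriv _

/-! ### Approximation on subsets of the circle -/

lemma exists_approx_mul_conj_pow {K : Set ℂ} (hKc : IsCompact K) (hKT : K ⊆ sphere (0 : ℂ) 1)
    {φ : ℂ → ℂ} (hφ : ContinuousOn φ K) {ε : ℝ} (hε : 0 < ε) :
    ∃ (h : ℂ[X]) (N : ℕ), ∀ ζ ∈ K, ‖h.eval ζ * (starRingEnd ℂ ζ) ^ N - φ ζ‖ < ε := by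
  have : CompactSpace K := isCompact_iff_compactSpace.1 hKc
  have hconj : ∀ ζ ∈ K, ζ * starRingEnd ℂ ζ = 1 := fun ζ hζ ↦ by
    rw [Complex.mul_conj, Complex.normSq_eq_norm_sq, mem_sphere_zero_iff_norm.1 (hKT hζ)]
    simp
  have key : ∀ f ∈ (polynomialFunctions K).starClosure,
      ∃ (h : ℂ[X]) (N : ℕ), ∀ ζ : K, f ζ = h.eval (ζ : ℂ) * (starRingEnd ℂ (ζ : ℂ)) ^ N := by
    intro f hf
    rw [polynomialFunctions.starClosure_eq_adjoin_X] at hf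
    induction hf using Algebra.adjoin_induction with
    | mem f hf =>
      rcases hf with rfl | hf
      · exact ⟨X, 0, fun ζ ↦ by simp⟩
      · refine ⟨1, 1, fun ζ ↦ ?_⟩
        rw [← star_star f, Set.mem_singleton_iff.1 hf]
        simp
    | algebraMap r => exact ⟨C r, 0, fun ζ ↦ by simp⟩
    | add f g _ _ hf hg =>
      obtain ⟨h, N, hh⟩ := hf
      obtain ⟨k, M, hk⟩ := hg
      refine ⟨h * X ^ M + k * X ^ N, N + M, fun ζ ↦ ?_⟩
      have h1 : ∀ n : ℕ, (ζ : ℂ) ^ n * (starRingEnd ℂ (ζ : ℂ)) ^ n = 1 := fun n ↦ by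
        rw [← mul_pow, hconj ζ ζ.2, one_pow]
      rw [ContinuousMap.add_apply, hh, hk, pow_add]
      simp only [eval_add, eval_mul, eval_pow, eval_X]
      linear_combination -(h.eval (ζ : ℂ) * starRingEnd ℂ (ζ : ℂ) ^ N) * h1 M
        - (k.eval (ζ : ℂ) * starRingEnd ℂ (ζ : ℂ) ^ M) * h1 N
    | mul f g _ _ hf hg =>
      obtain ⟨h, N, hh⟩ := hf
      obtain ⟨k, M, hk⟩ := hg
      refine ⟨h * k, N + M, fun ζ ↦ ?_⟩
      rw [ContinuousMap.mul_apply, hh, hk, pow_add, eval_mul]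
      ring
  set f : C(K, ℂ) := ⟨K.domRestrict φ, hφ.domRestrict⟩ with hf
  have hmem : f ∈ (polynomialFunctions K).starClosure.topologicalClosure := by
    rw [polynomialFunctions.starClosure_topologicalClosure]; trivial
  obtain ⟨g, hg, hfg⟩ := Metric.mem_closure_iff.1 hmem ε hε
  obtain ⟨h, N, hh⟩ := key g hg
  refine ⟨h, N, fun ζ hζ ↦ ?_⟩
  rw [← hh ⟨ζ, hζ⟩, ← dist_eq_norm, dist_comm]
  exact (ContinuousMap.dist_apply_le_dist ⟨ζ, hζ⟩).trans_lt hfg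

lemma exists_re_eval_eq (N : ℕ) (h : ℂ[X]) :
    ∃ g : ℂ[X], ∀ z ∈ sphere (0 : ℂ) 1,
      (g.eval z).re = (h.eval z * (starRingEnd ℂ z) ^ N).re := by
  induction N generalizing h with
  | zero => exact ⟨h, fun z _ ↦ by simp⟩
  | succ N ih =>
    obtain ⟨g, hg⟩ := ih h.divX
    refine ⟨g + C (starRingEnd ℂ (h.coeff 0)) * X ^ (N + 1), fun z hz ↦ ?_⟩
    have hz1 : z * starRingEnd ℂ z = 1 := by
      rw [Complex.mul_conj, Complex.normSq_eq_norm_sq, mem_sphere_zero_iff_norm.1 hz]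
      simp
    have h1 : h.eval z * (starRingEnd ℂ z) ^ (N + 1) = h.divX.eval z * (starRingEnd ℂ z) ^ N +
        starRingEnd ℂ (starRingEnd ℂ (h.coeff 0) * z ^ (N + 1)) := by
      rw [map_mul, map_pow, Complex.conj_conj]
      linear_combination (-(starRingEnd ℂ z) ^ (N + 1)) * eval_divX_mul h z
        + h.divX.eval z * (starRingEnd ℂ z) ^ N * hz1
    rw [h1, Complex.add_re, Complex.conj_re, ← hg z hz]
    simp

/-- Real parts of polynomials are uniformly dense in the real continuous functions on the circle. -/
lemma exists_re_eval_approx {u : ℂ → ℝ} (hu : Continuous u) {δ : ℝ} (hδ : 0 < δ) :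
    ∃ g : ℂ[X], (g.eval 0).im = 0 ∧ ∀ z ∈ sphere (0 : ℂ) 1, |(g.eval z).re - u z| < δ := by
  obtain ⟨h, N, hh⟩ := exists_approx_mul_conj_pow (isCompact_sphere (0 : ℂ) 1) subset_rfl
    (φ := fun z ↦ (u z : ℂ)) (by fun_prop) hδ
  obtain ⟨g, hg⟩ := exists_re_eval_eq N h
  refine ⟨g - C (((g.eval 0).im : ℂ) * I), by simp, fun z hz ↦ ?_⟩
  have h1 := (Complex.abs_re_le_norm _).trans_lt (hh z hz)
  rw [Complex.sub_re, Complex.ofReal_re, ← hg z hz] at h1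
  simpa using h1

/-- A compact subset of the circle of zero arc length has a continuous cut-off function with
small mean. -/
lemma exists_cutoff {K : Set ℂ} (hKc : IsCompact K) (hKm : arcMeasure K = 0)
    {δ : ℝ} (hδ : 0 < δ) :
    ∃ u : ℂ → ℝ, Continuous u ∧ (∀ z, 0 ≤ u z) ∧ (∀ z ∈ K, u z = 1) ∧
      Real.circleAverage u 0 1 ≤ δ := by
  set μ : Measure ℂ := (volume.restrict (Ioc 0 (2 * Real.pi))).map (circleMap 0 1) with hμ
  have hmeas : Measurable (circleMap 0 1) := (continuous_circleMap 0 1).measurable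
  have : IsFiniteMeasure μ := Measure.isFiniteMeasure_map _ _
  have hμK : μ K = 0 := by
    rw [hμ, Measure.map_apply hmeas hKc.isClosed.measurableSet,
      ← restrict_Ico_eq_restrict_Ioc,
      Measure.restrict_apply (hmeas hKc.isClosed.measurableSet), ← hKm, arcMeasure]
    congr 1
    ext θ
    simp [circleMap, and_comm]
  have hpos : ∀ n : ℕ, (0 : ℝ) < 1 / ((n : ℝ) + 1) := fun n ↦ by positivity
  have ht := tendsto_lintegral_thickenedIndicator_of_isClosed μ hKc.isClosed hpos
    tendsto_one_div_add_atTop_nhds_zero_nat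
  rw [hμK] at ht
  obtain ⟨n, hn⟩ := (ht.eventually (gt_mem_nhds (ENNReal.ofReal_pos.2 hδ))).exists
  set τ := thickenedIndicator (hpos n) K with hτ
  have hτc : Continuous fun z ↦ (τ z : ℝ) := NNReal.continuous_coe.comp τ.continuous
  refine ⟨fun z ↦ τ z, hτc, fun z ↦ (τ z).2, fun z hz ↦ by
    dsimp only
    rw [hτ, thickenedIndicator_one (hpos n) K hz, NNReal.coe_one], ?_⟩
  have hint : ∫ θ in (0 : ℝ)..2 * Real.pi, (τ (circleMap 0 1 θ) : ℝ) = ∫ z, (τ z : ℝ) ∂μ := by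
    rw [intervalIntegral.integral_of_le Real.two_pi_pos.le, hμ,
      integral_map hmeas.aemeasurable hτc.aestronglyMeasurable]
  have hle : ∫ z, (τ z : ℝ) ∂μ ≤ δ := by
    rw [integral_eq_lintegral_of_nonneg_ae (f := fun z ↦ (τ z : ℝ))
      (Eventually.of_forall fun z ↦ (τ z).2)
      hτc.aestronglyMeasurable]
    refine ENNReal.toReal_le_of_le_ofReal hδ.le ?_
    simpa using hn.le
  rw [Real.circleAverage, hint, smul_eq_mul]
  have hpi : (2 * Real.pi)⁻¹ ≤ 1 := inv_le_one_of_one_le₀ (by linarith [Real.pi_gt_three])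
  exact (mul_le_of_le_one_left (integral_nonneg fun z ↦ (τ z).2) hpi).trans hle

/-- The exponential of a polynomial is a uniform limit of polynomials on the unit circle. -/
lemma exists_approx_exp (g : ℂ[X]) {δ : ℝ} (hδ : 0 < δ) :
    ∃ Q : ℂ[X], ∀ z ∈ sphere (0 : ℂ) 1, ‖Q.eval z - Complex.exp (g.eval z)‖ ≤ δ := by
  obtain ⟨R, hR⟩ := (isCompact_sphere (0 : ℂ) 1).exists_bound_of_continuousOn
    (f := fun z ↦ g.eval z) (by fun_prop)
  have hR0 : 0 ≤ R := (norm_nonneg _).trans (hR 1 (by simp))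
  have ht := (FloorSemiring.tendsto_pow_div_factorial_atTop R).mul_const 2
  rw [zero_mul] at ht
  obtain ⟨n, hn, hnR⟩ := ((ht.eventually (gt_mem_nhds hδ)).and
    (eventually_ge_atTop ⌈2 * R⌉₊)).exists
  refine ⟨∑ m ∈ Finset.range n, C ((m.factorial : ℂ)⁻¹) * g ^ m, fun z hz ↦ ?_⟩
  have hnR' : 2 * R ≤ n := Nat.ceil_le.1 hnR
  have hb := Complex.exp_bound' (x := g.eval z) (n := n) (by
    rw [div_le_iff₀ (by positivity), Nat.cast_succ]
    linarith [hR z hz])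
  rw [norm_sub_rev, eval_finsetSum]
  calc _ = ‖Complex.exp (g.eval z) - ∑ m ∈ Finset.range n, g.eval z ^ m / m.factorial‖ := by
        simp [div_eq_inv_mul]
    _ ≤ _ := hb
    _ ≤ R ^ n / n.factorial * 2 := by gcongr; exact hR z hz
    _ ≤ δ := hn.le

/-- Polynomials that are close to `1` on a null set of the circle, but small in mean square. -/
lemma exists_peak_s12 {K : Set ℂ} (hKc : IsCompact K) (hKT : K ⊆ sphere (0 : ℂ) 1)
    (hKm : arcMeasure K = 0) {η : ℝ} (hη : 0 < η) :
    ∃ G : ℂ[X], (∀ z ∈ sphere (0 : ℂ) 1, ‖G.eval z‖ ≤ 3) ∧ meanSq G ≤ η ^ 2 ∧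
      ∀ ζ ∈ K, ‖G.eval ζ - 1‖ ≤ η := by
  obtain ⟨M, hM0, hM⟩ : ∃ M : ℝ, 0 < M ∧ Real.exp (-M) ≤ η / 2 := by
    have := (Real.tendsto_exp_neg_atTop_nhds_zero.eventually
      (gt_mem_nhds (half_pos hη))).and (eventually_gt_atTop 0)
    obtain ⟨M, h1, h2⟩ := this.exists
    exact ⟨M, h2, h1.le⟩
  obtain ⟨τ, hτc, hτ0, hτ1, hτa⟩ := exists_cutoff hKc hKm
    (δ := η ^ 2 / (16 * M)) (by positivity)
  set δ := η ^ 2 / 32 with hδ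
  have hδ0 : 0 < δ := by positivity
  obtain ⟨g, hg0, hg⟩ := exists_re_eval_approx (u := fun z ↦ M * τ z + δ) (by fun_prop) hδ0
  have hgpos : ∀ z ∈ sphere (0 : ℂ) 1, 0 ≤ (g.eval z).re := fun z hz ↦ by
    have := (abs_lt.1 (hg z hz)).1
    nlinarith [mul_nonneg hM0.le (hτ0 z)]
  set E : ℂ → ℂ := fun z ↦ Complex.exp ((-g).eval z) with hE
  have hEd : Differentiable ℂ E := by fun_prop
  have hEc : Continuous E := hEd.continuous
  have hEn : ∀ z ∈ sphere (0 : ℂ) 1, ‖E z‖ ≤ 1 := fun z hz ↦ by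
    simpa [hE, Complex.norm_exp] using hgpos z hz
  obtain ⟨Q, hQ⟩ := exists_approx_exp (-g) (δ := min 1 (η / 2)) (by positivity)
  have hQ1 : ∀ z ∈ sphere (0 : ℂ) 1, ‖Q.eval z - E z‖ ≤ 1 := fun z hz ↦
    (hQ z hz).trans (min_le_left _ _)
  have hQ2 : ∀ z ∈ sphere (0 : ℂ) 1, ‖Q.eval z - E z‖ ≤ η / 2 := fun z hz ↦
    (hQ z hz).trans (min_le_right _ _)
  refine ⟨1 - Q, fun z hz ↦ ?_, ?_, fun ζ hζ ↦ ?_⟩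
  · calc ‖(1 - Q).eval z‖ = ‖1 - E z - (Q.eval z - E z)‖ := by simp
      _ ≤ ‖(1 : ℂ)‖ + ‖E z‖ + ‖Q.eval z - E z‖ := (norm_sub_le _ _).trans (by
          gcongr; exact norm_sub_le _ _)
      _ ≤ 1 + 1 + 1 := by
          rw [norm_one]
          gcongr
          exacts [hEn z hz, hQ1 z hz]
      _ = 3 := by norm_num
  · have hga : (g.eval 0).re ≤ η ^ 2 / 8 := by
      have hmean : Real.circleAverage (fun z ↦ (g.eval z).re) 0 1 = (g.eval 0).re := by
        have h1 := DiffContOnCl.circleAverage (f := fun z ↦ g.eval z) (c := 0) (R := 1)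
          g.differentiable.diffContOnCl
        have h2 := Complex.reCLM.circleAverage_comp_comm (f := fun z ↦ g.eval z) (c := 0) (R := 1)
          (g.continuous.continuousOn.circleIntegrable zero_le_one)
        rw [h1] at h2
        exact h2
      rw [← hmean]
      calc Real.circleAverage (fun z ↦ (g.eval z).re) 0 1
          ≤ Real.circleAverage (fun z ↦ M • τ z + 2 * δ) 0 1 :=
            Real.circleAverage_mono (circleIntegrable_of_continuous (by fun_prop))
              (circleIntegrable_of_continuous (by fun_prop)) fun z hz ↦ by
                have := (abs_lt.1 (hg z (by simpa using hz))).2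
                rw [smul_eq_mul]
                linarith
        _ = M * Real.circleAverage τ 0 1 + 2 * δ := by
            rw [Real.circleAverage_fun_add (circleIntegrable_of_continuous (by fun_prop))
              (circleIntegrable_of_continuous (by fun_prop)), Real.circleAverage_const,
              Real.circleAverage_fun_smul, smul_eq_mul]
        _ ≤ M * (η ^ 2 / (16 * M)) + 2 * δ := by gcongr
        _ = η ^ 2 / 8 := by rw [hδ]; field_simp; norm_num
    have hE0 : (E 0).re = Real.exp (-(g.eval 0).re) := by
      simp [hE, Complex.exp_re, hg0]
    have hmeanE : Real.circleAverage (fun z ↦ (E z).re) 0 1 = (E 0).re := by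
      have h1 := DiffContOnCl.circleAverage (f := E) (c := 0) (R := 1) hEd.diffContOnCl
      have h2 := Complex.reCLM.circleAverage_comp_comm (f := E) (c := 0) (R := 1)
        (hEc.continuousOn.circleIntegrable zero_le_one)
      rw [h1] at h2
      exact h2
    calc meanSq (1 - Q)
        ≤ Real.circleAverage (fun z ↦ (4 + η ^ 2 / 2) + (-4 : ℝ) • (E z).re) 0 1 := by
          refine meanSq_le_of_norm_eval_sq_le (by fun_prop) fun z hz ↦ ?_
          have h1 : ‖(1 - Q).eval z‖ ≤ ‖1 - E z‖ + ‖Q.eval z - E z‖ := by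
            refine le_trans (le_of_eq ?_) (norm_sub_le _ _)
            simp
          have h2 : ‖1 - E z‖ ^ 2 ≤ 2 - 2 * (E z).re := by
            have h3 : ‖E z‖ ^ 2 ≤ 1 := pow_le_one₀ (norm_nonneg _) (hEn z hz)
            rw [← Complex.normSq_eq_norm_sq, Complex.normSq_apply] at h3 ⊢
            simp only [Complex.sub_re, Complex.sub_im, Complex.one_re, Complex.one_im]
            nlinarith
          have h3 := pow_le_pow_left₀ (norm_nonneg _) h1 2
          have h4 := pow_le_pow_left₀ (norm_nonneg _) (hQ2 z hz) 2
          rw [smul_eq_mul]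
          nlinarith [sq_nonneg (‖1 - E z‖ - ‖Q.eval z - E z‖)]
      _ = 4 + η ^ 2 / 2 - 4 * Real.exp (-(g.eval 0).re) := by
          rw [Real.circleAverage_fun_add (circleIntegrable_of_continuous (by fun_prop))
            (circleIntegrable_of_continuous (by fun_prop)), Real.circleAverage_const,
            Real.circleAverage_fun_smul, hmeanE, hE0, smul_eq_mul]
          ring
      _ ≤ η ^ 2 := by
          have := Real.add_one_le_exp (-(g.eval 0).re)
          linarith
  · have hre : M ≤ (g.eval ζ).re := by
      have := (abs_lt.1 (hg ζ (hKT hζ))).1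
      rw [hτ1 ζ hζ] at this
      linarith
    have hEζ : ‖E ζ‖ ≤ η / 2 := by
      refine le_trans ?_ hM
      simpa [hE, Complex.norm_exp] using hre
    calc ‖(1 - Q).eval ζ - 1‖ = ‖(Q.eval ζ - E ζ) + E ζ‖ := by simp
      _ ≤ η / 2 + η / 2 := norm_add_le_of_le (hQ2 ζ (hKT hζ)) hEζ
      _ = η := add_halves η

/-- `ψ` is approximable on `K` by uniformly bounded polynomials of arbitrarily small mean square. -/
def SmallApprox (K : Set ℂ) (ψ : ℂ → ℂ) : Prop :=
  ∃ B : ℝ, ∀ η > 0, ∃ P : ℂ[X], (∀ z ∈ sphere (0 : ℂ) 1, ‖P.eval z‖ ≤ B) ∧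
    meanSq P ≤ η ^ 2 ∧ ∀ ζ ∈ K, ‖P.eval ζ - ψ ζ‖ ≤ η

lemma SmallApprox.mul_conj {K : Set ℂ} (hKT : K ⊆ sphere (0 : ℂ) 1) {ψ : ℂ → ℂ}
    (h : SmallApprox K ψ) : SmallApprox K fun ζ ↦ ψ ζ * starRingEnd ℂ ζ := by
  obtain ⟨B, hB⟩ := h
  refine ⟨B + 1, fun η hη ↦ ?_⟩
  obtain ⟨P, hPB, hPm, hPK⟩ := hB (min 1 (η / 2)) (by positivity)
  have h0 : ‖P.coeff 0‖ ≤ min 1 (η / 2) :=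
    (pow_le_pow_iff_left₀ (norm_nonneg _) (by positivity) two_ne_zero).1
      ((norm_coeff_zero_sq_le_meanSq P).trans hPm)
  refine ⟨P.divX, fun z hz ↦ ?_, ?_, fun ζ hζ ↦ ?_⟩
  · rw [norm_eval_divX hz]
    exact norm_sub_le_of_le (hPB z hz) (h0.trans (min_le_left _ _))
  · refine (meanSq_divX_le P).trans (hPm.trans ?_)
    gcongr
    exact (min_le_right _ _).trans (by linarith)
  · have hn := mem_sphere_zero_iff_norm.1 (hKT hζ)
    have hz1 : starRingEnd ℂ ζ * ζ = 1 := by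
      rw [mul_comm, Complex.mul_conj, Complex.normSq_eq_norm_sq, hn]
      simp
    calc ‖P.divX.eval ζ - ψ ζ * starRingEnd ℂ ζ‖
        = ‖(P.divX.eval ζ - ψ ζ * starRingEnd ℂ ζ) * ζ‖ := by rw [norm_mul, hn, mul_one]
      _ = ‖(P.eval ζ - ψ ζ) - P.coeff 0‖ := by
          congr 1
          linear_combination eval_divX_mul P ζ - ψ ζ * hz1
      _ ≤ η / 2 + η / 2 := norm_sub_le_of_le ((hPK ζ hζ).trans (min_le_right _ _))
          (h0.trans (min_le_right _ _))
      _ = η := add_halves η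

lemma SmallApprox.mul_conj_pow {K : Set ℂ} (hKT : K ⊆ sphere (0 : ℂ) 1) {ψ : ℂ → ℂ}
    (h : SmallApprox K ψ) (N : ℕ) : SmallApprox K fun ζ ↦ ψ ζ * (starRingEnd ℂ ζ) ^ N := by
  induction N with
  | zero => simpa using h
  | succ N ih => simpa [pow_succ, mul_assoc] using ih.mul_conj hKT

lemma smallApprox_eval {K : Set ℂ} (hKc : IsCompact K) (hKT : K ⊆ sphere (0 : ℂ) 1)
    (hKm : arcMeasure K = 0) (h : ℂ[X]) : SmallApprox K fun ζ ↦ h.eval ζ := by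
  obtain ⟨R, hR⟩ := (isCompact_sphere (0 : ℂ) 1).exists_bound_of_continuousOn
    (f := fun z ↦ h.eval z) (by fun_prop)
  have hR0 : 0 ≤ R := (norm_nonneg _).trans (hR 1 (by simp))
  refine ⟨R * 3, fun η hη ↦ ?_⟩
  obtain ⟨G, hGB, hGm, hGK⟩ := exists_peak_s12 hKc hKT hKm (η := η / (R + 1)) (by positivity)
  have hle : R * (η / (R + 1)) ≤ η := by
    rw [mul_div_assoc', div_le_iff₀ (by positivity)]
    nlinarith
  refine ⟨h * G, fun z hz ↦ ?_, ?_, fun ζ hζ ↦ ?_⟩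
  · rw [eval_mul, norm_mul]
    gcongr
    exacts [hR z hz, hGB z hz]
  · calc meanSq (h * G) ≤ R ^ 2 * meanSq G := meanSq_mul_le hR G
      _ ≤ R ^ 2 * (η / (R + 1)) ^ 2 := by gcongr
      _ = (R * (η / (R + 1))) ^ 2 := by ring
      _ ≤ η ^ 2 := by gcongr
  · calc ‖(h * G).eval ζ - h.eval ζ‖ = ‖h.eval ζ‖ * ‖G.eval ζ - 1‖ := by
          rw [← norm_mul, eval_mul]; congr 1; ring
      _ ≤ R * (η / (R + 1)) := by
          gcongr
          exacts [hR ζ (hKT hζ), hGK ζ hζ]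
      _ ≤ η := hle

/-- Lemma (hardydermerg): for compact `K ⊆ 𝕋` of zero arc length and `l ∈ ℕ`, every continuous
function on `K` can be approximated uniformly on `K` by the `l`-th derivative of a polynomial
of small `H^p` norm. -/
theorem statement_12 (p : ℝ) (hp : 1 ≤ p)
    (K : Set ℂ) (hKc : IsCompact K) (hKT : K ⊆ Metric.sphere (0:ℂ) 1)
    (hKm : arcMeasure K = 0) (l : ℕ)
    (φ : ℂ → ℂ) (hφ : ContinuousOn φ K) (ε : ℝ) (hε : 0 < ε) :
    ∃ P : Polynomial ℂ,
      hardyNorm p (fun z => P.eval z) < ε ∧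
      ∀ ζ ∈ K, ‖iteratedDeriv l (fun z => P.eval z) ζ - φ ζ‖ < ε := by
  obtain ⟨h, N, hh⟩ := exists_approx_mul_conj_pow hKc hKT hφ (half_pos hε)
  obtain ⟨B, hB⟩ := (smallApprox_eval hKc hKT hKm h).mul_conj_pow hKT N
  set b := max B 1 with hb
  have hb0 : 0 < b := lt_of_lt_of_le one_pos (le_max_right _ _)
  have hbp : 0 < b ^ (p - 1) := Real.rpow_pos_of_pos hb0 _
  have hεp : 0 < (ε / 2) ^ p := Real.rpow_pos_of_pos (half_pos hε) _
  set η := min (ε / 2) ((ε / 2) ^ p / b ^ (p - 1)) with hη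
  have hη0 : 0 < η := lt_min (half_pos hε) (div_pos hεp hbp)
  obtain ⟨F, hFB, hFm, hFK⟩ := hB η hη0
  obtain ⟨P, hP, hPB, hPm⟩ := exists_iterate_antiderivative l F
    (fun z hz ↦ (hFB z hz).trans (le_max_left B 1))
  refine ⟨P, ?_, fun ζ hζ ↦ ?_⟩
  · calc hardyNorm p (fun z ↦ P.eval z) ≤ (b ^ (p - 1) * η) ^ (1 / p) :=
          hardyNorm_le_s12 hp hη0 hPB (hPm.trans hFm)
      _ ≤ ((ε / 2) ^ p) ^ (1 / p) := by
          refine Real.rpow_le_rpow (by positivity) ?_ (by positivity)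
          rw [← le_div_iff₀' hbp]
          exact min_le_right _ _
      _ = ε / 2 := by
          rw [one_div, Real.rpow_rpow_inv (half_pos hε).le (by linarith)]
      _ < ε := half_lt_self hε
  · rw [iteratedDeriv_eval, hP]
    calc ‖F.eval ζ - φ ζ‖ ≤ ‖F.eval ζ - h.eval ζ * starRingEnd ℂ ζ ^ N‖ +
          ‖h.eval ζ * starRingEnd ℂ ζ ^ N - φ ζ‖ := norm_sub_le_norm_sub_add_norm_sub _ _ _
      _ < ε / 2 + ε / 2 :=
          add_lt_add_of_le_of_lt ((hFK ζ hζ).trans (min_le_left _ _)) (hh ζ hζ)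
      _ = ε := add_halves ε
end
end
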